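/- arXiv:math/0603585 — 3 statements merged into one kernel-verified Lean document; each statement's English description precedes it below -/
import Mathlib

section
/- Let k ≥ 2 and let (x_1, …, x_k) be a tuple in X^k \ Δ_k(X). Then (x_1, …, x_k) is an entropy tuple if and only if it is an IE-tuple. -/
open Filter Set

/-- `J ⊆ ℕ` is an independence set for the tuple `A = (A 0, …, A (k-1))` of subsets of `X`
with respect to the map `T`. -/
def IsIndepSet {X : Type*} (T : X → X) {k : ℕ} (A : Fin k → Set X) (J : Set ℕ) : Prop :=
  ∀ I : Finset ℕ, I.Nonempty → ↑I ⊆ J → ∀ σ : ℕ → Fin k,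
    (⋂ s ∈ I, T^[s] ⁻¹' A (σ s)).Nonempty

/-- `J ⊆ ℕ` has positive density: the limit of `|J ∩ {0,…,n}| / (n+1)` exists and is nonzero. -/
def HasPosDensity (J : Set ℕ) : Prop :=
  ∃ d : ℝ, d ≠ 0 ∧
    Tendsto (fun n : ℕ => (Nat.card (J ∩ Set.Iic n : Set ℕ) : ℝ) / (n + 1)) atTop (nhds d)

/-- The tuple `A` has an independence set of positive density. -/
def HasIndepSetPosDensity {X : Type*} (T : X → X) {k : ℕ} (A : Fin k → Set X) : Prop :=
  ∃ J : Set ℕ, IsIndepSet T A J ∧ HasPosDensity J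

/-- `x` is an IE-tuple: every product neighbourhood of `x` has an independence set of
positive density. -/
def IsIETuple {X : Type*} [TopologicalSpace X] (T : X → X) {k : ℕ} (x : Fin k → X) : Prop :=
  ∀ U : Fin k → Set X, (∀ i, IsOpen (U i)) → (∀ i, x i ∈ U i) →
    HasIndepSetPosDensity T U

/-- `covNumCompl T U n` is `N(𝒰 ∨ T⁻¹𝒰 ∨ ⋯ ∨ T^{-n+1}𝒰)`, the minimal cardinality of a
subcover, where `𝒰 = {(U 0)ᶜ, …, (U (k-1))ᶜ}` is the cover of `X` by the complements of
the sets `U i`. -/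
noncomputable def covNumCompl {X : Type*} (T : X → X) {k : ℕ} (U : Fin k → Set X)
    (n : ℕ) : ℕ :=
  sInf {m : ℕ | ∃ F : Finset (Fin n → Fin k), F.card = m ∧
    (⋃ σ ∈ F, ⋂ i : Fin n, T^[(i : ℕ)] ⁻¹' (U (σ i))ᶜ) = Set.univ}

/-- `x` is an entropy tuple: whenever `U_1, …, U_l` are closed pairwise disjoint
neighbourhoods of the distinct points in the list `x_1, …, x_k`, the open cover
`{U_1ᶜ, …, U_lᶜ}` has positive topological entropy (the limit of
`(1/n) log N(𝒰 ∨ ⋯ ∨ T^{-n+1}𝒰)` exists and is positive). -/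
def IsEntropyTuple {X : Type*} [TopologicalSpace X] (T : X → X) {k : ℕ}
    (x : Fin k → X) : Prop :=
  ∀ (l : ℕ) (z : Fin l → X) (U : Fin l → Set X),
    Function.Injective z → Set.range z = Set.range x →
    (∀ i, IsClosed (U i)) → (∀ i, z i ∈ interior (U i)) →
    (∀ i j, i ≠ j → Disjoint (U i) (U j)) →
    ∃ h : ℝ, 0 < h ∧
      Tendsto (fun n : ℕ => Real.log (covNumCompl T U n : ℝ) / n) atTop (nhds h)

/-- `W` is independent for the sequence of tuples `A`, with witnesses in `S`: every pattern
`σ` on `W` is realised by some point of `S`. -/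
def IsIndepOn {X : Type*} {k : ℕ} (A : ℕ → Fin k → Set X) (S : Set X) (W : Finset ℕ) : Prop :=
  ∀ σ : ℕ → Fin k, ∃ x ∈ S, ∀ s ∈ W, x ∈ A s (σ s)

open scoped Classical in
/-- The subsets of `{0, …, n - 1}` which are independent with witnesses in `S`. -/
noncomputable def indepFamily {X : Type*} {k : ℕ} (A : ℕ → Fin k → Set X) (S : Set X) (n : ℕ) :
    Finset (Finset ℕ) :=
  (Finset.range n).powerset.filter (IsIndepOn A S)

theorem mem_indepFamily {X : Type*} {k : ℕ} {A : ℕ → Fin k → Set X} {S : Set X} {n : ℕ}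
    {W : Finset ℕ} : W ∈ indepFamily A S n ↔ W ⊆ Finset.range n ∧ IsIndepOn A S W := by
  simp [indepFamily]

theorem indepFamily_mono {X : Type*} {k : ℕ} (A : ℕ → Fin k → Set X) {S S' : Set X}
    (hS : S ⊆ S') {n n' : ℕ} (hn : n ≤ n') : indepFamily A S n ⊆ indepFamily A S' n' := by
  intro W hW
  rw [mem_indepFamily] at hW ⊢
  refine ⟨hW.1.trans (Finset.range_mono hn), fun σ => ?_⟩
  obtain ⟨x, hx, h⟩ := hW.2 σ
  exact ⟨x, hS hx, h⟩

/-- Restricting to one of the `k` sets at a new coordinate shrinks the number of independent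
sets by a definite factor, for a suitable choice of the set. -/
theorem exists_card_indepFamily_inter_le {X : Type*} {k : ℕ} (hk : 2 ≤ k)
    (A : ℕ → Fin k → Set X) (S : Set X) (n : ℕ) :
    ∃ i, k * (indepFamily A (S ∩ A n i) n).card ≤
      (k - 1) * (indepFamily A S (n + 1)).card := by
  classical
  set B : Fin k → Finset (Finset ℕ) := fun i => indepFamily A (S ∩ A n i) n with hB
  set P := Finset.univ.biUnion B with hP
  set Q := P.filter (fun W => ∀ i, W ∈ B i) with hQ
  have hnW : ∀ W ∈ P, n ∉ W := by
    intro W hW hn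
    obtain ⟨i, -, hi⟩ := Finset.mem_biUnion.1 hW
    simpa using (mem_indepFamily.1 hi).1 hn
  have hsub : P ∪ Q.image (insert n) ⊆ indepFamily A S (n + 1) := by
    intro W hW
    rcases Finset.mem_union.1 hW with hW | hW
    · obtain ⟨i, -, hi⟩ := Finset.mem_biUnion.1 hW
      exact indepFamily_mono A inter_subset_left n.le_succ hi
    · obtain ⟨V, hV, rfl⟩ := Finset.mem_image.1 hW
      have hV' := (Finset.mem_filter.1 hV).2
      rw [mem_indepFamily]
      constructor
      · rw [Finset.range_add_one]
        exact Finset.insert_subset_insert n (mem_indepFamily.1 (hV' ⟨0, by omega⟩)).1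
      · intro σ
        obtain ⟨x, hx, h⟩ := (mem_indepFamily.1 (hV' (σ n))).2 σ
        refine ⟨x, hx.1, fun s hs => ?_⟩
        rcases Finset.mem_insert.1 hs with rfl | hs
        · exact hx.2
        · exact h s hs
  have hdisj : Disjoint P (Q.image (insert n)) := by
    rw [Finset.disjoint_left]
    intro W hW hW'
    obtain ⟨V, -, rfl⟩ := Finset.mem_image.1 hW'
    exact hnW _ hW (Finset.mem_insert_self _ _)
  have hinj : (Q.image (insert n)).card = Q.card := by
    refine Finset.card_image_of_injOn fun V hV V' hV' h => ?_
    have h1 := hnW V (Finset.mem_filter.1 hV).1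
    have h2 := hnW V' (Finset.mem_filter.1 hV').1
    rw [← Finset.erase_insert h1, ← Finset.erase_insert h2]
    exact congrArg (fun W => Finset.erase W n) h
  have hPQ : P.card + Q.card ≤ (indepFamily A S (n + 1)).card := by
    rw [← hinj, ← Finset.card_union_of_disjoint hdisj]
    exact Finset.card_le_card hsub
  have hsum : ∑ i, (B i).card ≤ (k - 1) * P.card + Q.card := by
    have h1 : ∀ i, (B i).card = ∑ W ∈ P, if W ∈ B i then 1 else 0 := by
      intro i
      rw [← Finset.sum_filter, Finset.sum_const, smul_eq_mul, mul_one]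
      congr 1
      ext W
      simp only [Finset.mem_filter, hP, Finset.mem_biUnion, Finset.mem_univ, true_and]
      exact ⟨fun h => ⟨⟨i, h⟩, h⟩, fun h => h.2⟩
    rw [Finset.sum_congr rfl fun i _ => h1 i, Finset.sum_comm, hQ, Finset.card_filter,
      mul_comm, ← smul_eq_mul, ← Finset.sum_const, ← Finset.sum_add_distrib]
    refine Finset.sum_le_sum fun W _ => ?_
    rw [← Finset.card_filter]
    split_ifs with h
    · refine (Finset.card_le_univ _).trans ?_
      rw [Fintype.card_fin]
      omega
    · push Not at h
      obtain ⟨i, hi⟩ := h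
      have : (Finset.univ.filter fun i => W ∈ B i) ⊆ Finset.univ.erase i := by
        intro j hj
        refine Finset.mem_erase.2 ⟨?_, Finset.mem_univ _⟩
        rintro rfl
        exact hi (Finset.mem_filter.1 hj).2
      refine (Finset.card_le_card this).trans ?_
      simp
  by_contra! hcon
  have hne : (Finset.univ : Finset (Fin k)).Nonempty := ⟨⟨0, by omega⟩, Finset.mem_univ _⟩
  have h2 := Finset.sum_lt_sum_of_nonempty hne fun i _ => hcon i
  rw [Finset.sum_const, Finset.card_univ, Fintype.card_fin, smul_eq_mul, ← Finset.mul_sum] at h2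
  have h3 := lt_of_mul_lt_mul_left h2 (Nat.zero_le _)
  have h4 : (k - 1) * P.card + Q.card ≤ (k - 1) * (indepFamily A S (n + 1)).card := by
    refine le_trans ?_ (Nat.mul_le_mul_left _ hPQ)
    rw [mul_add]
    gcongr
    exact Nat.le_mul_of_pos_left _ (by omega)
  exact absurd (hsum.trans h4) (not_le.2 h3)

/-- A set is covered by few boxes `⋂ i, (A i (σ i))ᶜ` if it has few independent sets. -/
theorem exists_cover_card_le {X : Type*} {k : ℕ} (hk : 2 ≤ k) (A : ℕ → Fin k → Set X)
    (hA : ∀ n i j, i ≠ j → Disjoint (A n i) (A n j)) (a n : ℕ) (S : Set X) :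
    ∃ F : Finset (Fin n → Fin k), (∀ x ∈ S, ∃ σ ∈ F, ∀ i : Fin n, x ∉ A i (σ i)) ∧
      (F.card : ℝ) ≤ (1 + (1 - 1 / (k : ℝ)) ^ a) ^ n *
        ((indepFamily A S n).card : ℝ) ^ a := by
  classical
  have hk0 : (0 : ℝ) < k := by exact_mod_cast (by omega : 0 < k)
  have hq : (0 : ℝ) ≤ 1 - 1 / (k : ℝ) := by
    rw [sub_nonneg, div_le_one hk0]
    exact_mod_cast (by omega : 1 ≤ k)
  induction n generalizing S with
  | zero =>
    rcases S.eq_empty_or_nonempty with rfl | ⟨x, hx⟩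
    · exact ⟨∅, by simp, by simp⟩
    · refine ⟨Finset.univ, fun y _ => ⟨finZeroElim, Finset.mem_univ _, fun i => i.elim0⟩, ?_⟩
      have h : ∅ ∈ indepFamily A S 0 := mem_indepFamily.2 ⟨by simp, fun σ => ⟨x, hx, by simp⟩⟩
      have h1 : (1 : ℝ) ≤ (indepFamily A S 0).card := by
        exact_mod_cast Finset.card_pos.2 ⟨_, h⟩
      simpa using one_le_pow₀ h1
  | succ n ih =>
    obtain ⟨i, hi⟩ := exists_card_indepFamily_inter_le hk A S n
    obtain ⟨F₁, hF₁, hc₁⟩ := ih (S ∩ A n i)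
    obtain ⟨F₂, hF₂, hc₂⟩ := ih (S \ A n i)
    obtain ⟨i', hi'⟩ : ∃ i' : Fin k, i' ≠ i := by
      have : Nontrivial (Fin k) := Fin.nontrivial_iff_two_le.2 hk
      exact exists_ne i
    let e : Fin k → (Fin n → Fin k) → (Fin (n + 1) → Fin k) :=
      fun j σ => Fin.snoc (α := fun _ => Fin k) σ j
    have he : ∀ j σ x, (∀ m : Fin n, x ∉ A m (σ m)) → x ∉ A n j →
        ∀ m : Fin (n + 1), x ∉ A m (e j σ m) := by
      intro j σ x h1 h2 m
      refine Fin.lastCases ?_ (fun m => ?_) m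
      · simpa [e] using h2
      · simpa [e] using h1 m
    refine ⟨F₁.image (e i') ∪ F₂.image (e i), fun x hx => ?_, ?_⟩
    · by_cases hxi : x ∈ A n i
      · obtain ⟨σ, hσ, h⟩ := hF₁ x ⟨hx, hxi⟩
        exact ⟨e i' σ, Finset.mem_union_left _ (Finset.mem_image_of_mem _ hσ),
          he _ _ _ h fun h' => Set.disjoint_left.1 (hA n i' i hi') h' hxi⟩
      · obtain ⟨σ, hσ, h⟩ := hF₂ x ⟨hx, hxi⟩
        exact ⟨e i σ, Finset.mem_union_right _ (Finset.mem_image_of_mem _ hσ), he _ _ _ h hxi⟩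
    · set H := ((indepFamily A S (n + 1)).card : ℝ)
      set q := 1 - 1 / (k : ℝ)
      have h1 : ((indepFamily A (S ∩ A n i) n).card : ℝ) ≤ q * H := by
        have hi2 : (k : ℝ) * ((indepFamily A (S ∩ A n i) n).card : ℝ) ≤ (k - 1) * H := by
          have := (Nat.cast_le (α := ℝ)).2 hi
          push_cast [Nat.cast_sub (by omega : 1 ≤ k)] at this
          exact this
        have : q * H = (k - 1) * H / k := by
          simp only [q]; field_simp
        rw [this, le_div_iff₀ hk0]
        linarith
      have h2 : ((indepFamily A (S \ A n i) n).card : ℝ) ≤ H :=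
        Nat.cast_le.2 (Finset.card_le_card (indepFamily_mono A sdiff_subset n.le_succ))
      have hcard : ((F₁.image (e i') ∪ F₂.image (e i)).card : ℝ) ≤ F₁.card + F₂.card := by
        exact_mod_cast (Finset.card_union_le _ _).trans
          (add_le_add Finset.card_image_le Finset.card_image_le)
      calc _ ≤ (F₁.card : ℝ) + F₂.card := hcard
        _ ≤ (1 + q ^ a) ^ n * (q * H) ^ a + (1 + q ^ a) ^ n * H ^ a := by
            refine add_le_add (hc₁.trans ?_) (hc₂.trans ?_) <;> gcongr
        _ = (1 + q ^ a) ^ (n + 1) * H ^ a := by rw [mul_pow]; ring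

/-- A family of subsets of `{0, …, n - 1}` of exponential size has a member of size
proportional to `n`. -/
theorem exists_mul_le_card_of_exp_le {η : ℝ} (hη : 0 < η) {n : ℕ} (hn : 0 < n)
    (G : Finset (Finset ℕ)) (hG : ∀ W ∈ G, W ⊆ Finset.range n)
    (hcard : Real.exp (η * n) ≤ G.card) : ∃ W ∈ G, η ^ 2 / 9 * n ≤ W.card := by
  by_contra! hcon
  have hn' : (0 : ℝ) < n := by exact_mod_cast hn
  set y := Real.exp (-(3 / η)) with hy
  have hyη : y ≤ η / 3 := by
    rw [hy, Real.exp_neg, inv_le_comm₀ (Real.exp_pos _) (by positivity), inv_div]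
    linarith [Real.add_one_le_exp (3 / η)]
  have h1 : ∑ W ∈ (Finset.range n).powerset, y ^ W.card = (1 + y) ^ n := by
    have := Finset.sum_pow_mul_eq_add_pow y 1 (Finset.range n)
    simpa [add_comm] using this
  have h2 : (G.card : ℝ) * Real.exp (-(η / 3 * n)) ≤ ∑ W ∈ G, y ^ W.card := by
    rw [← nsmul_eq_mul, ← Finset.sum_const]
    refine Finset.sum_le_sum fun W hW => ?_
    rw [hy, ← Real.exp_nat_mul, Real.exp_le_exp]
    have := (hcon W hW).le
    have h3 : (W.card : ℝ) * (3 / η) ≤ η ^ 2 / 9 * n * (3 / η) := by gcongr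
    have h4 : η ^ 2 / 9 * n * (3 / η) = η / 3 * n := by field_simp; ring
    linarith
  have h3 : ∑ W ∈ G, y ^ W.card ≤ (1 + y) ^ n := by
    rw [← h1]
    refine Finset.sum_le_sum_of_subset_of_nonneg
      (fun W hW => Finset.mem_powerset.2 (hG W hW)) fun W _ _ => by positivity
  have h4 : (1 + y) ^ n ≤ Real.exp (η / 3 * n) := by
    have : 1 + y ≤ Real.exp (η / 3) := by linarith [Real.add_one_le_exp (η / 3)]
    calc (1 + y) ^ n ≤ Real.exp (η / 3) ^ n := by gcongr
      _ = _ := by rw [← Real.exp_nat_mul, mul_comm]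
  have h5 : Real.exp (η * n) * Real.exp (-(η / 3 * n)) ≤ Real.exp (η / 3 * n) :=
    (mul_le_mul_of_nonneg_right hcard (Real.exp_pos _).le).trans (h2.trans (h3.trans h4))
  rw [← Real.exp_add, Real.exp_le_exp] at h5
  nlinarith [mul_pos hη hn']

/-- The tuples `(T⁻ⁿ U 0, …, T⁻ⁿ U (k - 1))`. -/
def preimageSeq {X : Type*} (T : X → X) {k : ℕ} (U : Fin k → Set X) (n : ℕ) (i : Fin k) : Set X :=
  T^[n] ⁻¹' U i

theorem iUnion_iInter_eq_univ_iff {X : Type*} (T : X → X) {k : ℕ} (U : Fin k → Set X) {n : ℕ}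
    (F : Finset (Fin n → Fin k)) :
    (⋃ σ ∈ F, ⋂ i : Fin n, T^[(i : ℕ)] ⁻¹' (U (σ i))ᶜ) = Set.univ ↔
      ∀ x, ∃ σ ∈ F, ∀ i : Fin n, x ∉ preimageSeq T U i (σ i) := by
  simp [Set.eq_univ_iff_forall, preimageSeq]

theorem covNumCompl_le {X : Type*} (T : X → X) {k : ℕ} (U : Fin k → Set X) {n : ℕ}
    (F : Finset (Fin n → Fin k))
    (hF : ∀ x, ∃ σ ∈ F, ∀ i : Fin n, x ∉ preimageSeq T U i (σ i)) :
    covNumCompl T U n ≤ F.card :=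
  Nat.sInf_le ⟨F, rfl, (iUnion_iInter_eq_univ_iff T U F).2 hF⟩

theorem preimageSeq_disjoint {X : Type*} (T : X → X) {k : ℕ} {U : Fin k → Set X}
    (hU : ∀ i j, i ≠ j → Disjoint (U i) (U j)) (n : ℕ) (i j : Fin k) (hij : i ≠ j) :
    Disjoint (preimageSeq T U n i) (preimageSeq T U n j) :=
  (hU i j hij).preimage _

theorem exists_cover_card_eq {X : Type*} (T : X → X) {k : ℕ} (hk : 2 ≤ k) (U : Fin k → Set X)
    (hU : ∀ i j, i ≠ j → Disjoint (U i) (U j)) (n : ℕ) :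
    ∃ F : Finset (Fin n → Fin k), F.card = covNumCompl T U n ∧
      ∀ x, ∃ σ ∈ F, ∀ i : Fin n, x ∉ preimageSeq T U i (σ i) := by
  have hne : {m : ℕ | ∃ F : Finset (Fin n → Fin k), F.card = m ∧
      (⋃ σ ∈ F, ⋂ i : Fin n, T^[(i : ℕ)] ⁻¹' (U (σ i))ᶜ) = Set.univ}.Nonempty := by
    obtain ⟨F, hF, -⟩ := exists_cover_card_le hk _ (preimageSeq_disjoint T hU) 0 n Set.univ
    exact ⟨_, F, rfl, (iUnion_iInter_eq_univ_iff T U F).2 fun x => hF x trivial⟩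
  obtain ⟨F, h1, h2⟩ := Nat.sInf_mem hne
  exact ⟨F, h1, (iUnion_iInter_eq_univ_iff T U F).1 h2⟩

theorem covNumCompl_pos {X : Type*} [Nonempty X] (T : X → X) {k : ℕ} (hk : 2 ≤ k)
    (U : Fin k → Set X) (hU : ∀ i j, i ≠ j → Disjoint (U i) (U j)) (n : ℕ) :
    0 < covNumCompl T U n := by
  obtain ⟨F, hF, h⟩ := exists_cover_card_eq T hk U hU n
  obtain ⟨σ, hσ, -⟩ := h (Classical.arbitrary X)
  rw [← hF]
  exact Finset.card_pos.2 ⟨σ, hσ⟩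

theorem covNumCompl_add_le {X : Type*} (T : X → X) {k : ℕ} (hk : 2 ≤ k)
    (U : Fin k → Set X) (hU : ∀ i j, i ≠ j → Disjoint (U i) (U j)) (m n : ℕ) :
    covNumCompl T U (m + n) ≤ covNumCompl T U m * covNumCompl T U n := by
  classical
  obtain ⟨F, hF, hF'⟩ := exists_cover_card_eq T hk U hU m
  obtain ⟨G, hG, hG'⟩ := exists_cover_card_eq T hk U hU n
  rw [← hF, ← hG, ← Finset.card_product]
  refine (covNumCompl_le T U ((F ×ˢ G).image fun p => Fin.append p.1 p.2) fun x => ?_).trans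
    Finset.card_image_le
  obtain ⟨σ, hσ, h⟩ := hF' x
  obtain ⟨τ, hτ, h'⟩ := hG' (T^[m] x)
  refine ⟨_, Finset.mem_image_of_mem _ (Finset.mk_mem_product hσ hτ), fun i => ?_⟩
  refine Fin.addCases (fun i => ?_) (fun i => ?_) i
  · simpa using h i
  · have := h' i
    simp only [preimageSeq, Set.mem_preimage, ← Function.iterate_add_apply] at this
    simpa [preimageSeq, add_comm m] using this

/-- The limit defining the topological entropy exists. -/
theorem exists_tendsto_log_covNumCompl_div {X : Type*} [Nonempty X] (T : X → X) {k : ℕ}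
    (hk : 2 ≤ k) (U : Fin k → Set X) (hU : ∀ i j, i ≠ j → Disjoint (U i) (U j)) :
    ∃ h : ℝ, Tendsto (fun n : ℕ => Real.log (covNumCompl T U n : ℝ) / n) atTop (nhds h) := by
  have hpos : ∀ n, (0 : ℝ) < covNumCompl T U n := fun n => by
    exact_mod_cast covNumCompl_pos T hk U hU n
  have hsub : Subadditive fun n : ℕ => Real.log (covNumCompl T U n : ℝ) := by
    intro m n
    rw [← Real.log_mul (hpos m).ne' (hpos n).ne']
    refine Real.log_le_log (hpos _) ?_
    exact_mod_cast covNumCompl_add_le T hk U hU m n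
  refine ⟨_, hsub.tendsto_lim ⟨0, ?_⟩⟩
  rintro _ ⟨n, rfl⟩
  exact div_nonneg (Real.log_natCast_nonneg _) n.cast_nonneg

theorem pow_card_le_covNumCompl_mul {X : Type*} (T : X → X) {k : ℕ} (hk : 2 ≤ k)
    (U : Fin k → Set X) (hU : ∀ i j, i ≠ j → Disjoint (U i) (U j)) {n : ℕ} {W : Finset ℕ}
    (hW : W ∈ indepFamily (preimageSeq T U) Set.univ n) :
    k ^ W.card ≤ covNumCompl T U n * (k - 1) ^ W.card := by
  classical
  obtain ⟨hWn, hWi⟩ := mem_indepFamily.1 hW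
  obtain ⟨F, hF, hF'⟩ := exists_cover_card_eq T hk U hU n
  let r : W → Fin n := fun s => ⟨s, Finset.mem_range.1 (hWn s.2)⟩
  have hcov : (Finset.univ : Finset (W → Fin k)) ⊆
      F.biUnion fun σ => Fintype.piFinset fun s : W => {σ (r s)}ᶜ := by
    intro τ _
    obtain ⟨x, -, hx⟩ := hWi fun s => if hs : s ∈ W then τ ⟨s, hs⟩ else ⟨0, by omega⟩
    obtain ⟨σ, hσ, h⟩ := hF' x
    refine Finset.mem_biUnion.2 ⟨σ, hσ, Fintype.mem_piFinset.2 fun s => ?_⟩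
    rw [Finset.mem_compl, Finset.mem_singleton]
    intro heq
    have h1 := hx s s.2
    rw [dif_pos s.2, Subtype.coe_eta, heq] at h1
    exact h (r s) h1
  have := (Finset.card_le_card hcov).trans Finset.card_biUnion_le
  simpa [Fintype.card_piFinset, Finset.card_compl, hF] using this

theorem isIndepSet_iff {X : Type*} [Nonempty X] (T : X → X) {k : ℕ} (U : Fin k → Set X)
    (J : Set ℕ) :
    IsIndepSet T U J ↔ ∀ I : Finset ℕ, ↑I ⊆ J → IsIndepOn (preimageSeq T U) Set.univ I := by
  constructor
  · intro h I hI σ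
    rcases I.eq_empty_or_nonempty with rfl | hne
    · exact ⟨Classical.arbitrary X, trivial, by simp⟩
    · obtain ⟨x, hx⟩ := h I hne hI σ
      exact ⟨x, trivial, by simpa [preimageSeq] using hx⟩
  · intro h I _ hI σ
    obtain ⟨x, -, hx⟩ := h I hI σ
    exact ⟨x, by simpa [preimageSeq] using hx⟩

theorem natCard_inter_Iic (J : Set ℕ) [DecidablePred (· ∈ J)] (n : ℕ) :
    Nat.card (J ∩ Set.Iic n : Set ℕ) = ((Finset.range (n + 1)).filter (· ∈ J)).card := by
  rw [Nat.card_coe_set_eq, ← Set.ncard_coe_finset]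
  congr 1
  ext m
  simp [and_comm]

/-- An independence set of positive density forces positive entropy. -/
theorem exists_pos_tendsto_of_hasIndepSetPosDensity {X : Type*} [Nonempty X] (T : X → X) {k : ℕ}
    (hk : 2 ≤ k) (U : Fin k → Set X) (hU : ∀ i j, i ≠ j → Disjoint (U i) (U j))
    (h : HasIndepSetPosDensity T U) :
    ∃ h : ℝ, 0 < h ∧
      Tendsto (fun n : ℕ => Real.log (covNumCompl T U n : ℝ) / n) atTop (nhds h) := by
  classical
  obtain ⟨J, hJ, d, hd0, hd⟩ := h
  rw [isIndepSet_iff] at hJ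
  have hdpos : 0 < d := lt_of_le_of_ne (ge_of_tendsto' hd fun n => by positivity) hd0.symm
  obtain ⟨h, hh⟩ := exists_tendsto_log_covNumCompl_div T hk U hU
  refine ⟨h, ?_, hh⟩
  have hk0 : (0 : ℝ) < k := by exact_mod_cast (by omega : 0 < k)
  have hk1 : (0 : ℝ) < k - 1 := by
    have : (2 : ℝ) ≤ k := by exact_mod_cast hk
    linarith
  have hc : 0 < Real.log (k / (k - 1)) := Real.log_pos (by rw [lt_div_iff₀ hk1]; linarith)
  refine (mul_pos hdpos hc).trans_le ?_
  refine le_of_tendsto_of_tendsto' (hd.mul_const _) ((tendsto_add_atTop_iff_nat 1).2 hh)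
    fun n => ?_
  rw [natCard_inter_Iic]
  set W := (Finset.range (n + 1)).filter (· ∈ J)
  have hW : W ∈ indepFamily (preimageSeq T U) Set.univ (n + 1) :=
    mem_indepFamily.2 ⟨Finset.filter_subset _ _, hJ W fun s hs => (Finset.mem_filter.1 hs).2⟩
  have h1 := (Nat.cast_le (α := ℝ)).2 (pow_card_le_covNumCompl_mul T hk U hU hW)
  push_cast [Nat.cast_sub (by omega : 1 ≤ k)] at h1
  rw [div_mul_eq_mul_div]
  push_cast
  gcongr
  rw [← Real.log_pow]
  refine Real.log_le_log (by positivity) ?_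
  rwa [div_pow, div_le_iff₀ (by positivity)]

/-- Positive entropy produces independent sets of size proportional to `n`. -/
theorem exists_pos_eventually_indepFamily {X : Type*} [Nonempty X] (T : X → X) {k : ℕ}
    (hk : 2 ≤ k) (U : Fin k → Set X) (hU : ∀ i j, i ≠ j → Disjoint (U i) (U j)) {h : ℝ}
    (hpos : 0 < h)
    (hh : Tendsto (fun n : ℕ => Real.log (covNumCompl T U n : ℝ) / n) atTop (nhds h)) :
    ∃ c : ℝ, 0 < c ∧ ∀ᶠ n : ℕ in atTop,
      ∃ W ∈ indepFamily (preimageSeq T U) Set.univ n, c * n ≤ W.card := by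
  have hk0 : (0 : ℝ) < k := by exact_mod_cast (by omega : 0 < k)
  have hq0 : (0 : ℝ) ≤ 1 - 1 / (k : ℝ) := by
    rw [sub_nonneg, div_le_one hk0]
    exact_mod_cast (by omega : 1 ≤ k)
  have hq1 : 1 - 1 / (k : ℝ) < 1 := by
    have : (0 : ℝ) < 1 / k := by positivity
    linarith
  obtain ⟨a, ha⟩ := exists_pow_lt_of_lt_one (by positivity : 0 < h / 4) hq1
  set q := 1 - 1 / (k : ℝ)
  set η := h / 4 / (a + 1) with hη
  have hηpos : 0 < η := by positivity
  refine ⟨η ^ 2 / 9, by positivity, ?_⟩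
  filter_upwards [hh.eventually_const_lt (half_lt_self hpos), eventually_gt_atTop 0] with n hn hn0
  have hn' : (0 : ℝ) < n := by exact_mod_cast hn0
  obtain ⟨F, hF, hFc⟩ :=
    exists_cover_card_le hk _ (preimageSeq_disjoint T hU) a n Set.univ
  set G := indepFamily (preimageSeq T U) Set.univ n
  have hGpos : 0 < G.card := Finset.card_pos.2 ⟨∅, mem_indepFamily.2
    ⟨by simp, fun σ => ⟨Classical.arbitrary X, trivial, by simp⟩⟩⟩
  have hGpos' : (0 : ℝ) < G.card := by exact_mod_cast hGpos
  refine exists_mul_le_card_of_exp_le hηpos hn0 G (fun W hW => (mem_indepFamily.1 hW).1) ?_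
  rw [← Real.le_log_iff_exp_le hGpos']
  have hlogG : 0 ≤ Real.log G.card := Real.log_natCast_nonneg _
  have hcov : (covNumCompl T U n : ℝ) ≤ (1 + q ^ a) ^ n * (G.card : ℝ) ^ a := by
    refine le_trans ?_ hFc
    exact_mod_cast covNumCompl_le T U F fun x => hF x trivial
  have hlog : Real.log (covNumCompl T U n : ℝ) ≤ n * q ^ a + a * Real.log G.card := by
    have hqa : 0 < 1 + q ^ a := by positivity
    have hc0 : (0 : ℝ) < covNumCompl T U n := by exact_mod_cast covNumCompl_pos T hk U hU n
    refine (Real.log_le_log hc0 hcov).trans ?_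
    rw [Real.log_mul (by positivity) (by positivity), Real.log_pow, Real.log_pow]
    gcongr
    linarith [Real.log_le_sub_one_of_pos hqa]
  rw [lt_div_iff₀ hn'] at hn
  have h1 : (n : ℝ) * q ^ a ≤ n * (h / 4) := by gcongr
  have h2 : h / 4 * n ≤ (a + 1) * Real.log G.card := by nlinarith
  rw [hη, div_mul_eq_mul_div, div_le_iff₀ (by positivity)]
  linarith

section Density

variable {P : Finset ℕ → Prop}

open scoped Classical in
/-- The largest cardinality of a subset of `{0, …, n - 1}` satisfying `P`. -/
noncomputable def maxCard (P : Finset ℕ → Prop) (n : ℕ) : ℕ :=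
  ((Finset.range n).powerset.filter P).sup Finset.card

theorem card_le_maxCard {n : ℕ} {I : Finset ℕ} (hI : I ⊆ Finset.range n) (hP : P I) :
    I.card ≤ maxCard P n := by
  classical
  exact Finset.le_sup (f := Finset.card)
    (Finset.mem_filter.2 ⟨Finset.mem_powerset.2 hI, hP⟩)

theorem maxCard_le {n m : ℕ} (h : ∀ I ⊆ Finset.range n, P I → I.card ≤ m) :
    maxCard P n ≤ m := by
  classical
  refine Finset.sup_le fun I hI => ?_
  rw [Finset.mem_filter, Finset.mem_powerset] at hI
  exact h I hI.1 hI.2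

/-- The part of `I` in `{s, …, s + m - 1}`, moved to the origin. -/
def window (I : Finset ℕ) (s m : ℕ) : Finset ℕ :=
  (Finset.range m).filter fun i => i + s ∈ I

theorem window_subset (I : Finset ℕ) (s m : ℕ) : window I s m ⊆ Finset.range m :=
  Finset.filter_subset _ _

theorem card_window_add (I : Finset ℕ) (s m n : ℕ) :
    (window I s (m + n)).card = (window I s m).card + (window I (s + m) n).card := by
  have h : (window I (s + m) n).card = ((window I (s + m) n).map (addLeftEmbedding m)).card :=
    (Finset.card_map _).symm
  rw [h, ← Finset.card_union_of_disjoint]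
  · congr 1
    ext i
    simp only [window, Finset.mem_filter, Finset.mem_range, Finset.mem_union, Finset.mem_map,
      addLeftEmbedding_apply]
    constructor
    · rintro ⟨h1, h2⟩
      by_cases him : i < m
      · exact Or.inl ⟨him, h2⟩
      · refine Or.inr ⟨i - m, ⟨by omega, ?_⟩, by omega⟩
        rwa [show i - m + (s + m) = i + s by omega]
    · rintro (⟨h1, h2⟩ | ⟨j, ⟨h1, h2⟩, rfl⟩)
      · exact ⟨by omega, h2⟩
      · refine ⟨by omega, ?_⟩
        rwa [show m + j + s = j + (s + m) by omega]
  · rw [Finset.disjoint_left]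
    intro i hi hi'
    have := Finset.mem_range.1 (window_subset _ _ _ hi)
    obtain ⟨j, -, rfl⟩ := Finset.mem_map.1 hi'
    simp only [addLeftEmbedding_apply] at this
    omega

theorem window_zero_eq {I : Finset ℕ} {n : ℕ} (hI : I ⊆ Finset.range n) : window I 0 n = I := by
  ext i
  simp only [window, add_zero, Finset.mem_filter, and_iff_right_iff_imp]
  exact fun h => hI h

theorem subadditive_maxCard (hshift : ∀ I s m, P I → P (window I s m)) :
    Subadditive fun n => (maxCard P n : ℝ) := by
  intro m n
  beta_reduce
  have : maxCard P (m + n) ≤ maxCard P m + maxCard P n := by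
    refine maxCard_le fun I hI hP => ?_
    rw [← window_zero_eq hI, card_window_add]
    exact add_le_add (card_le_maxCard (window_subset _ _ _) (hshift _ _ _ hP))
      (card_le_maxCard (window_subset _ _ _) (hshift _ _ _ hP))
  exact_mod_cast this

/-- If the growth rate of `maxCard P` exceeds `e`, there are sets satisfying `P` all of whose
initial segments up to length `M` have density at least `e`. -/
theorem exists_forall_mul_le_card_filter (hshift : ∀ I s m, P I → P (window I s m)) {d e : ℝ}
    (he : 0 ≤ e) (hed : e < d) (hd : ∀ n, d * n ≤ maxCard P n) (M : ℕ) :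
    ∃ J, P J ∧ ∀ m ≤ M, e * m ≤ (window J 0 m).card := by
  by_contra! hcon
  have key : ∀ I, P I → ∀ n s, ((window I s n).card : ℝ) ≤ e * n + M := by
    intro I hI n
    induction n using Nat.strong_induction_on with
    | _ n ih =>
      intro s
      rcases le_or_gt n M with hnM | hnM
      · have h1 := Finset.card_le_card (window_subset I s n)
        rw [Finset.card_range] at h1
        have h2 : ((window I s n).card : ℝ) ≤ M := by exact_mod_cast h1.trans hnM
        have : 0 ≤ e * n := by positivity
        linarith
      · obtain ⟨m, hmM, hm⟩ := hcon _ (hshift I s M hI)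
        have hw : window (window I s M) 0 m = window I s m := by
          ext i
          simp only [window, Finset.mem_filter, Finset.mem_range, add_zero]
          constructor
          · rintro ⟨h1, -, h2⟩
            exact ⟨h1, h2⟩
          · rintro ⟨h1, h2⟩
            exact ⟨h1, by omega, h2⟩
        rw [hw] at hm
        have hm0 : 0 < m := by
          rcases Nat.eq_zero_or_pos m with rfl | h
          · simp [window] at hm
          · exact h
        obtain ⟨r, rfl⟩ : ∃ r, n = m + r := ⟨n - m, by omega⟩
        have := ih r (by omega) (s + m)
        rw [card_window_add]
        push_cast
        linarith
  obtain ⟨n, hn⟩ := exists_nat_gt ((M : ℝ) / (d - e))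
  have h1 : (maxCard P n : ℝ) ≤ e * n + M := by
    have h0 : 0 ≤ e * n + M := by positivity
    refine (Nat.cast_le.2 (maxCard_le (m := ⌊e * n + M⌋₊) fun I hI hP => ?_)).trans
      (Nat.floor_le h0)
    rw [Nat.le_floor_iff h0]
    simpa [window_zero_eq hI] using key I hP n 0
  rw [div_lt_iff₀ (by linarith)] at hn
  nlinarith [hd n]

/-- A hereditary and shift invariant property of finite sets satisfied by sets of size
proportional to `n` in `{0, …, n - 1}` is satisfied by all finite subsets of some set of
positive density. -/
theorem exists_hasPosDensity (hmono : ∀ I J, I ⊆ J → P J → P I)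
    (hshift : ∀ I s m, P I → P (window I s m)) {c : ℝ} (hc : 0 < c)
    (hlarge : ∀ᶠ n : ℕ in atTop, ∃ I ⊆ Finset.range n, P I ∧ c * n ≤ I.card) :
    ∃ J : Set ℕ, (∀ I : Finset ℕ, ↑I ⊆ J → P I) ∧ HasPosDensity J := by
  classical
  have hsub := subadditive_maxCard hshift
  have hbdd : BddBelow (Set.range fun n : ℕ => (maxCard P n : ℝ) / n) := by
    refine ⟨0, ?_⟩
    rintro _ ⟨n, rfl⟩
    positivity
  have hlim := hsub.tendsto_lim hbdd
  set d := hsub.lim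
  have hd : ∀ n : ℕ, d * n ≤ maxCard P n := by
    intro n
    rcases Nat.eq_zero_or_pos n with rfl | hn
    · simp
    · rw [← le_div_iff₀ (by exact_mod_cast hn)]
      exact hsub.lim_le_div hbdd hn.ne'
  have hdpos : 0 < d := by
    refine hc.trans_le (ge_of_tendsto hlim ?_)
    filter_upwards [hlarge, eventually_gt_atTop 0] with n ⟨I, hI, hP, hcI⟩ hn
    rw [le_div_iff₀ (by exact_mod_cast hn)]
    exact hcI.trans (Nat.cast_le.2 (card_le_maxCard hI hP))
  have hex : ∀ M : ℕ, ∃ J, P J ∧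
      ∀ m ≤ M, d * (1 - 1 / ((M : ℝ) + 1)) * m ≤ (window J 0 m).card := by
    intro M
    have hM : (0 : ℝ) < 1 / ((M : ℝ) + 1) := by positivity
    have hM1 : 1 / ((M : ℝ) + 1) ≤ 1 := by
      rw [div_le_one (by positivity)]
      linarith [M.cast_nonneg (α := ℝ)]
    exact exists_forall_mul_le_card_filter hshift (mul_nonneg hdpos.le (by linarith))
      (by nlinarith) hd M
  choose J hJP hJ using hex
  set u := hyperfilter ℕ
  have hu : (u : Filter ℕ) ≤ atTop := Nat.hyperfilter_le_atTop
  set K : Set ℕ := {i | ∀ᶠ M in (u : Filter ℕ), i ∈ J M} with hK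
  have hKP : ∀ I : Finset ℕ, ↑I ⊆ K → P I := by
    intro I hI
    have : ∀ᶠ M in (u : Filter ℕ), ∀ i ∈ I, i ∈ J M :=
      (Filter.eventually_all_finset I).2 fun i hi => hI hi
    obtain ⟨M, hM⟩ := this.exists
    exact hmono _ _ hM (hJP M)
  have hlower : ∀ m : ℕ, d * m ≤ ((Finset.range m).filter (· ∈ K)).card := by
    intro m
    have hev : ∀ᶠ M in (u : Filter ℕ), ∀ i ∈ Finset.range m, (i ∈ J M ↔ i ∈ K) := by
      refine (Filter.eventually_all_finset _).2 fun i _ => ?_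
      by_cases hi : i ∈ K
      · filter_upwards [hi] with M hM
        simp [hM, hi]
      · filter_upwards [Ultrafilter.eventually_not.2 hi] with M hM
        simp [hM, hi]
    have htend : Tendsto (fun M : ℕ => d * (1 - 1 / ((M : ℝ) + 1)) * m) u (nhds (d * m)) := by
      have h1 := (tendsto_one_div_add_atTop_nhds_zero_nat (𝕜 := ℝ)).mono_left hu
      simpa using ((h1.const_sub 1).const_mul d).mul_const (m : ℝ)
    refine le_of_tendsto htend ?_
    filter_upwards [hev, hu (eventually_ge_atTop m)] with M hM hmM
    refine (hJ M m hmM).trans_eq ?_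
    congr 2
    ext i
    simp only [window, add_zero, Finset.mem_filter]
    exact and_congr_right fun hi => hM i hi
  refine ⟨K, hKP, d, hdpos.ne', ?_⟩
  refine tendsto_of_tendsto_of_tendsto_of_le_of_le tendsto_const_nhds
    ((tendsto_add_atTop_iff_nat 1).2 hlim) (fun n => ?_) (fun n => ?_)
  · have := hlower (n + 1)
    rw [natCard_inter_Iic, le_div_iff₀ (by positivity)]
    exact_mod_cast this
  · have := card_le_maxCard (Finset.filter_subset (· ∈ K) (Finset.range (n + 1)))
      (hKP _ fun i hi => (Finset.mem_filter.1 hi).2)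
    simp only [natCard_inter_Iic]
    push_cast
    gcongr

end Density

theorem IsIndepOn.window {X : Type*} {T : X → X} {k : ℕ} {U : Fin k → Set X} {I : Finset ℕ}
    (h : IsIndepOn (preimageSeq T U) Set.univ I) (s m : ℕ) :
    IsIndepOn (preimageSeq T U) Set.univ (window I s m) := by
  intro σ
  obtain ⟨x, -, hx⟩ := h fun i => σ (i - s)
  refine ⟨T^[s] x, trivial, fun i hi => ?_⟩
  have := hx (i + s) (Finset.mem_filter.1 hi).2
  rw [Nat.add_sub_cancel] at this
  simpa only [preimageSeq, Set.mem_preimage, Function.iterate_add_apply] using this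

theorem hasIndepSetPosDensity_of_tendsto {X : Type*} [Nonempty X] (T : X → X) {k : ℕ}
    (hk : 2 ≤ k) (U : Fin k → Set X) (hU : ∀ i j, i ≠ j → Disjoint (U i) (U j)) {h : ℝ}
    (hpos : 0 < h)
    (hh : Tendsto (fun n : ℕ => Real.log (covNumCompl T U n : ℝ) / n) atTop (nhds h)) :
    HasIndepSetPosDensity T U := by
  obtain ⟨c, hc, hev⟩ := exists_pos_eventually_indepFamily T hk U hU hpos hh
  obtain ⟨J, hJ, hd⟩ := exists_hasPosDensity (P := IsIndepOn (preimageSeq T U) Set.univ)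
    (fun I J hIJ hJ σ => by
      obtain ⟨x, hx, h⟩ := hJ σ
      exact ⟨x, hx, fun s hs => h s (hIJ hs)⟩)
    (fun I s m hI => hI.window s m) hc
    (hev.mono fun n ⟨W, hW, hcW⟩ =>
      ⟨W, (mem_indepFamily.1 hW).1, (mem_indepFamily.1 hW).2, hcW⟩)
  exact ⟨J, (isIndepSet_iff T U J).2 hJ, hd⟩

/-- Independence passes to a tuple each of whose members contains a member of the given one. -/
theorem HasIndepSetPosDensity.mono {X : Type*} {T : X → X} {k l : ℕ} {A : Fin k → Set X}
    {B : Fin l → Set X} (h : HasIndepSetPosDensity T A) (f : Fin l → Fin k)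
    (hf : ∀ j, A (f j) ⊆ B j) : HasIndepSetPosDensity T B := by
  obtain ⟨J, hJ, hd⟩ := h
  refine ⟨J, fun I hne hI σ => (hJ I hne hI (f ∘ σ)).mono ?_, hd⟩
  exact Set.iInter₂_mono fun s _ => Set.preimage_mono (hf _)

/-- Finitely many distinct points have pairwise disjoint closed neighbourhoods inside given
neighbourhoods. -/
theorem exists_isClosed_pairwise_disjoint {X ι : Type*} [TopologicalSpace X] [CompactSpace X]
    [T2Space X] [Finite ι] {z : ι → X} (hz : Function.Injective z) (V : ι → Set X)
    (hV : ∀ i, V i ∈ nhds (z i)) :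
    ∃ W : ι → Set X, (∀ i, IsClosed (W i)) ∧ (∀ i, z i ∈ interior (W i)) ∧ (∀ i, W i ⊆ V i) ∧
      ∀ i j, i ≠ j → Disjoint (W i) (W j) := by
  obtain ⟨O, hO, hOd⟩ := (Set.finite_range z).t2_separation
  have hmem : ∀ i, V i ∩ O (z i) ∈ nhds (z i) := fun i =>
    inter_mem (hV i) ((hO (z i)).2.mem_nhds (hO (z i)).1)
  choose W hW hWc hWs using fun i => exists_mem_nhds_isClosed_subset (hmem i)
  refine ⟨W, hWc, fun i => mem_interior_iff_mem_nhds.2 (hW i),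
    fun i => (hWs i).trans inter_subset_left, fun i j hij => ?_⟩
  exact (hOd (Set.mem_range_self i) (Set.mem_range_self j) (hz.ne hij)).mono
    ((hWs i).trans inter_subset_right) ((hWs j).trans inter_subset_right)

theorem two_le_of_range_eq {X : Type*} {k l : ℕ} {x : Fin k → X} {z : Fin l → X}
    (hzx : Set.range z = Set.range x) (hx : ∃ i j, x i ≠ x j) : 2 ≤ l := by
  obtain ⟨i, j, hij⟩ := hx
  obtain ⟨a, ha⟩ := hzx.symm ▸ Set.mem_range_self (f := x) i
  obtain ⟨b, hb⟩ := hzx.symm ▸ Set.mem_range_self (f := x) j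
  have hab : a ≠ b := by
    rintro rfl
    exact hij (ha.symm.trans hb)
  exact Fin.nontrivial_iff_two_le.1 ⟨a, b, hab⟩

/-- Theorem `T-E vs IE`: a nondiagonal tuple is an entropy tuple iff it is
an IE-tuple. -/
theorem stmt10 {X : Type*} [TopologicalSpace X] [CompactSpace X] [T2Space X]
    (T : X → X) (hT : Continuous T) (hTs : Function.Surjective T)
    {k : ℕ} (hk : 2 ≤ k) (x : Fin k → X) (hx : ∃ i j, x i ≠ x j) :
    IsEntropyTuple T x ↔ IsIETuple T x := by
  have : Nonempty X := ⟨x ⟨0, by omega⟩⟩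
  constructor
  · intro h U hUo hxU
    let e := Finite.equivFin (Set.range x)
    let z : Fin (Nat.card (Set.range x)) → X := fun a => (e.symm a : X)
    have hz : Function.Injective z := Subtype.val_injective.comp e.symm.injective
    have hzx : Set.range z = Set.range x := by
      rw [show z = Subtype.val ∘ e.symm from rfl, e.symm.surjective.range_comp,
        Subtype.range_coe]
    obtain ⟨W, hWc, hWi, hWV, hWd⟩ := exists_isClosed_pairwise_disjoint hz
      (fun a => ⋂ (i) (_ : x i = z a), U i) fun a => by
        refine (Filter.iInter_mem).2 fun i => (Filter.iInter_mem).2 fun hi => ?_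
        exact (hUo i).mem_nhds (hi ▸ hxU i)
    obtain ⟨r, hr, hlim⟩ := h _ z W hz hzx hWc hWi hWd
    refine (hasIndepSetPosDensity_of_tendsto T (two_le_of_range_eq hzx hx) W hWd hr hlim).mono
      (fun i => e ⟨x i, i, rfl⟩) fun i => (hWV _).trans ?_
    exact Set.iInter₂_subset i (congrArg Subtype.val (e.symm_apply_apply ⟨x i, i, rfl⟩)).symm
  · intro h l z U _ hzx _ hzU hUd
    have hl := two_le_of_range_eq hzx hx
    have hzx' : ∀ a, ∃ i, x i = z a := fun a => Set.mem_range.1 (hzx ▸ Set.mem_range_self a)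
    choose f hf using hzx'
    have hind := h (fun i => ⋂ (a) (_ : z a = x i), interior (U a))
      (fun i => isOpen_iInter_of_finite fun a => isOpen_iInter_of_finite fun _ =>
        isOpen_interior)
      fun i => Set.mem_iInter₂.2 fun a ha => ha ▸ hzU a
    refine exists_pos_tendsto_of_hasIndepSetPosDensity T hl U hUd (hind.mono f fun a => ?_)
    exact (Set.iInter₂_subset a (hf a).symm).trans interior_subset
end

section
/- Suppose X is a compact metrizable space with metric ρ and T : X → X is a surjective continuous map. Let k ≥ 2 and let x = (x_1, …, x_k) be an IE-tuple in X^k \ Δ_k(X). For each 1 ≤ j ≤ k let A_j be a neighbourhood of x_j. Then there exist Cantor sets Z_j ⊆ A_j for j = 1, …, k such that, setting Z = ⋃_{j=1}^k Z_j: (1) every nonempty finite tuple of points in Z is an IE-tuple; (2) for every m ∈ ℕ, all distinct points y_1, …, y_m ∈ Z and all (not necessarily distinct) points y'_1, …, y'_m ∈ Z one has liminf_{n→∞} max_{1≤i≤m} ρ(T^n y_i, y'_i) = 0. -/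
open Filter Set

/-- A hereditary, shift-invariant family of finite sets containing sets of upper density at least
`c` admits a set of positive density all of whose finite subsets belong to the family. -/
theorem exists_hasPosDensity_of_frequently (F : Finset ℕ → Prop)
    (hF : ∀ (t : ℕ) (I I' : Finset ℕ), (∀ s ∈ I', s + t ∈ I) → F I → F I')
    {c : ℝ} (hc : 0 < c)
    (hfreq : ∃ᶠ n : ℕ in atTop, ∃ I ⊆ Finset.range n, F I ∧ c * n ≤ I.card) :
    ∃ J : Set ℕ, (∀ I : Finset ℕ, ↑I ⊆ J → F I) ∧ HasPosDensity J := by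
  classical
  have hempty : F ∅ := by
    obtain ⟨n, I, -, hI, -⟩ := hfreq.exists
    exact hF 0 I ∅ (by simp) hI
  let φ : ℕ → ℕ := fun n => ((Finset.range n).powerset.filter F).sup Finset.card
  have le_φ : ∀ (n : ℕ) (I : Finset ℕ), I ⊆ Finset.range n → F I → I.card ≤ φ n := by
    intro n I hI hFI
    exact Finset.le_sup (f := Finset.card) (by simp [hFI, hI])
  have exists_φ : ∀ n, ∃ I ⊆ Finset.range n, F I ∧ I.card = φ n := by
    intro n
    obtain ⟨I, hI, h⟩ := Finset.exists_mem_eq_sup ((Finset.range n).powerset.filter F)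
      ⟨∅, by simp [hempty]⟩ Finset.card
    simp only [Finset.mem_filter, Finset.mem_powerset] at hI
    exact ⟨I, hI.1, hI.2, h.symm⟩
  have hsub : Subadditive (fun n => (φ n : ℝ)) := by
    intro m n
    obtain ⟨I, hI, hFI, hcard⟩ := exists_φ (m + n)
    have h1 := le_φ m (I.filter (· < m)) (fun s hs => by simp at hs ⊢; exact hs.2)
      (hF 0 I _ (fun s hs => by simp at hs ⊢; exact hs.1) hFI)
    have h2 := le_φ n ((I.filter (¬ · < m)).image (· - m))
      (fun s hs => by
        simp only [Finset.mem_image, Finset.mem_filter, Finset.mem_range] at hs ⊢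
        obtain ⟨r, ⟨hr, hrm⟩, rfl⟩ := hs
        have := Finset.mem_range.1 (hI hr)
        omega)
      (hF m I _ (fun s hs => by
        simp only [Finset.mem_image, Finset.mem_filter] at hs
        obtain ⟨r, ⟨hr, hrm⟩, rfl⟩ := hs
        rwa [Nat.sub_add_cancel (not_lt.1 hrm)]) hFI)
    rw [Finset.card_image_of_injOn (fun a ha b hb hab => by
      simp at ha hb hab; omega)] at h2
    have h3 := Finset.card_filter_add_card_filter_not (s := I) (· < m)
    have h4 : φ (m + n) ≤ φ m + φ n := by omega
    show (φ (m + n) : ℝ) ≤ φ m + φ n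
    exact_mod_cast h4
  have hbdd : BddBelow (range fun n => (φ n : ℝ) / n) :=
    ⟨0, by rintro _ ⟨n, rfl⟩; positivity⟩
  set d := hsub.lim with hd
  have hlim : Tendsto (fun n => (φ n : ℝ) / n) atTop (nhds d) := hsub.tendsto_lim hbdd
  have hcd : c ≤ d := by
    refine ge_of_tendsto_of_frequently hlim ?_
    refine (hfreq.and_eventually (eventually_gt_atTop 0)).mono ?_
    rintro n ⟨⟨I, hI, hFI, hcard⟩, hn⟩
    rw [le_div_iff₀ (by exact_mod_cast hn)]
    exact hcard.trans (by exact_mod_cast le_φ n I hI hFI)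
  have hd0 : 0 < d := hc.trans_le hcd
  have hdφ : ∀ n, d * n ≤ φ n := by
    intro n
    rcases Nat.eq_zero_or_pos n with rfl | hn
    · simp
    · rw [← le_div_iff₀ (by exact_mod_cast hn)]
      exact hsub.lim_le_div hbdd hn.ne'
  -- a long set of maximal density has a translate all of whose prefixes are dense
  have key : ∀ n : ℕ, ∃ I, F I ∧ ∀ m ≤ n,
      (d - 1 / ((n : ℝ) + 1)) * m ≤ ((Finset.range m).filter (· ∈ I)).card := by
    intro n
    set ε : ℝ := 1 / ((n : ℝ) + 1) with hε
    have hε0 : 0 < ε := by positivity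
    by_cases hdε : d - ε ≤ 0
    · refine ⟨∅, hempty, fun m _ => ?_⟩
      have : (d - ε) * m ≤ 0 := mul_nonpos_of_nonpos_of_nonneg hdε (by positivity)
      exact this.trans (by positivity)
    push Not at hdε
    obtain ⟨N, hN⟩ := exists_nat_ge (n / ε)
    rw [div_le_iff₀ hε0] at hN
    obtain ⟨I, hI, hFI, hcard⟩ := exists_φ N
    let a : ℕ → ℕ := fun t => ((Finset.range t).filter (· ∈ I)).card
    have hadd : ∀ t m, a (t + m) = a t + ((Finset.range m).filter (fun s => s + t ∈ I)).card := by
      intro t m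
      induction m with
      | zero => simp
      | succ m ih =>
        have : a (t + m + 1) = a (t + m) + if t + m ∈ I then 1 else 0 := by
          simp only [a, Finset.range_add_one, Finset.filter_insert]
          split_ifs <;> simp
        rw [← add_assoc, this, ih, Finset.range_add_one, Finset.filter_insert]
        have e : m + t = t + m := add_comm _ _
        rw [e]
        split_ifs <;> simp [add_assoc]
    have haN : a N = φ N := by
      rw [← hcard]
      refine congrArg Finset.card (Finset.ext fun s => ?_)
      simp only [Finset.mem_filter, Finset.mem_range, and_iff_right_iff_imp]
      exact fun hs => Finset.mem_range.1 (hI hs)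
    obtain ⟨t, ht, htmin⟩ := Finset.exists_min_image (Finset.range (N + 1))
      (fun t => (a t : ℝ) - (d - ε) * t) ⟨0, by simp⟩
    simp only [Finset.mem_range, Nat.lt_succ_iff] at ht htmin
    have h0 := htmin 0 (Nat.zero_le _)
    have ha0 : a 0 = 0 := by simp [a]
    rw [ha0] at h0
    have hNn : t + n ≤ N := by
      obtain ⟨r, rfl⟩ := Nat.exists_eq_add_of_le ht
      have h1 := hadd t r
      have h2 : ((Finset.range r).filter (fun s => s + t ∈ I)).card ≤ r :=
        (Finset.card_filter_le _ _).trans (by simp)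
      have h3 : (φ (t + r) : ℝ) ≤ a t + r := by exact_mod_cast (by omega : φ (t + r) ≤ a t + r)
      have h4 := hdφ (t + r)
      push_cast at h4 hN h0
      have h5 : (0 : ℝ) ≤ (d - ε) * r := by positivity
      have h6 : (n : ℝ) ≤ r := by nlinarith
      have : n ≤ r := by exact_mod_cast h6
      omega
    refine ⟨(I.filter (t ≤ ·)).image (· - t), hF t I _ (fun s hs => ?_) hFI, fun m hm => ?_⟩
    · simp only [Finset.mem_image, Finset.mem_filter] at hs
      obtain ⟨r, ⟨hr, hrm⟩, rfl⟩ := hs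
      rwa [Nat.sub_add_cancel hrm]
    · have h1 := htmin (t + m) (by omega)
      rw [hadd] at h1
      push_cast at h1
      have h2 : (Finset.range m).filter (fun s => s + t ∈ I) =
          (Finset.range m).filter (· ∈ (I.filter (t ≤ ·)).image (· - t)) := by
        refine Finset.filter_congr fun s _ => ?_
        simp only [Finset.mem_image, Finset.mem_filter]
        exact ⟨fun h => ⟨s + t, ⟨h, by omega⟩, by omega⟩, by
          rintro ⟨r, ⟨hr, hrm⟩, rfl⟩
          rwa [Nat.sub_add_cancel hrm]⟩
      rw [← h2]
      linarith
  choose I hFI hI using key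
  let U : Ultrafilter ℕ := hyperfilter ℕ
  have hU : (U : Filter ℕ) ≤ atTop := by
    rw [← Nat.cofinite_eq_atTop]; exact hyperfilter_le_cofinite
  let J : Set ℕ := {s | ∀ᶠ n in U, s ∈ I n}
  have hJ : ∀ s, ∀ᶠ n in U, (s ∈ I n ↔ s ∈ J) := by
    intro s
    by_cases hs : s ∈ J
    · exact (show ∀ᶠ n in U, s ∈ I n from hs).mono fun n hn => by simp [hn, hs]
    · have : ∀ᶠ n in U, ¬ s ∈ I n := Ultrafilter.eventually_not.2 hs
      exact this.mono fun n hn => by simp [hn, hs]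
  have hJF : ∀ I' : Finset ℕ, ↑I' ⊆ J → F I' := by
    intro I' hI'
    have : ∀ᶠ n in U, ∀ s ∈ I', s ∈ I n :=
      (Filter.eventually_all_finset I').2 fun s hs => hI' hs
    obtain ⟨n, hn⟩ := this.exists
    exact hF 0 (I n) I' hn (hFI n)
  refine ⟨J, hJF, d, hd0.ne', ?_⟩
  let b : ℕ → ℕ := fun m => ((Finset.range m).filter (· ∈ J)).card
  have hcardb : ∀ n, Nat.card (J ∩ Set.Iic n : Set ℕ) = b (n + 1) := by
    intro n
    show _ = Finset.card _
    rw [Nat.card_coe_set_eq, ← Set.ncard_coe_finset]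
    refine congrArg Set.ncard (Set.ext fun s => ?_)
    simp [and_comm]
  have hbφ : ∀ m, b m ≤ φ m := fun m =>
    le_φ m _ (Finset.filter_subset _ _) (hJF _ fun s hs => by simp at hs; exact hs.2)
  have hdb : ∀ m, d * m ≤ b m := by
    intro m
    have h1 : ∀ᶠ n : ℕ in U, (d - 1 / ((n : ℝ) + 1)) * m ≤ b m := by
      have h2 : ∀ᶠ n in U, ∀ s ∈ Finset.range m, (s ∈ I n ↔ s ∈ J) :=
        (Filter.eventually_all_finset _).2 fun s _ => hJ s
      filter_upwards [h2, hU (eventually_ge_atTop m)] with n hn hmn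
      have := hI n m hmn
      rwa [Finset.filter_congr hn] at this
    have h2 : Tendsto (fun n : ℕ => (d - 1 / ((n : ℝ) + 1)) * m) U (nhds ((d - 0) * m)) :=
      ((tendsto_const_nhds.sub tendsto_one_div_add_atTop_nhds_zero_nat).mul_const _).mono_left hU
    simpa using le_of_tendsto h2 h1
  have hφ1 : Tendsto (fun n : ℕ => (φ (n + 1) : ℝ) / (n + 1)) atTop (nhds d) := by
    simpa [Function.comp_def] using hlim.comp (tendsto_add_atTop_nat 1)
  refine tendsto_of_tendsto_of_tendsto_of_le_of_le tendsto_const_nhds hφ1 (fun n => ?_) fun n => ?_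
  · have := hdb (n + 1)
    rw [hcardb, le_div_iff₀ (by positivity)]
    exact_mod_cast this
  · rw [hcardb]
    have := hbφ (n + 1)
    gcongr

/-- Finitely additive shift-invariant extension of density to all subsets of `ℕ`. -/
theorem exists_mean : ∃ (U : Ultrafilter ℕ) (μ : Set ℕ → ℝ), (U : Filter ℕ) ≤ atTop ∧
    (∀ S : Set ℕ, Tendsto (fun n : ℕ => (Nat.card (S ∩ Set.Iic n : Set ℕ) : ℝ) / (n + 1)) U
      (nhds (μ S))) ∧
    (∀ S, 0 ≤ μ S ∧ μ S ≤ 1) ∧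
    (∀ S S', μ (S ∪ S') + μ (S ∩ S') = μ S + μ S') ∧
    (∀ S S', S ⊆ S' → μ S ≤ μ S') ∧
    (∀ S h, μ {s | s + h ∈ S} = μ S) := by
  let U : Ultrafilter ℕ := hyperfilter ℕ
  have hU : (U : Filter ℕ) ≤ atTop := by
    rw [← Nat.cofinite_eq_atTop]; exact hyperfilter_le_cofinite
  let a : Set ℕ → ℕ → ℝ := fun S n => (Nat.card (S ∩ Set.Iic n : Set ℕ) : ℝ) / (n + 1)
  have hfin : ∀ (S : Set ℕ) n, (S ∩ Set.Iic n).Finite := fun S n =>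
    (Set.finite_Iic n).subset inter_subset_right
  have ha : ∀ S n, a S n ∈ Set.Icc (0 : ℝ) 1 := by
    intro S n
    refine ⟨by positivity, ?_⟩
    rw [div_le_one (by positivity), Nat.card_coe_set_eq]
    have := Set.ncard_le_ncard (inter_subset_right : S ∩ Set.Iic n ⊆ Set.Iic n)
      (Set.finite_Iic n)
    have h2 : (Set.Iic n).ncard = n + 1 := by
      rw [← Finset.coe_Iic, Set.ncard_coe_finset, Nat.card_Iic]
    rw [h2] at this
    exact_mod_cast this
  have hex : ∀ S, ∃ m ∈ Set.Icc (0 : ℝ) 1, Tendsto (a S) U (nhds m) := by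
    intro S
    exact isCompact_Icc.ultrafilter_le_nhds (U.map (a S))
      (le_principal_iff.2 (Filter.mem_map.2 (Filter.univ_mem' (ha S))))
  choose μ hμ hlim using hex
  refine ⟨U, μ, hU, hlim, fun S => ⟨(hμ S).1, (hμ S).2⟩, fun S S' => ?_, fun S S' h => ?_,
    fun S h => ?_⟩
  · refine tendsto_nhds_unique ((hlim (S ∪ S')).add (hlim (S ∩ S')))
      (((hlim S).add (hlim S')).congr fun n => ?_)
    simp only [a, Nat.card_coe_set_eq]
    rw [← add_div, ← add_div, Set.union_inter_distrib_right, Set.inter_inter_distrib_right]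
    congr 1
    exact_mod_cast (Set.ncard_union_add_ncard_inter _ _ (hfin S n) (hfin S' n)).symm
  · refine le_of_tendsto_of_tendsto' (hlim S) (hlim S') fun n => ?_
    simp only [a, Nat.card_coe_set_eq]
    gcongr
    exact hfin S' n
  · have h0 : Tendsto (fun n : ℕ => (h : ℝ) / (n + 1)) U (nhds 0) := by
      have := (tendsto_one_div_add_atTop_nhds_zero_nat (𝕜 := ℝ)).const_mul (h : ℝ)
      simp only [mul_one_div, mul_zero] at this
      exact this.mono_left hU
    have hsub : ∀ n, |a {s | s + h ∈ S} n - a S n| ≤ (h : ℝ) / (n + 1) := by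
      intro n
      simp only [a, Nat.card_coe_set_eq]
      rw [← sub_div, abs_div, abs_of_pos (by positivity : (0 : ℝ) < n + 1)]
      gcongr
      have himg : (({s | s + h ∈ S} ∩ Set.Iic n).image (· + h)) = S ∩ Set.Icc h (n + h) := by
        ext s
        simp only [mem_image, mem_inter_iff, mem_ofPred_eq, mem_Iic, mem_Icc]
        constructor
        · rintro ⟨r, ⟨h1, h2⟩, rfl⟩
          exact ⟨h1, by omega, by omega⟩
        · rintro ⟨h1, h2, h3⟩
          exact ⟨s - h, ⟨by rwa [Nat.sub_add_cancel h2], by omega⟩, by omega⟩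
      have hcard : ({s | s + h ∈ S} ∩ Set.Iic n).ncard = (S ∩ Set.Icc h (n + h)).ncard := by
        rw [← himg, Set.ncard_image_of_injective _ (add_left_injective h)]
      have hf1 : (S ∩ Set.Icc h (n + h)).Finite := (Set.finite_Icc _ _).subset inter_subset_right
      have h1 : (S ∩ Set.Icc h (n + h)).ncard ≤ (S ∩ Set.Iic n).ncard + h := by
        calc _ ≤ ((S ∩ Set.Iic n) ∪ Set.Ioc n (n + h)).ncard := by
              refine Set.ncard_le_ncard (fun s hs => ?_) ((hfin _ _).union (Set.finite_Ioc _ _))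
              simp only [mem_inter_iff, mem_Icc, mem_union, mem_Iic, mem_Ioc] at hs ⊢
              rcases le_or_gt s n with h | h
              · exact Or.inl ⟨hs.1, h⟩
              · exact Or.inr ⟨h, hs.2.2⟩
          _ ≤ _ := Set.ncard_union_le _ _
          _ = _ := by rw [← Finset.coe_Ioc, Set.ncard_coe_finset, Nat.card_Ioc]; omega
      have h2 : (S ∩ Set.Iic n).ncard ≤ (S ∩ Set.Icc h (n + h)).ncard + h := by
        calc _ ≤ ((S ∩ Set.Icc h (n + h)) ∪ Set.Iio h).ncard := by
              refine Set.ncard_le_ncard (fun s hs => ?_) (hf1.union (Set.finite_Iio _))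
              simp only [mem_inter_iff, mem_Icc, mem_union, mem_Iic, mem_Iio] at hs ⊢
              rcases le_or_gt h s with h' | h'
              · exact Or.inl ⟨hs.1, h', by omega⟩
              · exact Or.inr h'
          _ ≤ _ := Set.ncard_union_le _ _
          _ = _ := by rw [← Finset.coe_Iio, Set.ncard_coe_finset, Nat.card_Iio]
      rw [hcard, abs_le]
      have h1' : ((S ∩ Set.Icc h (n + h)).ncard : ℝ) ≤ (S ∩ Set.Iic n).ncard + h := by
        exact_mod_cast h1
      have h2' : ((S ∩ Set.Iic n).ncard : ℝ) ≤ (S ∩ Set.Icc h (n + h)).ncard + h := by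
        exact_mod_cast h2
      constructor <;> linarith
    have h1 : Tendsto (fun n => a {s | s + h ∈ S} n - a S n) U (nhds 0) :=
      squeeze_zero_norm hsub h0
    have h2 := tendsto_nhds_unique h1 ((hlim {s | s + h ∈ S}).sub (hlim S))
    linarith

/-- A set of positive density contains many pairs with a common difference `h ≥ M`, with all
the pairs disjoint. -/
theorem HasPosDensity.exists_shift {J : Set ℕ} (hJ : HasPosDensity J) (M : ℕ) :
    ∃ h ≥ M, ∃ J' ⊆ J, (∀ s ∈ J', s + h ∈ J) ∧ (∀ s ∈ J', s + h ∉ J') ∧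
      ∃ c > 0, ∃ᶠ n : ℕ in atTop, ∃ I ⊆ Finset.range n, ↑I ⊆ J' ∧ c * n ≤ (I.card : ℝ) := by
  obtain ⟨d, hd, hlim⟩ := hJ
  obtain ⟨U, μ, hU, hμ, h01, hadd, hmono, hshift⟩ := exists_mean
  have hμJ : 0 < μ J := by
    have := tendsto_nhds_unique (hμ J) (hlim.mono_left hU)
    exact lt_of_le_of_ne (h01 J).1 (by rw [this]; exact hd.symm)
  have hunion : ∀ S S', μ (S ∪ S') ≤ μ S + μ S' := fun S S' => by
    have := hadd S S'; have := (h01 (S ∩ S')).1; linarith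
  -- two of the translates of `J` by multiples of `M + 1` intersect in positive mean
  obtain ⟨h, hM, hpos⟩ : ∃ h ≥ M + 1, 0 < μ (J ∩ {s | s + h ∈ J}) := by
    by_contra! hcon
    let V : ℕ → Set ℕ := fun K => {s | ∃ i < K, s + (i + 1) * (M + 1) ∈ J}
    have hV : ∀ K, μ (J ∩ V K) ≤ 0 := by
      intro K
      induction K with
      | zero =>
        have : J ∩ V 0 = ∅ := by ext; simp [V]
        have h3 := hcon (M + 1) le_rfl
        rw [this]
        exact (hmono _ _ (empty_subset _)).trans h3
      | succ K ih =>
        have : J ∩ V (K + 1) ⊆ (J ∩ V K) ∪ (J ∩ {s | s + (K + 1) * (M + 1) ∈ J}) := by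
          rintro s ⟨hs, i, hi, h⟩
          rcases Nat.lt_succ_iff_lt_or_eq.1 hi with hi | rfl
          · exact Or.inl ⟨hs, i, hi, h⟩
          · exact Or.inr ⟨hs, h⟩
        have h1 := hmono _ _ this
        have h2 := hunion (J ∩ V K) (J ∩ {s | s + (K + 1) * (M + 1) ∈ J})
        have h3 := hcon ((K + 1) * (M + 1)) (Nat.le_mul_of_pos_left _ (by omega))
        linarith
    have hV2 : ∀ K : ℕ, K * μ J ≤ μ (V K) := by
      intro K
      induction K with
      | zero => simpa using (h01 _).1
      | succ K ih =>
        have : V (K + 1) = {s | s + (M + 1) ∈ J ∪ V K} := by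
          ext s
          simp only [V, mem_ofPred_eq, mem_union]
          constructor
          · rintro ⟨i, hi, h⟩
            rcases i with _ | i
            · left; simpa using h
            · right; exact ⟨i, by omega, by convert h using 1; ring⟩
          · rintro (h | ⟨i, hi, h⟩)
            · exact ⟨0, by omega, by simpa using h⟩
            · exact ⟨i + 1, by omega, by convert h using 1; ring⟩
        rw [this, hshift]
        have := hadd J (V K)
        have := hV K
        push_cast
        linarith
    obtain ⟨K, hK⟩ := exists_nat_gt (1 / μ J)
    rw [div_lt_iff₀ hμJ] at hK
    have := hV2 K
    have := (h01 (V K)).2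
    linarith
  have hh : 0 < h := by omega
  let E : ℕ → Set ℕ := fun p => {s | s ∈ J ∧ s + h ∈ J ∧ s / h % 2 = p}
  obtain ⟨p, hp⟩ : ∃ p, 0 < μ (E p) := by
    by_contra! hcon
    have h1 := hunion (E 0) (E 1)
    have h2 := hmono (J ∩ {s | s + h ∈ J}) (E 0 ∪ E 1) (by
      rintro s ⟨h1, h2⟩
      rcases Nat.mod_two_eq_zero_or_one (s / h) with h3 | h3
      · exact Or.inl ⟨h1, h2, h3⟩
      · exact Or.inr ⟨h1, h2, h3⟩)
    have := hcon 0
    have := hcon 1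
    linarith
  refine ⟨h, by omega, E p, fun s hs => hs.1, fun s hs => hs.2.1, fun s hs hs' => ?_,
    μ (E p) / 2, by positivity, ?_⟩
  · have h1 := hs.2.2
    have h2 := hs'.2.2
    rw [Nat.add_div_right _ hh] at h2
    omega
  · have hev : ∀ᶠ n : ℕ in U, μ (E p) / 2 <
        (Nat.card (E p ∩ Set.Iic n : Set ℕ) : ℝ) / (n + 1) :=
      (hμ (E p)).eventually (lt_mem_nhds (by linarith))
    have hfr : ∃ᶠ n : ℕ in atTop, μ (E p) / 2 <
        (Nat.card (E p ∩ Set.Iic n : Set ℕ) : ℝ) / (n + 1) := hev.frequently.filter_mono hU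
    refine (tendsto_add_atTop_nat 1).frequently (hfr.mono fun n hn => ?_)
    have hfin : (E p ∩ Set.Iic n).Finite := (Set.finite_Iic n).subset inter_subset_right
    refine ⟨hfin.toFinset, fun s hs => ?_, fun s hs => ?_, ?_⟩
    · simp at hs ⊢; omega
    · simp at hs; exact hs.1
    · rw [lt_div_iff₀ (by positivity), Nat.card_coe_set_eq, Set.ncard_eq_toFinset_card _ hfin] at hn
      push_cast
      exact hn.le

/-- The points of `S` realise every pattern of labels along `I`. -/
def Shatters {Y P : Type*} (R : Y → ℕ → P → Prop) (S : Set Y) (I : Finset ℕ) : Prop :=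
  ∀ σ : ℕ → P, ∃ y ∈ S, ∀ s ∈ I, R y s (σ s)

open Classical in
/-- The number of subsets of `I` shattered by `S`. -/
noncomputable def shatterCount {Y P : Type*} (R : Y → ℕ → P → Prop) (S : Set Y)
    (I : Finset ℕ) : ℕ :=
  (I.powerset.filter (Shatters R S)).card

theorem Shatters.mono {Y P : Type*} {R : Y → ℕ → P → Prop} {S S' : Set Y} {I : Finset ℕ}
    (h : Shatters R S I) (hS : S ⊆ S') : Shatters R S' I := fun σ =>
  let ⟨y, hy, h⟩ := h σ
  ⟨y, hS hy, h⟩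

theorem shatterCount_le_insert {Y P : Type*} (R : Y → ℕ → P → Prop) (S : Set Y)
    (I : Finset ℕ) (s : ℕ) : shatterCount R S I ≤ shatterCount R S (insert s I) := by
  classical
  exact Finset.card_le_card (Finset.filter_subset_filter _
    (Finset.powerset_mono.2 (Finset.subset_insert _ _)))

/-- Some label at the new coordinate `s` lowers the shatter count by a definite factor. -/
theorem exists_shatterCount_le {Y P : Type*} [Fintype P] [Nontrivial P]
    (R : Y → ℕ → P → Prop) (S : Set Y) (I : Finset ℕ) {s : ℕ} (hs : s ∉ I) :
    ∃ i : P, (shatterCount R {y ∈ S | R y s i} I : ℝ) ≤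
      (Fintype.card P / (Fintype.card P + 1) : ℝ) * shatterCount R S (insert s I) := by
  classical
  let a : P → Finset (Finset ℕ) := fun p => I.powerset.filter (Shatters R {y ∈ S | R y s p})
  let V : Finset (Finset ℕ) := I.powerset.filter (Shatters R S)
  let W : Finset (Finset ℕ) := V.filter fun I' => ∀ p, I' ∈ a p
  have haV : ∀ p, a p ⊆ V := fun p I' hI' => by
    simp only [a, V, Finset.mem_filter] at hI' ⊢
    exact ⟨hI'.1, hI'.2.mono (sep_subset _ _)⟩
  have hVW : V.card + W.card ≤ shatterCount R S (insert s I) := by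
    have hinj : W.card = (W.image (insert s)).card := by
      refine (Finset.card_image_of_injOn fun A hA B hB hAB => ?_).symm
      have hsA : s ∉ A := fun h => by
        simp only [W, V, Finset.coe_filter, Finset.mem_filter, Finset.mem_powerset,
          mem_ofPred_eq] at hA
        exact hs (hA.1.1 h)
      have hsB : s ∉ B := fun h => by
        simp only [W, V, Finset.coe_filter, Finset.mem_filter, Finset.mem_powerset,
          mem_ofPred_eq] at hB
        exact hs (hB.1.1 h)
      rw [← Finset.erase_insert hsA, ← Finset.erase_insert hsB]
      exact congrArg (Finset.erase · s) hAB
    rw [hinj, ← Finset.card_union_of_disjoint]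
    · refine Finset.card_le_card fun I' hI' => ?_
      rw [Finset.mem_filter, Finset.mem_powerset]
      rcases Finset.mem_union.1 hI' with h | h
      · simp only [V, Finset.mem_filter, Finset.mem_powerset] at h
        exact ⟨h.1.trans (Finset.subset_insert _ _), h.2⟩
      · obtain ⟨I₀, h₀, rfl⟩ := Finset.mem_image.1 h
        simp only [W, V, a, Finset.mem_filter, Finset.mem_powerset] at h₀
        refine ⟨Finset.insert_subset_insert _ h₀.1.1, fun σ => ?_⟩
        obtain ⟨y, ⟨hyS, hys⟩, hy⟩ := (h₀.2 (σ s)).2 σ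
        refine ⟨y, hyS, fun r hr => ?_⟩
        rcases Finset.mem_insert.1 hr with rfl | hr
        · exact hys
        · exact hy r hr
    · rw [Finset.disjoint_left]
      intro I' h1 h2
      obtain ⟨I', -, rfl⟩ := Finset.mem_image.1 h2
      simp only [V, Finset.mem_filter, Finset.mem_powerset] at h1
      exact hs (h1.1 (Finset.mem_insert_self _ _))
  have hcover : V.card ≤ W.card + ∑ p, (V.card - (a p).card) := by
    have : V ⊆ W ∪ Finset.univ.biUnion fun p => V \ a p := by
      intro I' hI'
      by_cases h : ∀ p, I' ∈ a p
      · exact Finset.mem_union_left _ (Finset.mem_filter.2 ⟨hI', h⟩)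
      · push Not at h
        obtain ⟨p, hp⟩ := h
        exact Finset.mem_union_right _ (by simpa using ⟨hI', p, hp⟩)
    calc V.card ≤ _ := Finset.card_le_card this
      _ ≤ _ := Finset.card_union_le _ _
      _ ≤ W.card + ∑ p, (V \ a p).card := by gcongr; exact Finset.card_biUnion_le
      _ = _ := by
        congr 1
        exact Finset.sum_congr rfl fun p _ => Finset.card_sdiff_of_subset (haV p)
  by_contra! hcon
  have hcon' : ∀ p, (Fintype.card P / (Fintype.card P + 1) : ℝ) *
      shatterCount R S (insert s I) < (a p).card := hcon
  set N : ℝ := (shatterCount R S (insert s I) : ℝ)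
  set k : ℝ := (Fintype.card P : ℝ)
  have hk : 2 ≤ k := by simp only [k]; exact_mod_cast Fintype.one_lt_card
  have h1 : (V.card : ℝ) + W.card ≤ N := by simp only [N]; exact_mod_cast hVW
  have h2 : (V.card : ℝ) ≤ W.card + ∑ p, ((V.card : ℝ) - (a p).card) := by
    have : ∀ p, ((V.card : ℝ) - (a p).card) = ((V.card - (a p).card : ℕ) : ℝ) := fun p =>
      (Nat.cast_sub (Finset.card_le_card (haV p))).symm
    simp only [this]
    exact_mod_cast hcover
  have h3 : ∑ p, ((V.card : ℝ) - (a p).card) < ∑ _p : P, ((V.card : ℝ) - k / (k + 1) * N) :=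
    Finset.sum_lt_sum_of_nonempty Finset.univ_nonempty fun p _ => by linarith [hcon' p]
  rw [Finset.sum_const, Finset.card_univ, nsmul_eq_mul] at h3
  have h4 : k / (k + 1) * N * (k + 1) = k * N := by field_simp
  set θN := k / (k + 1) * N
  change _ < k * ((V.card : ℝ) - θN) at h3
  have hW : (0 : ℝ) ≤ W.card := by positivity
  have hN : 0 ≤ N := by simp only [N]; positivity
  have h5 : 0 ≤ (k - 2) * (N - V.card) := mul_nonneg (by linarith) (by linarith)
  nlinarith

/-- Few shattered sets imply that few label sequences suffice to avoid all points of `S`. -/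
theorem exists_avoiding {Y P : Type*} [Fintype P] [Nontrivial P]
    (R : Y → ℕ → P → Prop) (hR : ∀ y s p q, R y s p → R y s q → p = q)
    (a : ℕ) (I : Finset ℕ) (S : Set Y) :
    ∃ B : Finset (ℕ → P), (∀ y ∈ S, ∃ b ∈ B, ∀ s ∈ I, ¬ R y s (b s)) ∧
      (B.card : ℝ) ≤ (1 + (Fintype.card P / (Fintype.card P + 1) : ℝ) ^ a) ^ I.card *
        (shatterCount R S I : ℝ) ^ a := by
  classical
  set θ : ℝ := Fintype.card P / (Fintype.card P + 1) with hθ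
  have hθ0 : 0 ≤ θ := by positivity
  induction I using Finset.induction_on generalizing S with
  | empty =>
    rcases S.eq_empty_or_nonempty with rfl | ⟨y, hy⟩
    · exact ⟨∅, by simp, by simp only [Finset.card_empty, Nat.cast_zero]; positivity⟩
    · refine ⟨{fun _ => Classical.arbitrary P}, by simp, ?_⟩
      have : shatterCount R S ∅ = 1 := by
        rw [shatterCount, Finset.powerset_empty, Finset.filter_singleton, if_pos]
        · simp
        · exact fun σ => ⟨y, hy, by simp⟩
      simp [this]
  | insert s I hs ih =>
    obtain ⟨i, hi⟩ := exists_shatterCount_le R S I hs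
    obtain ⟨j, hj⟩ := exists_ne i
    obtain ⟨B₁, hB₁, hc₁⟩ := ih S
    obtain ⟨B₂, hB₂, hc₂⟩ := ih {y ∈ S | R y s i}
    have hne : ∀ r ∈ I, r ≠ s := fun r hr h => hs (h ▸ hr)
    refine ⟨B₁.image (Function.update · s i) ∪ B₂.image (Function.update · s j), ?_, ?_⟩
    · intro y hy
      by_cases hyi : R y s i
      · obtain ⟨b, hb, hby⟩ := hB₂ y ⟨hy, hyi⟩
        refine ⟨_, Finset.mem_union_right _ (Finset.mem_image_of_mem _ hb), fun r hr => ?_⟩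
        rcases Finset.mem_insert.1 hr with rfl | hr
        · simpa using fun h => hj (hR _ _ _ _ h hyi)
        · simpa [Function.update_of_ne (hne r hr)] using hby r hr
      · obtain ⟨b, hb, hby⟩ := hB₁ y hy
        refine ⟨_, Finset.mem_union_left _ (Finset.mem_image_of_mem _ hb), fun r hr => ?_⟩
        rcases Finset.mem_insert.1 hr with rfl | hr
        · simpa using hyi
        · simpa [Function.update_of_ne (hne r hr)] using hby r hr
    · set N : ℝ := (shatterCount R S (insert s I) : ℝ)
      have h1 : (shatterCount R S I : ℝ) ^ a ≤ N ^ a := by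
        gcongr
        simp only [N]
        exact_mod_cast shatterCount_le_insert R S I s
      have h2 : (shatterCount R {y ∈ S | R y s i} I : ℝ) ^ a ≤ θ ^ a * N ^ a := by
        rw [← mul_pow]
        gcongr
      have h3 : (B₁.image (Function.update · s i) ∪ B₂.image (Function.update · s j)).card ≤
          B₁.card + B₂.card :=
        (Finset.card_union_le _ _).trans (add_le_add Finset.card_image_le Finset.card_image_le)
      rw [Finset.card_insert_of_notMem hs, pow_succ]
      calc _ ≤ (B₁.card : ℝ) + B₂.card := by exact_mod_cast h3
        _ ≤ (1 + θ ^ a) ^ I.card * N ^ a + (1 + θ ^ a) ^ I.card * (θ ^ a * N ^ a) := by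
          refine add_le_add (hc₁.trans ?_) (hc₂.trans ?_) <;> gcongr
        _ = _ := by ring

theorem shatterCount_le {Y P : Type*} (R : Y → ℕ → P → Prop) (S : Set Y) (I : Finset ℕ) (d : ℕ)
    (hd : ∀ I' ⊆ I, Shatters R S I' → I'.card ≤ d) {y : ℝ} (hy : 0 < y) (hy1 : y ≤ 1) :
    (shatterCount R S I : ℝ) * y ^ d ≤ (1 + y) ^ I.card := by
  classical
  calc (shatterCount R S I : ℝ) * y ^ d = ∑ _I' ∈ I.powerset.filter (Shatters R S), y ^ d := by
        rw [Finset.sum_const, nsmul_eq_mul, shatterCount]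
    _ ≤ ∑ I' ∈ I.powerset.filter (Shatters R S), y ^ I'.card := by
        refine Finset.sum_le_sum fun I' hI' => ?_
        rw [Finset.mem_filter, Finset.mem_powerset] at hI'
        exact pow_le_pow_of_le_one hy.le hy1 (hd I' hI'.1 hI'.2)
    _ ≤ ∑ I' ∈ I.powerset, y ^ I'.card :=
        Finset.sum_le_sum_of_subset_of_nonneg (Finset.filter_subset _ _) fun _ _ _ => by positivity
    _ = (1 + y) ^ I.card := by
        simp [← Finset.sum_pow_mul_eq_add_pow, add_comm]

/-- The finite set `I` is an independence set for the family `G`. -/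
def Indep {X P : Type*} (T : X → X) (G : P → Set X) (I : Finset ℕ) : Prop :=
  ∀ σ : ℕ → P, ∃ z, ∀ s ∈ I, T^[s] z ∈ G (σ s)

theorem Indep.of_shift {X P : Type*} {T : X → X} {G : P → Set X} (t : ℕ) (I I' : Finset ℕ)
    (h : ∀ s ∈ I', s + t ∈ I) (hI : Indep T G I) : Indep T G I' := by
  intro σ
  obtain ⟨z, hz⟩ := hI fun s => σ (s - t)
  refine ⟨T^[t] z, fun s hs => ?_⟩
  simpa [← Function.iterate_add_apply] using hz _ (h s hs)

theorem Indep.pow_card_le {X P C : Type*} [Fintype P] [DecidableEq P] [Nontrivial P]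
    [Fintype C] {T : X → X} {G : P → Set X} {D : C → Set X} (hD : ⋃ c, D c = univ) {I : Finset ℕ}
    (hI : Indep T G I) (a d : ℕ)
    (hd : ∀ (f : P → C), ∀ I' ⊆ I, Indep T (fun p => G p ∩ D (f p)) I' → I'.card ≤ d)
    {y : ℝ} (hy : 0 < y) (hy1 : y ≤ 1) :
    (Fintype.card P : ℝ) ^ I.card * (y ^ (a * Fintype.card (P → C))) ^ d ≤
      ((Fintype.card P - 1) * ((1 + (Fintype.card P / (Fintype.card P + 1) : ℝ) ^ a) *
        (1 + y) ^ a) ^ Fintype.card (P → C)) ^ I.card := by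
  classical
  set θ : ℝ := Fintype.card P / (Fintype.card P + 1) with hθ
  have hθ0 : 0 ≤ θ := by positivity
  have hP : 2 ≤ Fintype.card P := Fintype.one_lt_card
  let R : (P → C) → X × (ℕ → P) → ℕ → P → Prop := fun f x s p =>
    x.2 s = p ∧ T^[s] x.1 ∈ G p ∩ D (f p)
  have hR : ∀ f y s p q, R f y s p → R f y s q → p = q := fun f y s p q hp hq =>
    hp.1.symm.trans hq.1
  choose B hB hBcard using fun f => exists_avoiding (R f) (hR f) a I univ
  have hB' : ∀ f, ((B f).card : ℝ) * (y ^ a) ^ d ≤ ((1 + θ ^ a) * (1 + y) ^ a) ^ I.card := by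
    intro f
    have h1 := shatterCount_le (R f) univ I d (fun I' hI' hsh => hd f I' hI' fun σ => by
      obtain ⟨z, -, hz⟩ := hsh σ
      exact ⟨z.1, fun s hs => (hz s hs).2⟩) hy hy1
    calc ((B f).card : ℝ) * (y ^ a) ^ d
        ≤ (1 + θ ^ a) ^ I.card * (shatterCount (R f) univ I : ℝ) ^ a * (y ^ a) ^ d := by
          gcongr; exact hBcard f
      _ = (1 + θ ^ a) ^ I.card * ((shatterCount (R f) univ I : ℝ) * y ^ d) ^ a := by
          rw [mul_pow, ← pow_mul, ← pow_mul, mul_comm a d, mul_assoc]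
      _ ≤ (1 + θ ^ a) ^ I.card * ((1 + y) ^ I.card) ^ a := by gcongr
      _ = _ := by rw [mul_pow, ← pow_mul, ← pow_mul, mul_comm a]
  -- each choice of avoiding sequences rules out one label at each coordinate
  have hex : ∀ (b : (P → C) → ℕ → P) (s : ℕ), ∃ p, ∀ c, ∃ f, b f s = p ∧ f p = c := by
    intro b s
    by_contra! h
    choose f hf using h
    exact hf _ f rfl rfl
  choose p hp using hex
  have hcount : Fintype.card P ^ I.card ≤
      (∏ f, (B f).card) * (Fintype.card P - 1) ^ I.card := by
    have hsub : (Finset.univ : Finset (I → P)) ⊆ (Fintype.piFinset B).biUnion fun b =>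
        Fintype.piFinset fun s : I => Finset.univ.erase (p b s) := by
      intro σ _
      let σ' : ℕ → P := fun s => if h : s ∈ I then σ ⟨s, h⟩ else Classical.arbitrary P
      obtain ⟨z, hz⟩ := hI σ'
      choose b hb hbz using fun f => hB f (z, σ') (mem_univ _)
      refine Finset.mem_biUnion.2 ⟨b, Fintype.mem_piFinset.2 hb, Fintype.mem_piFinset.2 ?_⟩
      rintro ⟨s, hs⟩
      refine Finset.mem_erase.2 ⟨fun h => ?_, Finset.mem_univ _⟩
      have hσ : σ' s = p b s := by simp only [σ', dif_pos hs]; exact h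
      obtain ⟨c, hc⟩ : ∃ c, T^[s] z ∈ D c := by
        have : T^[s] z ∈ ⋃ c, D c := hD ▸ mem_univ _
        simpa using this
      obtain ⟨f, hf, hfc⟩ := hp b s c
      refine hbz f s hs ?_
      rw [hf]
      exact ⟨hσ, hσ ▸ hz s hs, by rwa [hfc]⟩
    have h1 := Finset.card_le_card hsub
    have h2 : ((Fintype.piFinset B).biUnion fun b =>
        Fintype.piFinset fun s : I => Finset.univ.erase (p b s)).card ≤
        (Fintype.piFinset B).card * (Fintype.card P - 1) ^ I.card := by
      refine Finset.card_biUnion_le_card_mul _ _ _ fun b _ => ?_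
      simp [Fintype.card_piFinset]
    rw [Finset.card_univ, Fintype.card_fun, Fintype.card_coe] at h1
    rw [Fintype.card_piFinset] at h2
    exact h1.trans h2
  have hcountR : (Fintype.card P : ℝ) ^ I.card ≤
      (∏ f, ((B f).card : ℝ)) * ((Fintype.card P : ℝ) - 1) ^ I.card := by
    have : ((Fintype.card P : ℝ) - 1) = ((Fintype.card P - 1 : ℕ) : ℝ) := by
      rw [Nat.cast_sub (by omega)]; simp
    rw [this]
    exact_mod_cast hcount
  have hk : (0 : ℝ) ≤ (Fintype.card P : ℝ) - 1 := by
    have : (2 : ℝ) ≤ Fintype.card P := by exact_mod_cast hP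
    linarith
  have hy2 : (y ^ (a * Fintype.card (P → C))) ^ d = ∏ _f : P → C, (y ^ a) ^ d := by
    rw [Finset.prod_const, Finset.card_univ, ← pow_mul, ← pow_mul, ← pow_mul]
    ring_nf
  calc (Fintype.card P : ℝ) ^ I.card * (y ^ (a * Fintype.card (P → C))) ^ d
      ≤ (∏ f, ((B f).card : ℝ)) * ((Fintype.card P : ℝ) - 1) ^ I.card *
          ∏ _f : P → C, (y ^ a) ^ d := by
        rw [hy2]; gcongr
    _ = ((Fintype.card P : ℝ) - 1) ^ I.card * ∏ f, (((B f).card : ℝ) * (y ^ a) ^ d) := by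
        rw [Finset.prod_mul_distrib]; ring
    _ ≤ ((Fintype.card P : ℝ) - 1) ^ I.card *
          ∏ _f : P → C, ((1 + θ ^ a) * (1 + y) ^ a) ^ I.card := by
        refine mul_le_mul_of_nonneg_left ?_ (by positivity)
        exact Finset.prod_le_prod (fun f _ => by positivity) fun f _ => hB' f
    _ = _ := by
        rw [Finset.prod_const, Finset.card_univ, mul_pow ((Fintype.card P : ℝ) - 1), pow_right_comm]

/-- Passing to pieces of a finite cover keeps a fixed proportion of any independence set. -/
theorem exists_indep_inter (P C : Type*) [Fintype P] [Nontrivial P] [Fintype C] :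
    ∃ m : ℕ, ∀ {X : Type*} (T : X → X) (G : P → Set X) (D : C → Set X), ⋃ c, D c = univ →
      ∀ I : Finset ℕ, Indep T G I → ∃ f : P → C, ∃ I' ⊆ I,
        Indep T (fun p => G p ∩ D (f p)) I' ∧ I.card ≤ m * I'.card := by
  classical
  set k : ℝ := (Fintype.card P : ℝ) with hk
  set r := Fintype.card (P → C)
  set θ : ℝ := k / (k + 1) with hθ
  have hk2 : 2 ≤ k := by simp only [k]; exact_mod_cast Fintype.one_lt_card
  have hθ0 : 0 ≤ θ := by positivity
  have hθ1 : θ < 1 := by rw [hθ, div_lt_one (by positivity)]; linarith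
  obtain ⟨a, ha⟩ : ∃ a : ℕ, (k - 1) * (1 + θ ^ a) ^ r < k := by
    have : Tendsto (fun a : ℕ => (k - 1) * (1 + θ ^ a) ^ r) atTop
        (nhds ((k - 1) * (1 + 0) ^ r)) :=
      ((tendsto_pow_atTop_nhds_zero_of_lt_one hθ0 hθ1).const_add 1 |>.pow r).const_mul _
    exact (this.eventually (gt_mem_nhds (by simp))).exists
  obtain ⟨y, hyk, hy0, hy1⟩ : ∃ y : ℝ, (k - 1) * ((1 + θ ^ a) * (1 + y) ^ a) ^ r < k ∧
      0 < y ∧ y ≤ 1 := by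
    have hcont : Continuous fun y : ℝ => (k - 1) * ((1 + θ ^ a) * (1 + y) ^ a) ^ r := by fun_prop
    have h1 : ∀ᶠ y in nhdsWithin (0 : ℝ) (Set.Ioi 0),
        (k - 1) * ((1 + θ ^ a) * (1 + y) ^ a) ^ r < k :=
      (hcont.tendsto 0).mono_left nhdsWithin_le_nhds |>.eventually (gt_mem_nhds (by simpa using ha))
    exact (h1.and (Ioc_mem_nhdsGT one_pos)).exists.imp fun y hy => ⟨hy.1, hy.2.1, hy.2.2⟩
  set u := (k - 1) * ((1 + θ ^ a) * (1 + y) ^ a) ^ r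
  have hu : 0 < u := by
    have : 0 < k - 1 := by linarith
    positivity
  obtain ⟨m, hm⟩ := pow_unbounded_of_one_lt (1 / y ^ (a * r)) ((one_lt_div hu).2 hyk)
  have hm0 : 0 < m := by
    rcases Nat.eq_zero_or_pos m with rfl | h
    · have := one_le_one_div (pow_pos hy0 (a * r)) (pow_le_one₀ hy0.le hy1)
      simp at hm this
      linarith
    · exact h
  refine ⟨m, fun {X} T G D hD I hI => ?_⟩
  by_contra! hcon
  have hn : 0 < I.card := by
    obtain ⟨c⟩ : Nonempty (P → C) := by
      have ⟨z, _⟩ := hI fun _ => Classical.arbitrary P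
      have : z ∈ ⋃ c, D c := hD ▸ mem_univ _
      obtain ⟨c, -⟩ := mem_iUnion.1 this
      exact ⟨fun _ => c⟩
    have ⟨z, _⟩ := hI fun _ => Classical.arbitrary P
    have := hcon c ∅ (by simp) fun σ => ⟨z, by simp⟩
    simpa using this
  have hle := hI.pow_card_le hD a ((I.card - 1) / m) (fun f I' hI' hind => by
    have := hcon f I' hI' hind
    rw [Nat.le_div_iff_mul_le hm0, mul_comm]
    omega) hy0 hy1
  set d := (I.card - 1) / m
  have hmd : m * d < I.card := (Nat.mul_div_le _ _).trans_lt (by omega)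
  have h1 : (k / u) ^ I.card ≤ (1 / y ^ (a * r)) ^ d := by
    rw [div_pow, div_pow, one_pow, div_le_div_iff₀ (by positivity) (by positivity), one_mul]
    exact hle
  have h2 : (1 / y ^ (a * r)) ^ d ≤ ((k / u) ^ m) ^ d := by gcongr
  rw [← pow_mul] at h2
  have h3 : (k / u) ^ (m * d) < (k / u) ^ I.card := by
    exact pow_lt_pow_right₀ ((one_lt_div hu).2 hyk) hmd
  linarith

/-- The family `G` has an independence set of positive density. -/
def Good {X P : Type*} (T : X → X) (G : P → Set X) : Prop :=
  ∃ J : Set ℕ, (∀ I : Finset ℕ, ↑I ⊆ J → Indep T G I) ∧ HasPosDensity J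

theorem HasPosDensity.nonempty {J : Set ℕ} (hJ : HasPosDensity J) : J.Nonempty := by
  obtain ⟨h, -, J', hJ', -, -, c, hc, hfr⟩ := hJ.exists_shift 0
  obtain ⟨n, ⟨I, -, hI, hcard⟩, hn⟩ := (hfr.and_eventually (eventually_gt_atTop 0)).exists
  have : (0 : ℝ) < I.card := lt_of_lt_of_le (by positivity) hcard
  obtain ⟨s, hs⟩ := Finset.card_pos.1 (by exact_mod_cast this)
  exact ⟨s, hJ' (hI hs)⟩

theorem HasPosDensity.exists_frequently {J : Set ℕ} (hJ : HasPosDensity J) :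
    ∃ c > 0, ∃ᶠ n : ℕ in atTop, ∃ I ⊆ Finset.range n, ↑I ⊆ J ∧ c * n ≤ (I.card : ℝ) := by
  obtain ⟨h, -, J', hJ', -, -, c, hc, hfr⟩ := hJ.exists_shift 0
  refine ⟨c, hc, hfr.mono ?_⟩
  rintro n ⟨I, hIn, hI, hcard⟩
  exact ⟨I, hIn, hI.trans hJ', hcard⟩

theorem Good.of_frequently {X P : Type*} {T : X → X} {G : P → Set X} {c : ℝ} (hc : 0 < c)
    (h : ∃ᶠ n : ℕ in atTop, ∃ I ⊆ Finset.range n, Indep T G I ∧ c * n ≤ I.card) : Good T G :=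
  exists_hasPosDensity_of_frequently (Indep T G) (fun t I I' h hI => hI.of_shift t I I' h) hc h

theorem Good.mono {X P Q : Type*} {T : X → X} {G : P → Set X} {G' : Q → Set X} (hG : Good T G)
    (f : Q → P) (hf : ∀ q, G (f q) ⊆ G' q) : Good T G' := by
  obtain ⟨J, hJ, hd⟩ := hG
  refine ⟨J, fun I hI σ => ?_, hd⟩
  obtain ⟨z, hz⟩ := hJ I hI (f ∘ σ)
  exact ⟨z, fun s hs => hf _ (hz s hs)⟩

theorem Good.nonempty {X P : Type*} {T : X → X} {G : P → Set X} (hG : Good T G) (p : P) :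
    (G p).Nonempty := by
  obtain ⟨J, hJ, hd⟩ := hG
  obtain ⟨s, hs⟩ := hd.nonempty
  obtain ⟨z, hz⟩ := hJ {s} (by simpa using hs) fun _ => p
  exact ⟨_, hz s (by simp)⟩

theorem Good.hasIndepSetPosDensity {X : Type*} {T : X → X} {k : ℕ} {A : Fin k → Set X}
    (hA : Good T A) : HasIndepSetPosDensity T A := by
  obtain ⟨J, hJ, hd⟩ := hA
  refine ⟨J, fun I _ hI σ => ?_, hd⟩
  obtain ⟨z, hz⟩ := hJ I hI σ
  exact ⟨z, by simpa using hz⟩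

theorem HasIndepSetPosDensity.good {X : Type*} [Nonempty X] {T : X → X} {k : ℕ}
    {A : Fin k → Set X} (hA : HasIndepSetPosDensity T A) : Good T A := by
  obtain ⟨J, hJ, hd⟩ := hA
  refine ⟨J, fun I hI σ => ?_, hd⟩
  rcases I.eq_empty_or_nonempty with rfl | hne
  · exact ⟨Classical.arbitrary X, by simp⟩
  · obtain ⟨z, hz⟩ := hJ I hne hI σ
    exact ⟨z, by simpa using hz⟩

theorem Good.inter_preimage {X P : Type*} {T : X → X} {G : P → Set X} (hG : Good T G)
    (γ : P → P) (M : ℕ) : ∃ h ≥ M, Good T fun p => G p ∩ T^[h] ⁻¹' G (γ p) := by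
  classical
  obtain ⟨J, hJ, hd⟩ := hG
  obtain ⟨h, hM, J', hJ', hadd, hdisj, c, hc, hfr⟩ := hd.exists_shift M
  refine ⟨h, hM, Good.of_frequently hc (hfr.mono ?_)⟩
  rintro n ⟨I, hIn, hI, hcard⟩
  refine ⟨I, hIn, fun σ => ?_, hcard⟩
  obtain ⟨z, hz⟩ := hJ (I ∪ I.image (· + h)) (fun s hs => by
    simp only [Finset.coe_union, Finset.coe_image, mem_union, mem_image, Finset.mem_coe] at hs
    rcases hs with hs | ⟨s, hs, rfl⟩
    · exact hJ' (hI hs)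
    · exact hadd s (hI hs)) fun s => if s ∈ I then σ s else γ (σ (s - h))
  refine ⟨z, fun s hs => ⟨?_, ?_⟩⟩
  · simpa [hs] using hz s (Finset.mem_union_left _ hs)
  · have h1 := hz (s + h) (Finset.mem_union_right _ (Finset.mem_image_of_mem _ hs))
    have h2 : s + h ∉ I := fun h' => hdisj s (hI hs) (hI h')
    simpa [h2, ← Function.iterate_add_apply, add_comm h s] using h1

theorem Good.exists_inter {X P C : Type*} [Finite P] [Nontrivial P] [Finite C]
    {T : X → X} {G : P → Set X} (hG : Good T G) {D : C → Set X} (hD : ⋃ c, D c = univ) :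
    ∃ f : P → C, Good T fun p => G p ∩ D (f p) := by
  classical
  have := Fintype.ofFinite P
  have := Fintype.ofFinite C
  obtain ⟨J, hJ, hd⟩ := hG
  obtain ⟨m, hm⟩ := exists_indep_inter P C
  obtain ⟨c, hc, hfr⟩ := hd.exists_frequently
  have hfr' : ∃ᶠ n : ℕ in atTop, ∃ f : P → C, ∃ I ⊆ Finset.range n,
      Indep T (fun p => G p ∩ D (f p)) I ∧ c / (m + 1) * n ≤ I.card := by
    refine hfr.mono ?_
    rintro n ⟨I, hIn, hI, hcard⟩
    obtain ⟨f, I', hI', hind, hle⟩ := hm T G D hD I (hJ I hI)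
    refine ⟨f, I', hI'.trans hIn, hind, ?_⟩
    rw [div_mul_eq_mul_div, div_le_iff₀ (by positivity)]
    have : (I.card : ℝ) ≤ m * I'.card := by exact_mod_cast hle
    nlinarith [(Nat.cast_nonneg I'.card : (0 : ℝ) ≤ I'.card)]
  obtain ⟨f, hf⟩ : ∃ f : P → C, ∃ᶠ n : ℕ in atTop, ∃ I ⊆ Finset.range n,
      Indep T (fun p => G p ∩ D (f p)) I ∧ c / (m + 1) * n ≤ I.card := by
    by_contra! h
    refine hfr' ((eventually_all.2 h).mono fun n hn => ?_)
    rintro ⟨f, I, hI, hind, hle⟩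
    exact (hn f I hI hind).not_ge hle
  exact ⟨f, Good.of_frequently (by positivity) hf⟩

theorem exists_finite_closed_cover (X : Type*) [MetricSpace X] [CompactSpace X] {ε : ℝ}
    (hε : 0 < ε) : ∃ (t : Set X) (_ : t.Finite) (D : t → Set X), ⋃ c, D c = univ ∧
      ∀ c, IsClosed (D c) ∧ ∀ y ∈ D c, ∀ z ∈ D c, dist y z ≤ ε := by
  obtain ⟨t, -, ht, hcov⟩ := finite_cover_balls_of_compact (isCompact_univ (X := X)) (half_pos hε)
  refine ⟨t, ht, fun c => Metric.closedBall c (ε / 2), ?_, fun c => ⟨Metric.isClosed_closedBall,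
    fun y hy z hz => ?_⟩⟩
  · refine eq_univ_of_forall fun z => ?_
    obtain ⟨c, hc, hz⟩ := mem_iUnion₂.1 (hcov (mem_univ z))
    exact mem_iUnion.2 ⟨⟨c, hc⟩, Metric.ball_subset_closedBall hz⟩
  · have := dist_triangle_right y z (c : X)
    rw [Metric.mem_closedBall] at hy hz
    linarith

theorem Good.exists_split {X P : Type*} [MetricSpace X] [CompactSpace X] [Finite P]
    {T : X → X} (hT : Continuous T) {A : P → Set X} (hA : Good T A) (hcl : ∀ p, IsClosed (A p))
    {a a' : P} (haa : Disjoint (A a) (A a')) {ε : ℝ} (hε : 0 < ε) (M : ℕ) :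
    ∃ B : P × Bool → Set X, Good T B ∧ (∀ q, IsClosed (B q)) ∧ (∀ q, B q ⊆ A q.1) ∧
      (∀ q q', q ≠ q' → Disjoint (B q) (B q')) ∧
      (∀ q, ∀ y ∈ B q, ∀ z ∈ B q, dist y z ≤ ε) ∧
      ∀ γ : P × Bool → P, ∃ h ≥ M, ∀ q, MapsTo T^[h] (B q) (A (γ q)) := by
  classical
  have := Fintype.ofFinite P
  have : Nonempty P := ⟨a⟩
  have key : ∀ Γ : Finset (P × Bool → P), ∃ B : P × Bool → Set X, Good T B ∧
      (∀ q, IsClosed (B q)) ∧ (∀ q, B q ⊆ A q.1) ∧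
      ∀ γ ∈ Γ, ∃ h ≥ M, ∀ q, MapsTo T^[h] (B q) (A (γ q)) := by
    intro Γ
    induction Γ using Finset.induction_on with
    | empty =>
      exact ⟨fun q => A q.1, hA.mono Prod.fst fun _ => subset_rfl, fun q => hcl _,
        fun _ => subset_rfl, by simp⟩
    | insert γ Γ _ ih =>
      obtain ⟨B, hB, hBcl, hBA, hΓ⟩ := ih
      obtain ⟨h, hM, hgood⟩ := hB.inter_preimage (fun q => (γ q, true)) M
      refine ⟨_, hgood, fun q => (hBcl q).inter ((hBcl _).preimage (hT.iterate h)),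
        fun q => inter_subset_left.trans (hBA q), fun γ' hγ' => ?_⟩
      rcases Finset.mem_insert.1 hγ' with rfl | hγ'
      · exact ⟨h, hM, fun q z hz => hBA _ hz.2⟩
      · obtain ⟨h', hM', hh'⟩ := hΓ γ' hγ'
        exact ⟨h', hM', fun q => (hh' q).mono_left inter_subset_left⟩
  obtain ⟨B, hB, hBcl, hBA, hΓ⟩ := key Finset.univ
  obtain ⟨t, ht, D, hD, hDcl⟩ := exists_finite_closed_cover X hε
  have := ht.to_subtype
  obtain ⟨f, hf⟩ := hB.exists_inter hD
  have hmaps : ∀ γ : P × Bool → P, ∃ h ≥ M, ∀ q, MapsTo T^[h] (B q ∩ D (f q)) (A (γ q)) :=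
    fun γ => (hΓ γ (Finset.mem_univ _)).imp fun h hh =>
      ⟨hh.1, fun q => (hh.2 q).mono_left inter_subset_left⟩
  refine ⟨_, hf, fun q => (hBcl q).inter (hDcl _).1, fun q => inter_subset_left.trans (hBA q),
    fun q q' hqq => ?_, fun q y hy z hz => (hDcl _).2 y hy.2 z hz.2, hmaps⟩
  obtain ⟨h, -, hh⟩ := hmaps fun r => if r = q then a else a'
  rw [Set.disjoint_left]
  intro z hz hz'
  have h1 := hh q hz
  have h2 := hh q' hz'
  simp only [if_pos, if_neg hqq.symm] at h1 h2
  exact Set.disjoint_left.1 haa h1 h2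

/-- A finite disjoint collection of at least two closed sets with an independence set of
positive density. -/
structure GoodCollection {X : Type*} [TopologicalSpace X] (T : X → X) (F : Set (Set X)) :
    Prop where
  finite : F.Finite
  nontrivial : F.Nontrivial
  isClosed : ∀ B ∈ F, IsClosed B
  good : Good T (Subtype.val : F → Set X)
  disjoint : ∀ B ∈ F, ∀ B' ∈ F, B ≠ B' → Disjoint B B'

theorem GoodCollection.nonempty {X : Type*} [TopologicalSpace X] {T : X → X} {F : Set (Set X)}
    (hF : GoodCollection T F) {B : Set X} (hB : B ∈ F) : B.Nonempty :=
  hF.good.nonempty ⟨B, hB⟩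

theorem GoodCollection.of_range {X P : Type*} [TopologicalSpace X] [Finite P] [Nonempty P]
    {T : X → X} {B : P × Bool → Set X} (hB : Good T B) (hcl : ∀ q, IsClosed (B q))
    (hdisj : ∀ q q', q ≠ q' → Disjoint (B q) (B q')) : GoodCollection T (range B) where
  finite := finite_range B
  nontrivial := by
    obtain ⟨p⟩ := ‹Nonempty P›
    refine ⟨B (p, true), mem_range_self _, B (p, false), mem_range_self _, fun h => ?_⟩
    have h1 := hdisj (p, true) (p, false) (by simp)
    rw [h, disjoint_self] at h1
    exact (hB.nonempty (p, false)).ne_empty h1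
  isClosed := by rintro _ ⟨q, rfl⟩; exact hcl q
  good := hB.mono (fun q => q.2.choose) fun q => q.2.choose_spec.subset
  disjoint := by
    rintro _ ⟨q, rfl⟩ _ ⟨q', rfl⟩ h
    exact hdisj q q' fun h' => h (h' ▸ rfl)

/-- `F'` refines `F`, has small members, and its members can be moved by an iterate of `T`
into arbitrarily prescribed members of `F`. -/
structure Refines {X : Type*} [MetricSpace X] (T : X → X) (n : ℕ) (F F' : Set (Set X)) :
    Prop where
  exists_superset : ∀ B ∈ F', ∃ A ∈ F, B ⊆ A
  exists_children : ∀ A ∈ F, ∃ B ∈ F', ∃ B' ∈ F', B ⊆ A ∧ B' ⊆ A ∧ Disjoint B B'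
  dist_le : ∀ B ∈ F', ∀ y ∈ B, ∀ z ∈ B, dist y z ≤ 1 / ((n : ℝ) + 1)
  exists_mapsTo : ∀ γ : Set X → Set X, (∀ B ∈ F', γ B ∈ F) →
    ∃ h ≥ n, ∀ B ∈ F', MapsTo T^[h] B (γ B)

theorem GoodCollection.exists_refines {X : Type*} [MetricSpace X] [CompactSpace X] {T : X → X}
    (hT : Continuous T) {F : Set (Set X)} (hF : GoodCollection T F) (n : ℕ) :
    ∃ F', GoodCollection T F' ∧ Refines T n F F' := by
  have := hF.finite.to_subtype
  obtain ⟨a, ha, a', ha', hne⟩ := hF.nontrivial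
  have : Nonempty F := ⟨⟨a, ha⟩⟩
  obtain ⟨B, hB, hcl, hBA, hdisj, hdist, hmaps⟩ := hF.good.exists_split hT
    (fun p => hF.isClosed p p.2) (a := ⟨a, ha⟩) (a' := ⟨a', ha'⟩) (hF.disjoint a ha a' ha' hne)
    (ε := 1 / ((n : ℝ) + 1)) (by positivity) n
  refine ⟨range B, .of_range hB hcl hdisj, ?_, ?_, ?_, ?_⟩
  · rintro _ ⟨q, rfl⟩
    exact ⟨q.1, q.1.2, hBA q⟩
  · intro A hA
    exact ⟨B (⟨A, hA⟩, true), mem_range_self _, B (⟨A, hA⟩, false), mem_range_self _,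
      hBA _, hBA _, hdisj _ _ (by simp)⟩
  · rintro _ ⟨q, rfl⟩
    exact hdist q
  · intro γ hγ
    obtain ⟨h, hn, hh⟩ := hmaps fun q => ⟨γ (B q), hγ _ (mem_range_self q)⟩
    refine ⟨h, hn, ?_⟩
    rintro _ ⟨q, rfl⟩
    exact hh q

section Scheme

variable {X : Type*} [MetricSpace X] {T : X → X} {F : ℕ → Set (Set X)}

theorem isClosed_sUnion_goodCollection {F : Set (Set X)} (hF : GoodCollection T F) :
    IsClosed (⋃₀ F) := by
  rw [sUnion_eq_biUnion]
  exact hF.finite.isClosed_biUnion hF.isClosed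

theorem antitone_sUnion (hR : ∀ n, Refines T n (F n) (F (n + 1))) :
    Antitone fun n => ⋃₀ F n := by
  refine antitone_nat_of_succ_le fun n => ?_
  rintro y ⟨B, hB, hy⟩
  obtain ⟨A, hA, hBA⟩ := (hR n).exists_superset B hB
  exact ⟨A, hA, hBA hy⟩

theorem exists_superset_zero (hR : ∀ n, Refines T n (F n) (F (n + 1))) (n : ℕ) :
    ∀ B ∈ F n, ∃ A ∈ F 0, B ⊆ A := by
  induction n with
  | zero => exact fun B hB => ⟨B, hB, subset_rfl⟩
  | succ n ih =>
    intro B hB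
    obtain ⟨A, hA, hBA⟩ := (hR n).exists_superset B hB
    obtain ⟨A', hA', hAA'⟩ := ih A hA
    exact ⟨A', hA', hBA.trans hAA'⟩

theorem inter_iInter_sUnion_nonempty [CompactSpace X] (hF : ∀ n, GoodCollection T (F n))
    (hR : ∀ n, Refines T n (F n) (F (n + 1))) {m : ℕ} {B : Set X} (hB : B ∈ F m) :
    (B ∩ ⋂ n, ⋃₀ F n).Nonempty := by
  have hchild : ∀ n (A : F (m + n)), ∃ A' : F (m + (n + 1)), (A' : Set X) ⊆ A := fun n A => by
    obtain ⟨A', hA', -, -, h, -⟩ := (hR (m + n)).exists_children A A.2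
    exact ⟨⟨A', hA'⟩, h⟩
  choose next hnext using hchild
  let C : ∀ n, F (m + n) := fun n => Nat.rec ⟨B, hB⟩ (fun n A => next n A) n
  have hcl : ∀ n, IsClosed (C n).1 := fun n => (hF (m + n)).isClosed _ (C n).2
  obtain ⟨z, hz⟩ := IsCompact.nonempty_iInter_of_sequence_nonempty_isCompact_isClosed
    (fun n => (C n).1) (fun n => hnext n (C n)) (fun n => (hF (m + n)).nonempty (C n).2)
    (hcl 0).isCompact hcl
  rw [mem_iInter] at hz
  exact ⟨z, hz 0, mem_iInter.2 fun n =>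
    antitone_sUnion hR (Nat.le_add_left n m) ⟨(C n).1, (C n).2, hz n⟩⟩

theorem perfect_inter_iInter_sUnion [CompactSpace X] (hF : ∀ n, GoodCollection T (F n))
    (hR : ∀ n, Refines T n (F n) (F (n + 1))) {B : Set X} (hB : B ∈ F 0) :
    Perfect (B ∩ ⋂ n, ⋃₀ F n) := by
  refine ⟨((hF 0).isClosed B hB).inter
    (isClosed_iInter fun n => isClosed_sUnion_goodCollection (hF n)), fun y hy => ?_⟩
  rw [accPt_iff_nhds]
  intro U hU
  obtain ⟨ε, hε, hball⟩ := Metric.mem_nhds_iff.1 hU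
  obtain ⟨n, hn⟩ := exists_nat_one_div_lt hε
  obtain ⟨P, hP, hyP⟩ := mem_iInter.1 hy.2 (n + 1)
  obtain ⟨B₁, hB₁, B₂, hB₂, h₁, h₂, hdisj⟩ := (hR (n + 1)).exists_children P hP
  obtain ⟨Q, hQ, hPQ⟩ := exists_superset_zero hR _ P hP
  have hQB : Q = B := by
    by_contra h
    exact Set.disjoint_left.1 ((hF 0).disjoint Q hQ B hB h) (hPQ hyP) hy.1
  subst hQB
  have hU' : P ⊆ U := fun z hz => hball (((hR n).dist_le P hP z hz y hyP).trans_lt hn)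
  obtain ⟨z₁, hz₁, hK₁⟩ := inter_iInter_sUnion_nonempty hF hR hB₁
  obtain ⟨z₂, hz₂, hK₂⟩ := inter_iInter_sUnion_nonempty hF hR hB₂
  by_cases h : z₁ = y
  · refine ⟨z₂, ⟨hU' (h₂ hz₂), hPQ (h₂ hz₂), hK₂⟩, fun h' => ?_⟩
    exact Set.disjoint_left.1 hdisj hz₁ (by rwa [h, ← h'])
  · exact ⟨z₁, ⟨hU' (h₁ hz₁), hPQ (h₁ hz₁), hK₁⟩, h⟩

theorem isTotallyDisconnected_iInter_sUnion (hF : ∀ n, GoodCollection T (F n))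
    (hR : ∀ n, Refines T n (F n) (F (n + 1))) : IsTotallyDisconnected (⋂ n, ⋃₀ F n) := by
  intro t ht hconn y hy y' hy'
  by_contra hne
  obtain ⟨n, hn⟩ := exists_nat_one_div_lt (dist_pos.2 hne)
  obtain ⟨P, hP, hyP⟩ := mem_iInter.1 (ht hy) (n + 1)
  have hy'P : y' ∉ P := fun h => ((hR n).dist_le P hP y hyP y' h).not_gt hn
  have hclosed : IsClosed (⋃ B ∈ F (n + 1) \ {P}, B) :=
    ((hF (n + 1)).finite.subset sdiff_subset).isClosed_biUnion
      fun B hB => (hF (n + 1)).isClosed B hB.1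
  have hcov : ∀ z ∈ t, z ∉ P → z ∈ ⋃ B ∈ F (n + 1) \ {P}, B := fun z hz hzP => by
    obtain ⟨Q, hQ, hzQ⟩ := mem_iInter.1 (ht hz) (n + 1)
    exact mem_biUnion (show Q ∈ F (n + 1) \ {P} from ⟨hQ, fun h => hzP (h ▸ hzQ)⟩) hzQ
  obtain ⟨z, -, hzP, hz⟩ := isPreconnected_closed_iff.1 hconn P _
    ((hF (n + 1)).isClosed P hP) hclosed (fun z hz => or_iff_not_imp_left.2 (hcov z hz))
    ⟨y, hy, hyP⟩ ⟨y', hy', hcov y' hy' hy'P⟩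
  obtain ⟨Q, hQ, hzQ⟩ := mem_iUnion₂.1 hz
  exact Set.disjoint_left.1 ((hF (n + 1)).disjoint Q hQ.1 P hP hQ.2) hzQ hzP

theorem isIETuple_of_mem_iInter_sUnion (hF : ∀ n, GoodCollection T (F n))
    (hR : ∀ n, Refines T n (F n) (F (n + 1))) {m : ℕ} (y : Fin m → X)
    (hy : ∀ i, y i ∈ ⋂ n, ⋃₀ F n) : IsIETuple T y := by
  intro U hU hyU
  have hev : ∀ᶠ n : ℕ in atTop, ∀ i, Metric.closedBall (y i) (1 / ((n : ℝ) + 1)) ⊆ U i := by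
    refine eventually_all.2 fun i => ?_
    obtain ⟨ε, hε, hball⟩ := Metric.isOpen_iff.1 (hU i) (y i) (hyU i)
    filter_upwards [tendsto_one_div_add_atTop_nhds_zero_nat.eventually (gt_mem_nhds hε)] with n hn
    exact (Metric.closedBall_subset_ball hn).trans hball
  obtain ⟨n, hn⟩ := hev.exists
  choose P hP hyP using fun i => mem_iInter.1 (hy i) (n + 1)
  exact ((hF (n + 1)).good.mono (fun i => ⟨P i, hP i⟩) fun i z hz =>
    hn i ((hR n).dist_le _ (hP i) z hz _ (hyP i))).hasIndepSetPosDensity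

theorem liminf_dist_eq_zero [CompactSpace X]
    (hR : ∀ n, Refines T n (F n) (F (n + 1))) {m : ℕ} (hm : 0 < m) (y y' : Fin m → X)
    (hinj : Function.Injective y) (hy : ∀ i, y i ∈ ⋂ n, ⋃₀ F n)
    (hy' : ∀ i, y' i ∈ ⋂ n, ⋃₀ F n) :
    liminf (fun n : ℕ => ⨆ i, dist (T^[n] (y i)) (y' i)) atTop = 0 := by
  have : Nonempty (Fin m) := ⟨⟨0, hm⟩⟩
  have h0 : ∀ n : ℕ, 0 ≤ ⨆ i, dist (T^[n] (y i)) (y' i) := fun n =>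
    Real.iSup_nonneg fun _ => dist_nonneg
  have hle : ∀ n : ℕ, ⨆ i, dist (T^[n] (y i)) (y' i) ≤ Metric.diam (univ : Set X) := fun n =>
    ciSup_le fun i => Metric.dist_le_diam_of_mem isCompact_univ.isBounded (mem_univ _) (mem_univ _)
  have hbdd : IsBoundedUnder (· ≥ ·) atTop fun n : ℕ => ⨆ i, dist (T^[n] (y i)) (y' i) :=
    isBoundedUnder_of ⟨0, h0⟩
  have hcobdd : IsCoboundedUnder (· ≥ ·) atTop fun n : ℕ => ⨆ i, dist (T^[n] (y i)) (y' i) :=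
    (isBoundedUnder_of ⟨_, hle⟩ : IsBoundedUnder (· ≤ ·) atTop _).isCoboundedUnder_ge
  refine le_antisymm (le_of_forall_pos_le_add fun ε hε => ?_)
    (le_liminf_of_le hcobdd (Eventually.of_forall h0))
  rw [zero_add]
  refine liminf_le_of_frequently_le (frequently_atTop.2 fun N => ?_) hbdd
  have hev : ∀ᶠ n : ℕ in atTop, ∀ i j, y i ≠ y j → 1 / ((n : ℝ) + 1) < dist (y i) (y j) :=
    eventually_all.2 fun i => eventually_all.2 fun j => by
      by_cases h : y i = y j
      · simp [h]
      · filter_upwards [tendsto_one_div_add_atTop_nhds_zero_nat.eventually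
          (gt_mem_nhds (dist_pos.2 h))] with n hn _ using hn
  obtain ⟨n, hnd, hnε, hnN⟩ := (hev.and ((tendsto_one_div_add_atTop_nhds_zero_nat.eventually
    (gt_mem_nhds hε)).and (eventually_ge_atTop N))).exists
  choose B hB hyB using fun i => mem_iInter.1 (hy i) (n + 2)
  choose A hA hyA using fun i => mem_iInter.1 (hy' i) (n + 1)
  have hBinj : Function.Injective B := by
    intro i j hij
    by_contra hne
    have h1 := (hR (n + 1)).dist_le (B i) (hB i) _ (hyB i) (y j) (hij ▸ hyB j)
    have h2 := hnd i j (hinj.ne hne)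
    have h3 : 1 / (((n + 1 : ℕ) : ℝ) + 1) ≤ 1 / ((n : ℝ) + 1) := by
      gcongr
      simp
    linarith
  obtain ⟨h, hh, hmaps⟩ := (hR (n + 1)).exists_mapsTo
    (Function.extend B A fun _ => A ⟨0, hm⟩) (fun P _ => by
      by_cases hP : ∃ i, B i = P
      · obtain ⟨i, rfl⟩ := hP
        rw [hBinj.extend_apply]
        exact hA i
      · rw [Function.extend_apply' _ _ _ hP]
        exact hA _)
  refine ⟨h, by omega, ciSup_le fun i => ?_⟩
  have h1 := hmaps (B i) (hB i) (hyB i)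
  rw [hBinj.extend_apply] at h1
  exact ((hR n).dist_le _ (hA i) _ h1 _ (hyA i)).trans hnε.le

end Scheme

/-- Theorem `T-LY`.  Here a Cantor set is a nonempty compact perfect
totally disconnected (metrizable) subset. -/
theorem stmt11 {X : Type*} [MetricSpace X] [CompactSpace X]
    (T : X → X) (hT : Continuous T) (hTs : Function.Surjective T)
    {k : ℕ} (hk : 2 ≤ k) (x : Fin k → X) (hxIE : IsIETuple T x) (hxnd : ∃ i j, x i ≠ x j)
    (A : Fin k → Set X) (hA : ∀ j, A j ∈ nhds (x j)) :
    ∃ Z : Fin k → Set X,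
      (∀ j, Z j ⊆ A j ∧ (Z j).Nonempty ∧ IsCompact (Z j) ∧ Perfect (Z j) ∧
        IsTotallyDisconnected (Z j)) ∧
      (∀ (m : ℕ) (y : Fin m → X), 0 < m → (∀ i, y i ∈ ⋃ j, Z j) → IsIETuple T y) ∧
      (∀ m : ℕ, 0 < m → ∀ y y' : Fin m → X, Function.Injective y →
        (∀ i, y i ∈ ⋃ j, Z j) → (∀ i, y' i ∈ ⋃ j, Z j) →
        Filter.liminf (fun n : ℕ => ⨆ i, dist (T^[n] (y i)) (y' i)) atTop = 0) := by
  obtain ⟨a, a', hne⟩ := hxnd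
  have : Nonempty X := ⟨x a⟩
  have : Nonempty (Fin k) := ⟨a⟩
  obtain ⟨r, hr, hrA, hra⟩ : ∃ r > 0, (∀ j, Metric.closedBall (x j) r ⊆ A j) ∧
      2 * r < dist (x a) (x a') := by
    have hev : ∀ᶠ r in nhdsWithin (0 : ℝ) (Ioi 0), ∀ j, Metric.closedBall (x j) r ⊆ A j :=
      eventually_all.2 fun j => by
        obtain ⟨ε, hε, hball⟩ := Metric.mem_nhds_iff.1 (hA j)
        filter_upwards [Ioo_mem_nhdsGT hε] with r hr
        exact (Metric.closedBall_subset_ball hr.2).trans hball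
    have hlt : ∀ᶠ r in nhdsWithin (0 : ℝ) (Ioi 0), r ∈ Ioo 0 (dist (x a) (x a') / 2) :=
      Ioo_mem_nhdsGT (half_pos (dist_pos.2 hne))
    obtain ⟨r, ⟨h1, h2⟩, h3⟩ := (hlt.and hev).exists
    exact ⟨r, h1, h3, by linarith⟩
  have hgood : Good T fun j => Metric.closedBall (x j) r :=
    (hxIE (fun j => Metric.ball (x j) r) (fun j => Metric.isOpen_ball)
      fun j => Metric.mem_ball_self hr).good.mono id fun j => Metric.ball_subset_closedBall
  obtain ⟨B, hB, hBcl, hBA, hBdisj, -, -⟩ := hgood.exists_split hT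
    (fun _ => Metric.isClosed_closedBall) (a := a) (a' := a')
    (Metric.closedBall_disjoint_closedBall (by linarith)) one_pos 0
  choose! next hnext using fun (p : ℕ × Set (Set X)) (hF : GoodCollection T p.2) =>
    hF.exists_refines hT p.1
  let F : ℕ → Set (Set X) := fun n => Nat.rec (range B) (fun n G => next (n, G)) n
  have hF : ∀ n, GoodCollection T (F n) := by
    intro n
    induction n with
    | zero => exact .of_range hB hBcl hBdisj
    | succ n ih => exact (hnext (n, F n) ih).1
  have hR : ∀ n, Refines T n (F n) (F (n + 1)) := fun n => (hnext (n, F n) (hF n)).2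
  have hmem : ∀ j, B (j, true) ∈ F 0 := fun j => mem_range_self _
  have hZK : ∀ y ∈ ⋃ j, B (j, true) ∩ ⋂ n, ⋃₀ F n, y ∈ ⋂ n, ⋃₀ F n := fun y hy => by
    obtain ⟨j, hj⟩ := mem_iUnion.1 hy
    exact hj.2
  refine ⟨fun j => B (j, true) ∩ ⋂ n, ⋃₀ F n, fun j => ?_, fun m y _ hy => ?_,
    fun m hm y y' hinj hy hy' => ?_⟩
  · have hperf := perfect_inter_iInter_sUnion hF hR (hmem j)
    exact ⟨inter_subset_left.trans ((hBA _).trans (hrA j)),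
      inter_iInter_sUnion_nonempty hF hR (m := 0) (hmem j), hperf.closed.isCompact, hperf,
      fun t ht => isTotallyDisconnected_iInter_sUnion hF hR t (ht.trans inter_subset_right)⟩
  · exact isIETuple_of_mem_iInter_sUnion hF hR y fun i => hZK _ (hy i)
  · exact liminf_dist_eq_zero hR hm y y' hinj (fun i => hZK _ (hy i)) fun i => hZK _ (hy' i)
end

section
/- Suppose X is a compact metrizable space with metric ρ and T : X → X is a surjective continuous map with h_top(T) > 0. Then (X, T) is Li-Yorke chaotic: X contains an uncountable scrambled set. -/
open Filter Set


/-- `covNumOpen T V n` is `N(𝒱 ∨ T⁻¹𝒱 ∨ ⋯ ∨ T^{-n+1}𝒱)`, the minimal cardinality of a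
subcover, for the cover `𝒱 = {V 0, …, V (l-1)}` of `X`. -/
noncomputable def covNumOpen {X : Type*} (T : X → X) {l : ℕ} (V : Fin l → Set X)
    (n : ℕ) : ℕ :=
  sInf {m : ℕ | ∃ F : Finset (Fin n → Fin l), F.card = m ∧
    (⋃ σ ∈ F, ⋂ i : Fin n, T^[(i : ℕ)] ⁻¹' V (σ i)) = Set.univ}

section Patterns

variable {κ : Type*} {n : ℕ}

/-- The word `τ` disagrees everywhere with the partial word `s`. -/
def Avoids (τ : Fin n → κ) (s : Fin n → Option κ) : Prop :=
  ∀ i, s i ≠ some (τ i)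

/-- Every word on the positions `I` is realised by some partial word in `S`. -/
def PatternShatters (S : Finset (Fin n → Option κ)) (I : Finset (Fin n)) : Prop :=
  ∀ σ : Fin n → κ, ∃ s ∈ S, ∀ i ∈ I, s i = some (σ i)

theorem PatternShatters.mono {S S' : Finset (Fin n → Option κ)} {I : Finset (Fin n)}
    (h : PatternShatters S I) (hS : S ⊆ S') : PatternShatters S' I := fun σ =>
  let ⟨s, hs, hI⟩ := h σ
  ⟨s, hS hs, hI⟩

open Classical in
/-- If a proportion `δ` of every subset of `S` is avoided by a single word, then `S` is covered
greedily by few words. -/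
theorem exists_small_avoiding_set (S : Finset (Fin n → Option κ)) {δ : ℝ} (hδ : δ ≤ 1)
    (h : ∀ S₁ ⊆ S, S₁.Nonempty → ∃ τ : Fin n → κ,
      δ * (S₁.card : ℝ) ≤ ((S₁.filter (Avoids τ)).card : ℝ)) (m : ℕ) :
    ∀ S₁ ⊆ S, (1 - δ) ^ m * (S₁.card : ℝ) < 1 →
      ∃ F : Finset (Fin n → κ), F.card ≤ m ∧ ∀ s ∈ S₁, ∃ τ ∈ F, Avoids τ s := by
  induction m with
  | zero =>
    intro S₁ _ hlt
    have h0 : S₁ = ∅ := by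
      rw [pow_zero, one_mul] at hlt
      have : S₁.card < 1 := by exact_mod_cast hlt
      exact Finset.card_eq_zero.mp (by omega)
    exact ⟨∅, by simp, by simp [h0]⟩
  | succ m ih =>
    intro S₁ hS₁ hlt
    rcases S₁.eq_empty_or_nonempty with rfl | hne
    · exact ⟨∅, by simp, by simp⟩
    obtain ⟨τ, hτ⟩ := h S₁ hS₁ hne
    have hcard : ((S₁.filter (Avoids τ)).card : ℝ) +
        ((S₁.filter fun s => ¬ Avoids τ s).card : ℝ) = S₁.card := by
      exact_mod_cast Finset.card_filter_add_card_filter_not (Avoids τ)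
    obtain ⟨F, hF, hcov⟩ := ih (S₁.filter fun s => ¬ Avoids τ s)
      ((Finset.filter_subset _ _).trans hS₁) (by
        refine lt_of_le_of_lt ?_ hlt
        rw [pow_succ, mul_assoc]
        exact mul_le_mul_of_nonneg_left (by linarith) (pow_nonneg (by linarith) m))
    refine ⟨insert τ F, (Finset.card_insert_le _ _).trans (by omega), fun s hs => ?_⟩
    by_cases hs' : Avoids τ s
    · exact ⟨τ, Finset.mem_insert_self _ _, hs'⟩
    · obtain ⟨τ', hτ', hav⟩ := hcov s (by simp [hs, hs'])
      exact ⟨τ', Finset.mem_insert_of_mem hτ', hav⟩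

variable [Fintype κ]

theorem sum_pow_card_finset (n : ℕ) (x : ℝ) :
    ∑ E : Finset (Fin n), x ^ E.card = (1 + x) ^ n := by
  have := Finset.sum_pow_mul_eq_add_pow x 1 (Finset.univ : Finset (Fin n))
  simpa [add_comm] using this

open Classical in
/-- If no single word is avoided by a large part of `S'`, then at some position every letter
occurs in a fixed proportion of `S'`. -/
theorem exists_balanced_coordinate [Nontrivial κ] (S' : Finset (Fin n → Option κ))
    {ε L D : ℝ} (hL : 0 ≤ L)
    (hD : ∀ τ : Fin n → κ, ((S'.filter (Avoids τ)).card : ℝ) ≤ D)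
    (hlt : Real.exp (Real.exp (-L) * n + L * ε * n) * D < S'.card) :
    ∃ i, ∀ a : κ, ε * (S'.card : ℝ) ≤ ((S'.filter fun s => s i = some a).card : ℝ) := by
  by_contra! hcon
  choose τ hτ using hcon
  let e : (Fin n → Option κ) → Finset (Fin n) := fun s =>
    Finset.univ.filter fun i => s i = some (τ i)
  have hfib : ∀ E : Finset (Fin n), ((S'.filter fun s => e s = E).card : ℝ) ≤ D := by
    intro E
    choose flip hflip using fun a : κ => exists_ne a
    refine le_trans ?_ (hD fun i => if i ∈ E then flip (τ i) else τ i)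
    refine Nat.cast_le.mpr (Finset.card_le_card fun s hs => ?_)
    obtain ⟨hs', rfl⟩ := Finset.mem_filter.mp hs
    refine Finset.mem_filter.mpr ⟨hs', fun i => ?_⟩
    by_cases hi : s i = some (τ i)
    · simp [e, hi, (hflip (τ i)).symm]
    · simp [e, hi]
  have hsum : ∑ s ∈ S', ((e s).card : ℝ) ≤ ε * n * S'.card := by
    have : ∑ s ∈ S', ((e s).card : ℝ) =
        ∑ i : Fin n, ((S'.filter fun s => s i = some (τ i)).card : ℝ) := by
      simp only [e, Finset.card_filter, Nat.cast_sum]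
      exact Finset.sum_comm
    rw [this]
    calc _ ≤ ∑ i : Fin n, ε * (S'.card : ℝ) := Finset.sum_le_sum fun i _ => (hτ i).le
      _ = ε * n * S'.card := by simp; ring
  have hupper : ∑ s ∈ S', Real.exp (-L) ^ (e s).card ≤ Real.exp (Real.exp (-L) * n) * D := by
    have hD0 : 0 ≤ D := (Nat.cast_nonneg _).trans (hD τ)
    calc ∑ s ∈ S', Real.exp (-L) ^ (e s).card
        = ∑ E : Finset (Fin n), ∑ s ∈ S' with e s = E, Real.exp (-L) ^ (e s).card :=
          (Finset.sum_fiberwise _ _ _).symm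
      _ = ∑ E : Finset (Fin n),
            Real.exp (-L) ^ E.card * ((S'.filter fun s => e s = E).card : ℝ) := by
          refine Finset.sum_congr rfl fun E _ => ?_
          rw [Finset.sum_congr rfl (g := fun _ => Real.exp (-L) ^ E.card)
            fun s hs => by rw [(Finset.mem_filter.mp hs).2]]
          simp [mul_comm]
      _ ≤ ∑ E : Finset (Fin n), Real.exp (-L) ^ E.card * D :=
          Finset.sum_le_sum fun E _ => mul_le_mul_of_nonneg_left (hfib E) (by positivity)
      _ = (1 + Real.exp (-L)) ^ n * D := by rw [← Finset.sum_mul, sum_pow_card_finset]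
      _ ≤ Real.exp (Real.exp (-L)) ^ n * D := by
          refine mul_le_mul_of_nonneg_right (pow_le_pow_left₀ (by positivity) ?_ n) hD0
          linarith [Real.add_one_le_exp (Real.exp (-L))]
      _ = Real.exp (Real.exp (-L) * n) * D := by rw [← Real.exp_nat_mul, mul_comm (n : ℝ)]
  have hlower : Real.exp (-(L * ε * n)) * S'.card ≤ ∑ s ∈ S', Real.exp (-L) ^ (e s).card := by
    calc Real.exp (-(L * ε * n)) * S'.card
        ≤ Real.exp (-(L * ε * n)) *
            ∑ s ∈ S', (1 - L * (((e s).card : ℝ) - ε * n)) := by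
          refine mul_le_mul_of_nonneg_left ?_ (Real.exp_pos _).le
          rw [Finset.sum_sub_distrib, ← Finset.mul_sum, Finset.sum_sub_distrib]
          simp only [Finset.sum_const, nsmul_eq_mul, mul_one]
          nlinarith
      _ ≤ _ := by
          rw [Finset.mul_sum]
          refine Finset.sum_le_sum fun s _ => ?_
          have h1 := Real.add_one_le_exp (-(L * (((e s).card : ℝ) - ε * n)))
          calc _ ≤ Real.exp (-(L * ε * n)) * Real.exp (-(L * (((e s).card : ℝ) - ε * n))) :=
                mul_le_mul_of_nonneg_left (by linarith) (Real.exp_pos _).le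
            _ = _ := by rw [← Real.exp_add, ← Real.exp_nat_mul]; congr 1; ring
  have h2 : (S'.card : ℝ) ≤ Real.exp (L * ε * n) * (Real.exp (Real.exp (-L) * n) * D) := by
    calc (S'.card : ℝ) = Real.exp (L * ε * n) * (Real.exp (-(L * ε * n)) * S'.card) := by
          rw [← mul_assoc, ← Real.exp_add]; simp
      _ ≤ _ := mul_le_mul_of_nonneg_left (hlower.trans hupper) (Real.exp_pos _).le
  rw [← mul_assoc, ← Real.exp_add, add_comm] at h2
  linarith

open Classical in
/-- The family of position sets shattered by `S`. -/
noncomputable def patternShatterer (S : Finset (Fin n → Option κ)) : Finset (Finset (Fin n)) :=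
  Finset.univ.filter (PatternShatters S)

open Classical in
theorem card_mul_le_card_patternShatterer [Nontrivial κ] (S : Finset (Fin n → Option κ))
    (i : Fin n) {Q : ℝ}
    (hQ : ∀ a : κ, Q ≤ ((patternShatterer (S.filter fun s => s i = some a)).card : ℝ)) :
    (Fintype.card κ : ℝ) * Q ≤ ((Fintype.card κ : ℝ) - 1) * ((patternShatterer S).card : ℝ) := by
  let Sh : κ → Finset (Finset (Fin n)) := fun a => patternShatterer (S.filter fun s => s i = some a)
  let U : Finset (Finset (Fin n)) := Finset.univ.filter fun I => ∃ a, I ∈ Sh a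
  let W : Finset (Finset (Fin n)) := Finset.univ.filter fun I => ∀ a, I ∈ Sh a
  have hk : (2 : ℝ) ≤ Fintype.card κ := by
    exact_mod_cast Fintype.one_lt_card (α := κ)
  have hmem : ∀ a I, I ∈ Sh a ↔ PatternShatters (S.filter fun s => s i = some a) I := by
    intro a I; simp [Sh, patternShatterer]
  have hnot : ∀ a I, I ∈ Sh a → i ∉ I := by
    intro a I hI hiI
    obtain ⟨b, hb⟩ := exists_ne a
    obtain ⟨s, hs, h⟩ := (hmem a I).mp hI fun _ => b
    have h1 := (Finset.mem_filter.mp hs).2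
    rw [h i hiI] at h1
    exact hb (Option.some.inj h1)
  have hsub : U ∪ W.image (insert i) ⊆ patternShatterer S := by
    intro I hI
    refine Finset.mem_filter.mpr ⟨Finset.mem_univ _, ?_⟩
    rcases Finset.mem_union.mp hI with hI | hI
    · obtain ⟨a, ha⟩ := (Finset.mem_filter.mp hI).2
      exact ((hmem a I).mp ha).mono (Finset.filter_subset _ _)
    · obtain ⟨J, hJ, rfl⟩ := Finset.mem_image.mp hI
      intro σ
      obtain ⟨s, hs, h⟩ := (hmem (σ i) J).mp ((Finset.mem_filter.mp hJ).2 (σ i)) σ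
      obtain ⟨hs, hsi⟩ := Finset.mem_filter.mp hs
      refine ⟨s, hs, fun j hj => ?_⟩
      rcases Finset.mem_insert.mp hj with rfl | hj
      · exact hsi
      · exact h j hj
  have hcard : (U.card : ℝ) + W.card ≤ (patternShatterer S).card := by
    rw [← Nat.cast_add, Nat.cast_le]
    refine le_trans (le_of_eq ?_) (Finset.card_le_card hsub)
    obtain ⟨a⟩ : Nonempty κ := inferInstance
    rw [Finset.card_union_of_disjoint, Finset.card_image_of_injOn]
    · intro I hI J hJ hIJ
      have hI' := hnot a I ((Finset.mem_filter.mp hI).2 a)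
      have hJ' := hnot a J ((Finset.mem_filter.mp hJ).2 a)
      simpa [Finset.erase_insert hI', Finset.erase_insert hJ'] using congrArg (Finset.erase · i) hIJ
    · rw [Finset.disjoint_left]
      intro I hI hI'
      obtain ⟨b, hb⟩ := (Finset.mem_filter.mp hI).2
      obtain ⟨J, -, rfl⟩ := Finset.mem_image.mp hI'
      exact hnot b _ hb (Finset.mem_insert_self _ _)
  have hWU : W ⊆ U := by
    intro I hI
    obtain ⟨a⟩ : Nonempty κ := inferInstance
    exact Finset.mem_filter.mpr ⟨Finset.mem_univ _, a, (Finset.mem_filter.mp hI).2 a⟩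
  have hdouble : ∑ a, ((Sh a).card : ℝ) ≤ ((Fintype.card κ : ℝ) - 1) * U.card + W.card := by
    calc ∑ a, ((Sh a).card : ℝ)
        = ∑ a, ∑ I ∈ U, (if I ∈ Sh a then 1 else 0 : ℝ) := by
          refine Finset.sum_congr rfl fun a _ => ?_
          rw [Finset.sum_boole, Finset.filter_mem_eq_inter, Finset.inter_eq_right.mpr]
          exact fun I hI => Finset.mem_filter.mpr ⟨Finset.mem_univ _, a, hI⟩
      _ = ∑ I ∈ U, ∑ a, (if I ∈ Sh a then 1 else 0 : ℝ) := Finset.sum_comm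
      _ ≤ ∑ I ∈ U, (((Fintype.card κ : ℝ) - 1) + if I ∈ W then 1 else 0) := by
          refine Finset.sum_le_sum fun I _ => ?_
          by_cases hI : I ∈ W
          · have : ∀ a, I ∈ Sh a := (Finset.mem_filter.mp hI).2
            simp [hI, this]
          · have : ∃ a, I ∉ Sh a := by simpa [W] using hI
            obtain ⟨a, ha⟩ := this
            rw [if_neg hI, add_zero, ← Finset.add_sum_erase _ _ (Finset.mem_univ a), if_neg ha,
              zero_add]
            calc _ ≤ ∑ _b ∈ Finset.univ.erase a, (1 : ℝ) :=
                  Finset.sum_le_sum fun b _ => by split_ifs <;> norm_num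
              _ = _ := by
                  rw [Finset.sum_const, Finset.card_erase_of_mem (Finset.mem_univ a),
                    Finset.card_univ, nsmul_eq_mul, mul_one, Nat.cast_sub (by
                      exact_mod_cast (by linarith : (1 : ℝ) ≤ Fintype.card κ)), Nat.cast_one]
      _ = _ := by
          rw [Finset.sum_add_distrib, Finset.sum_boole, Finset.filter_mem_eq_inter,
            Finset.inter_eq_right.mpr hWU, Finset.sum_const, nsmul_eq_mul, mul_comm]
  have hlow : (Fintype.card κ : ℝ) * Q ≤ ∑ a, ((Sh a).card : ℝ) := by
    calc (Fintype.card κ : ℝ) * Q = ∑ _a : κ, Q := by simp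
      _ ≤ _ := Finset.sum_le_sum fun a _ => hQ a
  have hW0 : (0 : ℝ) ≤ W.card := Nat.cast_nonneg _
  nlinarith

open Classical in
/-- Many position sets are shattered as soon as balanced coordinates persist in all subsets of
cardinality at least `c`. -/
theorem pow_le_card_patternShatterer [Nontrivial κ] {c ε : ℝ} (hc : 0 < c) (hε : 0 ≤ ε)
    (hε1 : ε ≤ 1) (S : Finset (Fin n → Option κ))
    (h : ∀ S' ⊆ S, c ≤ (S'.card : ℝ) →
      ∃ i, ∀ a : κ, ε * (S'.card : ℝ) ≤ ((S'.filter fun s => s i = some a).card : ℝ)) (m : ℕ) :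
    ∀ S' ⊆ S, c ≤ ε ^ m * (S'.card : ℝ) →
      ((Fintype.card κ : ℝ) / (Fintype.card κ - 1)) ^ m ≤ ((patternShatterer S').card : ℝ) := by
  have hk : (2 : ℝ) ≤ Fintype.card κ := by
    exact_mod_cast Fintype.one_lt_card (α := κ)
  induction m with
  | zero =>
    intro S' _ hS'
    rw [pow_zero, one_mul] at hS'
    have hne : S'.Nonempty := by
      rw [← Finset.card_pos]
      exact_mod_cast hc.trans_le hS'
    obtain ⟨s, hs⟩ := hne
    rw [pow_zero, Nat.one_le_cast, Nat.one_le_iff_ne_zero, Finset.card_ne_zero]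
    exact ⟨∅, Finset.mem_filter.mpr ⟨Finset.mem_univ _, fun _ => ⟨s, hs, by simp⟩⟩⟩
  | succ m ih =>
    intro S' hS' hle
    have hc' : c ≤ (S'.card : ℝ) :=
      hle.trans (mul_le_of_le_one_left (Nat.cast_nonneg _) (pow_le_one₀ hε hε1))
    obtain ⟨i, hi⟩ := h S' hS' hc'
    have key := card_mul_le_card_patternShatterer S' i
      (Q := ((Fintype.card κ : ℝ) / (Fintype.card κ - 1)) ^ m) fun a => by
        refine ih _ ((Finset.filter_subset _ _).trans hS') (hle.trans ?_)
        rw [pow_succ, mul_assoc]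
        exact mul_le_mul_of_nonneg_left (hi a) (pow_nonneg hε m)
    rw [pow_succ', div_mul_eq_mul_div, div_le_iff₀ (by linarith)]
    linarith

theorem exists_exp_neg_add_mul_le {c : ℝ} (hc : 0 < c) :
    ∃ L ε : ℝ, 0 < L ∧ 0 < ε ∧ ε < 1 ∧ Real.exp (-L) + L * ε ≤ c := by
  obtain ⟨L, hL, hL0⟩ : ∃ L, Real.exp (-L) < c / 2 ∧ 0 < L := by
    have h1 : ∀ᶠ L in atTop, Real.exp (-L) < c / 2 :=
      (Real.tendsto_exp_neg_atTop_nhds_zero).eventually_lt_const (by positivity)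
    exact (h1.and (eventually_gt_atTop 0)).exists
  refine ⟨L, min (c / (2 * L)) (1 / 2), hL0, by positivity, ?_, ?_⟩
  · exact (min_le_right _ _).trans_lt (by norm_num)
  · have : L * min (c / (2 * L)) (1 / 2) ≤ L * (c / (2 * L)) :=
      mul_le_mul_of_nonneg_left (min_le_left _ _) hL0.le
    have h2 : L * (c / (2 * L)) = c / 2 := by field_simp
    linarith

open Classical in
/-- A Sauer–Shelah type dichotomy for partial words: either exponentially few words (at rate `b`)
suffice to avoid every element of `S`, or `S` shatters a set of positions of positive density. -/
theorem exists_avoiding_set_or_patternShatters [Nontrivial κ] {b : ℝ} (hb : 0 < b) :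
    ∃ d : ℝ, 0 < d ∧ ∀ᶠ n : ℕ in atTop, ∀ S : Finset (Fin n → Option κ),
      (∃ F : Finset (Fin n → κ), (F.card : ℝ) ≤ Real.exp (b * n) ∧
        ∀ s ∈ S, ∃ τ ∈ F, Avoids τ s) ∨
      ∃ I : Finset (Fin n), d * n ≤ I.card ∧ PatternShatters S I := by
  have hk : (2 : ℝ) ≤ Fintype.card κ := by
    exact_mod_cast Fintype.one_lt_card (α := κ)
  obtain ⟨L, ε, hL, hε, hε1, hLε⟩ := exists_exp_neg_add_mul_le (c := b / 8) (by positivity)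
  obtain ⟨E, hE, rfl⟩ : ∃ E, 0 < E ∧ Real.exp (-E) = ε :=
    ⟨-Real.log ε, by linarith [Real.log_neg hε hε1], by rw [neg_neg, Real.exp_log hε]⟩
  obtain ⟨Q, hQ, hQk⟩ : ∃ Q, 0 < Q ∧ Real.exp Q = (Fintype.card κ : ℝ) / (Fintype.card κ - 1) := by
    have h1 : 1 < (Fintype.card κ : ℝ) / (Fintype.card κ - 1) := by
      rw [lt_div_iff₀ (by linarith)]; linarith
    exact ⟨_, Real.log_pos h1, Real.exp_log (by linarith)⟩
  obtain ⟨K, hK, hKk⟩ : ∃ K, 0 < K ∧ Real.exp K = (Fintype.card κ : ℝ) + 1 :=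
    ⟨_, Real.log_pos (by linarith), Real.exp_log (by linarith)⟩
  obtain ⟨L₂, d, hL₂, hd, -, hLd⟩ :=
    exists_exp_neg_add_mul_le (c := Q * b / (8 * E)) (by positivity)
  refine ⟨d, hd, ?_⟩
  filter_upwards [eventually_gt_atTop 0,
    tendsto_natCast_atTop_atTop.eventually_gt_atTop (8 * E / b),
    tendsto_natCast_atTop_atTop.eventually_ge_atTop (8 * K / b ^ 2)] with n hn0 hnE hnK S
  have hn : (0 : ℝ) < n := by exact_mod_cast hn0
  rw [div_lt_iff₀ hb] at hnE
  rw [div_le_iff₀ (by positivity)] at hnK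
  by_cases H : ∀ S₁ ⊆ S, S₁.Nonempty → ∃ τ : Fin n → κ,
      Real.exp (-(b * n / 2)) * (S₁.card : ℝ) ≤ ((S₁.filter (Avoids τ)).card : ℝ)
  · left
    obtain ⟨F, hF, hcov⟩ := exists_small_avoiding_set S
      (Real.exp_le_one_iff.mpr (by rw [neg_nonpos]; positivity)) H
      (⌊K * n * Real.exp (b * n / 2)⌋₊ + 1) S subset_rfl (by
        have hcard : (S.card : ℝ) ≤ Real.exp (K * n) := by
          have : S.card ≤ (Fintype.card κ + 1) ^ n := by
            simpa using Finset.card_le_univ S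
          rw [mul_comm K, Real.exp_nat_mul, hKk]
          exact_mod_cast this
        have hm := Nat.lt_floor_add_one (K * n * Real.exp (b * n / 2))
        set m := ⌊K * n * Real.exp (b * n / 2)⌋₊
        have h1 : (1 - Real.exp (-(b * n / 2))) ^ (m + 1) ≤
            Real.exp (-Real.exp (-(b * n / 2)) * ((m : ℝ) + 1)) := by
          have h2 : (1 - Real.exp (-(b * n / 2))) ≤ Real.exp (-Real.exp (-(b * n / 2))) := by
            linarith [Real.add_one_le_exp (-Real.exp (-(b * n / 2)))]
          have h0 : 0 ≤ 1 - Real.exp (-(b * n / 2)) := by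
            have : Real.exp (-(b * n / 2)) ≤ 1 :=
              Real.exp_le_one_iff.mpr (by rw [neg_nonpos]; positivity)
            linarith
          refine (pow_le_pow_left₀ h0 h2 _).trans_eq ?_
          rw [← Real.exp_nat_mul]
          push_cast
          ring_nf
        calc _ ≤ Real.exp (-Real.exp (-(b * n / 2)) * ((m : ℝ) + 1)) * Real.exp (K * n) :=
              mul_le_mul h1 hcard (Nat.cast_nonneg _) (Real.exp_pos _).le
          _ < 1 := by
              rw [← Real.exp_add, Real.exp_lt_one_iff]
              have h3 : Real.exp (-(b * n / 2)) * (K * n * Real.exp (b * n / 2)) = K * n := by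
                rw [mul_comm, mul_assoc, ← Real.exp_add]; simp
              have h4 := mul_lt_mul_of_pos_left hm (Real.exp_pos (-(b * n / 2)))
              linarith)
    refine ⟨F, ?_, hcov⟩
    have h1 : (F.card : ℝ) ≤ ⌊K * n * Real.exp (b * n / 2)⌋₊ + 1 := by exact_mod_cast hF
    have h2 := Nat.floor_le (a := K * n * Real.exp (b * n / 2)) (by positivity)
    have h3 := Real.quadratic_le_exp_of_nonneg (x := b * n / 2) (by positivity)
    have h4 : K * n + 1 ≤ Real.exp (b * n / 2) := by nlinarith
    have h5 : (1 : ℝ) ≤ Real.exp (b * n / 2) := Real.one_le_exp (by positivity)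
    calc (F.card : ℝ) ≤ (K * n + 1) * Real.exp (b * n / 2) := by linarith
      _ ≤ Real.exp (b * n / 2) * Real.exp (b * n / 2) :=
          mul_le_mul_of_nonneg_right h4 (Real.exp_pos _).le
      _ = _ := by rw [← Real.exp_add]; ring_nf
  · right
    push Not at H
    obtain ⟨S₁, hS₁, hne, hav⟩ := H
    by_contra! hcon
    have hcard : (0 : ℝ) < S₁.card := by exact_mod_cast hne.card_pos
    have hlow := pow_le_card_patternShatterer (κ := κ)
      (c := Real.exp (-(b * n / 4)) * S₁.card) (by positivity) hε.le hε1.le S₁ (by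
        intro S' hS' hc
        refine exists_balanced_coordinate S' (L := L)
          (D := Real.exp (-(b * n / 2)) * S₁.card) hL.le (fun τ => ?_) ?_
        · exact (Nat.cast_le.mpr (Finset.card_le_card
            (Finset.filter_subset_filter _ hS'))).trans (hav τ).le
        · refine lt_of_lt_of_le ?_ hc
          rw [← mul_assoc, ← Real.exp_add]
          refine mul_lt_mul_of_pos_right (Real.exp_lt_exp.mpr ?_) hcard
          nlinarith [mul_le_mul_of_nonneg_right hLε hn.le, mul_pos hb hn])
      ⌊b * n / (4 * E)⌋₊ S₁ subset_rfl (by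
        refine mul_le_mul_of_nonneg_right ?_ hcard.le
        rw [← Real.exp_nat_mul]
        refine Real.exp_le_exp.mpr ?_
        have := Nat.floor_le (a := b * n / (4 * E)) (by positivity)
        rw [le_div_iff₀ (by positivity)] at this
        linarith)
    have hup : ((patternShatterer S₁).card : ℝ) * Real.exp (-(L₂ * d * n)) ≤
        Real.exp (Real.exp (-L₂) * n) := by
      calc _ = ∑ I ∈ patternShatterer S₁, Real.exp (-(L₂ * d * n)) := by simp
        _ ≤ ∑ I ∈ patternShatterer S₁, Real.exp (-L₂) ^ I.card := by
            refine Finset.sum_le_sum fun I hI => ?_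
            rw [← Real.exp_nat_mul]
            refine Real.exp_le_exp.mpr ?_
            have h1 : (I.card : ℝ) < d * n := by
              by_contra! h
              exact hcon I h ((Finset.mem_filter.mp hI).2.mono hS₁)
            nlinarith
        _ ≤ ∑ I : Finset (Fin n), Real.exp (-L₂) ^ I.card :=
            Finset.sum_le_univ_sum_of_nonneg fun I => by positivity
        _ = (1 + Real.exp (-L₂)) ^ n := sum_pow_card_finset n _
        _ ≤ Real.exp (Real.exp (-L₂)) ^ n := by
            refine pow_le_pow_left₀ (by positivity) ?_ n
            linarith [Real.add_one_le_exp (Real.exp (-L₂))]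
        _ = Real.exp (Real.exp (-L₂) * n) := by rw [← Real.exp_nat_mul, mul_comm (n : ℝ)]
    have hfin := (mul_le_mul_of_nonneg_right hlow (Real.exp_pos (-(L₂ * d * n))).le).trans hup
    rw [← hQk, ← Real.exp_nat_mul, ← Real.exp_add, Real.exp_le_exp] at hfin
    have hm := Nat.lt_floor_add_one (b * n / (4 * E))
    have h1 := mul_le_mul_of_nonneg_right hLd hn.le
    have h2 : Q * b / (8 * E) * n = Q * (b * n / (4 * E)) / 2 := by field_simp; ring
    have h3 : 2 < b * n / (4 * E) := by rw [lt_div_iff₀ (by positivity)]; linarith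
    have h4 := mul_lt_mul_of_pos_left hm hQ
    have h5 := mul_lt_mul_of_pos_left h3 hQ
    linarith

end Patterns

section Independence

variable {X κ κ' ι : Type*}

/-- `I` is an independence set for the tuple `A` under iteration of `T`. -/
def IndepOn (T : X → X) (A : κ → Set X) (I : Finset ℕ) : Prop :=
  ∀ σ : ℕ → κ, ∃ x, ∀ i ∈ I, T^[i] x ∈ A (σ i)

/-- The tuple `A` has independence sets of positive upper density in initial segments. -/
def PosIndep (T : X → X) (A : κ → Set X) : Prop :=
  ∃ d : ℝ, 0 < d ∧ ∃ᶠ n : ℕ in atTop,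
    ∃ I ⊆ Finset.range n, d * n ≤ (I.card : ℝ) ∧ IndepOn T A I

/-- The itineraries in `F` cover `X` with respect to the family `V`. -/
def IsItineraryCover (T : X → X) (V : κ → Set X) (n : ℕ) (F : Finset (Fin n → κ)) : Prop :=
  ∀ x, ∃ σ ∈ F, ∀ i : Fin n, T^[i] x ∈ V (σ i)

theorem IndepOn.reindex {T : X → X} {A : κ → Set X} {B : κ' → Set X} {I : Finset ℕ}
    (h : IndepOn T A I) (f : κ' → κ) (hf : ∀ b, A (f b) ⊆ B b) : IndepOn T B I := fun σ =>
  let ⟨x, hx⟩ := h (f ∘ σ)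
  ⟨x, fun i hi => hf _ (hx i hi)⟩

theorem PosIndep.reindex {T : X → X} {A : κ → Set X} {B : κ' → Set X}
    (h : PosIndep T A) (f : κ' → κ) (hf : ∀ b, A (f b) ⊆ B b) : PosIndep T B := by
  obtain ⟨d, hd, h⟩ := h
  exact ⟨d, hd, h.mono fun n ⟨I, hI, hc, hi⟩ => ⟨I, hI, hc, hi.reindex f hf⟩⟩

theorem PosIndep.nonempty {T : X → X} {A : κ → Set X} (h : PosIndep T A) (a : κ) :
    (A a).Nonempty := by
  obtain ⟨d, hd, h⟩ := h
  obtain ⟨n, ⟨I, -, hc, hi⟩, hn⟩ := (h.and_eventually (eventually_gt_atTop 0)).exists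
  have hn : (0 : ℝ) < n := by exact_mod_cast hn
  have : (0 : ℝ) < I.card := (mul_pos hd hn).trans_le hc
  obtain ⟨i, hI⟩ := Finset.card_pos.mp (by exact_mod_cast this : 0 < I.card)
  obtain ⟨x, hx⟩ := hi fun _ => a
  exact ⟨_, hx i hI⟩

open Classical in
theorem exists_itineraryCover_or_indepOn [Fintype κ] [Nontrivial κ] (T : X → X) {A : κ → Set X}
    (hA : Pairwise (Function.onFun Disjoint A)) {b : ℝ} (hb : 0 < b) :
    ∃ d : ℝ, 0 < d ∧ ∀ᶠ n : ℕ in atTop,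
      (∃ F : Finset (Fin n → κ), (F.card : ℝ) ≤ Real.exp (b * n) ∧
        IsItineraryCover T (fun a => (A a)ᶜ) n F) ∨
      ∃ I ⊆ Finset.range n, d * n ≤ (I.card : ℝ) ∧ IndepOn T A I := by
  obtain ⟨d, hd, h⟩ := exists_avoiding_set_or_patternShatters (κ := κ) hb
  refine ⟨d, hd, h.mono fun n hn => ?_⟩
  let letter : X → Option κ := fun y => if h : ∃ a, y ∈ A a then some h.choose else none
  have hletter : ∀ y a, letter y = some a ↔ y ∈ A a := by
    intro y a
    by_cases h : ∃ a, y ∈ A a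
    · simp only [letter, dif_pos h, Option.some.injEq]
      refine ⟨fun e => e ▸ h.choose_spec, fun hy => ?_⟩
      by_contra hne
      exact Set.disjoint_left.mp (hA hne) h.choose_spec hy
    · simp only [letter, dif_neg h]
      exact ⟨fun e => by simp at e, fun hy => absurd ⟨a, hy⟩ h⟩
  let pat : X → Fin n → Option κ := fun x i => letter (T^[i] x)
  rcases hn (Finset.univ.filter fun s => ∃ x, pat x = s) with ⟨F, hF, hcov⟩ | ⟨I, hI, hsh⟩
  · refine Or.inl ⟨F, hF, fun x => ?_⟩
    obtain ⟨τ, hτ, hav⟩ := hcov (pat x) (by simp)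
    exact ⟨τ, hτ, fun i hi => hav i ((hletter _ _).mpr hi)⟩
  · refine Or.inr ⟨I.map Fin.valEmbedding, ?_, by simpa using hI, fun σ => ?_⟩
    · intro i hi
      obtain ⟨j, -, rfl⟩ := Finset.mem_map.mp hi
      simp
    · obtain ⟨s, hs, h⟩ := hsh fun i => σ i
      obtain ⟨x, rfl⟩ := (Finset.mem_filter.mp hs).2
      refine ⟨x, fun i hi => ?_⟩
      obtain ⟨j, hj, rfl⟩ := Finset.mem_map.mp hi
      exact (hletter _ _).mp (h j hj)

open Classical in
theorem IsItineraryCover.exists_join [Fintype ι] {T : X → X} {n : ℕ} {V : κ → Set X}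
    {U : ι → κ' → Set X} (g : (ι → κ') → κ) (hg : ∀ f x, (∀ c, x ∈ U c (f c)) → x ∈ V (g f))
    {F : ι → Finset (Fin n → κ')} (hF : ∀ c, IsItineraryCover T (U c) n (F c)) :
    ∃ F' : Finset (Fin n → κ), F'.card ≤ ∏ c, (F c).card ∧ IsItineraryCover T V n F' := by
  refine ⟨(Fintype.piFinset F).image fun τ t => g fun c => τ c t,
    Finset.card_image_le.trans_eq (Fintype.card_piFinset F), fun x => ?_⟩
  choose τ hτ h using fun c => hF c x
  exact ⟨_, Finset.mem_image_of_mem _ (Fintype.mem_piFinset.mpr hτ),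
    fun i => hg _ _ fun c => h c i⟩

/-- If `V` has exponentially growing itinerary covers and is refined by the join of the covers
complementary to the tuples `A c`, then one of these tuples has positive independence density. -/
theorem exists_posIndep_of_refines [Fintype ι] [Fintype κ'] [Nontrivial κ'] (T : X → X)
    {V : κ → Set X} {A : ι → κ' → Set X}
    (hA : ∀ c, Pairwise (Function.onFun Disjoint (A c)))
    (g : (ι → κ') → κ) (hg : ∀ f x, (∀ c, x ∉ A c (f c)) → x ∈ V (g f))
    {b : ℝ} (hb : 0 < b)
    (hV : ∃ᶠ n : ℕ in atTop, ∀ F : Finset (Fin n → κ), IsItineraryCover T V n F →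
      Real.exp (b * n) ≤ F.card) : ∃ c, PosIndep T (A c) := by
  have hb' : 0 < b / (Fintype.card ι + 1) := by positivity
  choose d hd h using fun c => exists_itineraryCover_or_indepOn T (hA c) hb'
  by_contra! hcon
  have hcon' : ∀ c, ∀ᶠ n : ℕ in atTop,
      ¬ ∃ I ⊆ Finset.range n, d c * n ≤ (I.card : ℝ) ∧ IndepOn T (A c) I := fun c => by
    have := hcon c
    simp only [PosIndep, not_exists, not_and] at this
    exact not_frequently.mp (this (d c) (hd c))
  obtain ⟨n, hn, hcov, hn0⟩ := (hV.and_eventually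
    ((eventually_all.mpr fun c => (h c).and (hcon' c)).and (eventually_gt_atTop 0))).exists
  choose F hF hFc using fun c => (hcov c).1.resolve_right (hcov c).2
  obtain ⟨F', hF', hF'c⟩ := IsItineraryCover.exists_join g hg hFc
  have hn0 : (0 : ℝ) < n := by exact_mod_cast hn0
  have h1 := hn F' hF'c
  have h2 : (F'.card : ℝ) ≤ Real.exp (b / (Fintype.card ι + 1) * n) ^ Fintype.card ι := by
    calc (F'.card : ℝ) ≤ ∏ c, ((F c).card : ℝ) := by exact_mod_cast hF'
      _ ≤ ∏ _c : ι, Real.exp (b / (Fintype.card ι + 1) * n) :=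
          Finset.prod_le_prod (fun _ _ => Nat.cast_nonneg _) fun c _ => hF c
      _ = _ := by simp
  rw [← Real.exp_nat_mul] at h2
  have h3 := Real.exp_le_exp.mp (h1.trans h2)
  have h4 : (Fintype.card ι : ℝ) * (b / (Fintype.card ι + 1) * n) =
      b * n - b / (Fintype.card ι + 1) * n := by field_simp; ring
  have h5 := mul_pos hb' hn0
  linarith

open Classical in
theorem IndepOn.pow_card_le [Fintype κ] [Nonempty κ] {T : X → X} {A : κ → Set X} {n : ℕ}
    {I : Finset ℕ} (hI : I ⊆ Finset.range n) (h : IndepOn T A I) {F : Finset (Fin n → κ)}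
    (hF : IsItineraryCover T (fun a => (A a)ᶜ) n F) :
    Fintype.card κ ^ I.card ≤ F.card * (Fintype.card κ - 1) ^ I.card := by
  obtain ⟨a₀⟩ : Nonempty κ := inferInstance
  have hlt : ∀ i : I, (i : ℕ) < n := fun i => Finset.mem_range.mp (hI i.2)
  have hsub : (Finset.univ : Finset (I → κ)) ⊆
      F.biUnion fun τ => Fintype.piFinset fun i : I => Finset.univ.erase (τ ⟨i, hlt i⟩) := by
    intro σ _
    obtain ⟨x, hx⟩ := h fun i => if hi : i ∈ I then σ ⟨i, hi⟩ else a₀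
    obtain ⟨τ, hτ, hav⟩ := hF x
    refine Finset.mem_biUnion.mpr ⟨τ, hτ, Fintype.mem_piFinset.mpr fun i => ?_⟩
    refine Finset.mem_erase.mpr ⟨fun heq => ?_, Finset.mem_univ _⟩
    have h1 := hx i i.2
    rw [dif_pos i.2, heq] at h1
    exact hav ⟨i, hlt i⟩ h1
  have := (Finset.card_le_card hsub).trans (Finset.card_biUnion_le_card_mul _ _
    ((Fintype.card κ - 1) ^ I.card) fun τ _ => by simp [Finset.card_erase_of_mem])
  simpa using this

theorem PosIndep.exp_le_card [Fintype κ] [Nontrivial κ] {T : X → X} {A : κ → Set X}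
    (h : PosIndep T A) :
    ∃ b : ℝ, 0 < b ∧ ∃ᶠ n : ℕ in atTop, ∀ F : Finset (Fin n → κ),
      IsItineraryCover T (fun a => (A a)ᶜ) n F → Real.exp (b * n) ≤ F.card := by
  have hk : 2 ≤ Fintype.card κ := Fintype.one_lt_card
  have hk' : (2 : ℝ) ≤ Fintype.card κ := by exact_mod_cast hk
  obtain ⟨Q, hQ, hQk⟩ : ∃ Q, 0 < Q ∧ Real.exp Q = (Fintype.card κ : ℝ) / (Fintype.card κ - 1) := by
    have h1 : 1 < (Fintype.card κ : ℝ) / (Fintype.card κ - 1) := by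
      rw [lt_div_iff₀ (by linarith)]; linarith
    exact ⟨_, Real.log_pos h1, Real.exp_log (by linarith)⟩
  obtain ⟨d, hd, h⟩ := h
  refine ⟨Q * d, by positivity, h.mono fun n ⟨I, hI, hc, hi⟩ F hF => ?_⟩
  have h1 : (Fintype.card κ : ℝ) ^ I.card ≤ F.card * (Fintype.card κ - 1 : ℝ) ^ I.card := by
    have := hi.pow_card_le hI hF
    rw [← Nat.cast_le (α := ℝ)] at this
    push_cast [Nat.cast_sub (by omega : 1 ≤ Fintype.card κ)] at this
    exact this
  calc Real.exp (Q * d * n) ≤ Real.exp (I.card * Q) := Real.exp_le_exp.mpr (by nlinarith)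
    _ = ((Fintype.card κ : ℝ) / (Fintype.card κ - 1)) ^ I.card := by
        rw [Real.exp_nat_mul, hQk]
    _ ≤ F.card := by
        rw [div_pow, div_le_iff₀ (pow_pos (by linarith) _)]
        exact h1

/-- Positive independence density passes to suitable pieces with respect to a finite cover. -/
theorem PosIndep.exists_inter [Fintype κ] [Nontrivial κ] [Fintype ι] {T : X → X} {A : κ → Set X}
    (hA : Pairwise (Function.onFun Disjoint A)) (h : PosIndep T A) (C : ι → Set X)
    (hC : ⋃ j, C j = Set.univ) : ∃ c : κ → ι, PosIndep T fun a => A a ∩ C (c a) := by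
  classical
  obtain ⟨b, hb, hcov⟩ := h.exp_le_card
  have hg : ∀ f : (κ → ι) → κ, ∃ a, ∀ j, ∃ c, f c = a ∧ c a = j := by
    intro f
    by_contra! hcon
    choose c hc using hcon
    exact hc (f c) c rfl rfl
  choose g hg using hg
  refine exists_posIndep_of_refines T (A := fun (c : κ → ι) a => A a ∩ C (c a))
    (fun c a a' haa' => (hA haa').mono inter_subset_left inter_subset_left) g ?_ hb hcov
  intro f x hx hxA
  obtain ⟨j, hj⟩ := mem_iUnion.mp (hC.symm ▸ mem_univ x : x ∈ ⋃ j, C j)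
  obtain ⟨c, hfc, rfl⟩ := hg f j
  refine hx c ⟨?_, ?_⟩
  · rw [hfc]; exact hxA
  · rw [hfc]; exact hj

theorem exists_shift_of_card {d : ℝ} (hd : 0 < d) (M : ℕ) (hM : 0 < M) :
    ∃ R : ℕ, ∃ e : ℝ, 0 < e ∧ ∀ᶠ n : ℕ in atTop, ∀ I ⊆ Finset.range n, d * n ≤ (I.card : ℝ) →
      ∃ j : Fin R, ∃ J ⊆ I, e * n ≤ (J.card : ℝ) ∧ ∀ i ∈ J,
        i + (j + 1) * M ∈ I ∧ i + (j + 1) * M ∉ J := by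
  classical
  obtain ⟨R, hR⟩ := exists_nat_gt (4 / d)
  rw [div_lt_iff₀ hd] at hR
  have hR0 : (0 : ℝ) < R := by
    by_contra! h0
    nlinarith
  refine ⟨R, d / (4 * R), by positivity, ?_⟩
  filter_upwards [tendsto_natCast_atTop_atTop.eventually_ge_atTop ((R * M : ℕ) : ℝ)]
    with n hn I hI hcard
  by_contra! hcon
  let P : Fin R → Finset ℕ := fun j => I.filter fun i => i + (j + 1) * M ∈ I
  have hP : ∀ j, ((P j).card : ℝ) ≤ d / (2 * R) * n := by
    intro j
    have hN : 0 < ((j : ℕ) + 1) * M := by positivity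
    have hpar : ∀ p : Prop, (((P j).filter fun i => (Even (i / (((j : ℕ) + 1) * M)) ↔ p)).card : ℝ)
        ≤ d / (4 * R) * n := by
      intro p
      by_contra! hlt
      obtain ⟨i, hi, hi'⟩ := hcon j ((P j).filter fun i => (Even (i / (((j : ℕ) + 1) * M)) ↔ p))
        ((Finset.filter_subset _ _).trans (Finset.filter_subset _ _)) hlt.le
      have h1 := Finset.mem_filter.mp hi
      have h2 := Finset.mem_filter.mp (hi' (Finset.mem_filter.mp h1.1).2)
      have h3 := h2.2
      rw [Nat.add_div_right _ hN, Nat.even_add_one] at h3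
      tauto
    have hsplit := Finset.card_filter_add_card_filter_not (s := P j)
      fun i => Even (i / (((j : ℕ) + 1) * M))
    have h1 := hpar True
    have h2 := hpar False
    simp only [iff_true, iff_false] at h1 h2
    have h3 : ((P j).card : ℝ) ≤ d / (4 * R) * n + d / (4 * R) * n := by
      rw [← hsplit]; push_cast; exact add_le_add h1 h2
    refine h3.trans_eq ?_
    field_simp; ring
  let Lst : Finset ℕ := I.filter fun i => ∀ j : Fin R, i + (j + 1) * M ∉ I
  have hLst : R * Lst.card ≤ n + R * M := by
    have hinj : Set.InjOn (fun q : ℕ × ℕ => q.2 + q.1 * M)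
        ((Finset.range R ×ˢ Lst : Finset (ℕ × ℕ)) : Set (ℕ × ℕ)) := by
      have aux : ∀ j j' l l' : ℕ, j' < R → l ∈ Lst → l' ∈ Lst → l + j * M = l' + j' * M →
          ¬ j < j' := by
        intro j j' l l' hj' hl hl' he hjj
        refine (Finset.mem_filter.mp hl').2 ⟨j' - j - 1, by omega⟩ ?_
        have h1 : l' + ((j' - j - 1 : ℕ) + 1) * M = l := by
          obtain ⟨k, rfl⟩ : ∃ k, j' = j + k + 1 := ⟨j' - j - 1, by omega⟩
          have : j + k + 1 - j - 1 = k := by omega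
          rw [this]
          nlinarith
        simp only [h1]
        exact (Finset.mem_filter.mp hl).1
      rintro ⟨j, l⟩ hq ⟨j', l'⟩ hq' he
      simp only [Finset.coe_product, Set.mem_prod, Finset.mem_coe, Finset.mem_range] at hq hq' he
      have h1 := aux j j' l l' hq'.1 hq.2 hq'.2 he
      have h2 := aux j' j l' l hq.1 hq'.2 hq.2 he.symm
      have h3 : j = j' := by omega
      subst h3
      simpa using he
    have := Finset.card_le_card_of_injOn (t := Finset.range (n + R * M)) _ (fun q hq => ?_) hinj
    · simpa using this
    · simp only [Finset.coe_product, Set.mem_prod, Finset.mem_coe, Finset.mem_range] at hq ⊢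
      have h1 := Finset.mem_range.mp (hI (Finset.mem_filter.mp hq.2).1)
      have h2 : q.1 * M ≤ R * M := Nat.mul_le_mul_right _ hq.1.le
      omega
  have hIsub : I ⊆ Lst ∪ Finset.univ.biUnion P := by
    intro i hi
    by_cases h : ∀ j : Fin R, i + (j + 1) * M ∉ I
    · exact Finset.mem_union_left _ (Finset.mem_filter.mpr ⟨hi, h⟩)
    · push Not at h
      obtain ⟨j, hj⟩ := h
      exact Finset.mem_union_right _ (Finset.mem_biUnion.mpr
        ⟨j, Finset.mem_univ _, Finset.mem_filter.mpr ⟨hi, hj⟩⟩)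
  have hIcard : (I.card : ℝ) ≤ Lst.card + ∑ j, ((P j).card : ℝ) := by
    have := (Finset.card_le_card hIsub).trans ((Finset.card_union_le _ _).trans
      (Nat.add_le_add_left Finset.card_biUnion_le _))
    exact_mod_cast this
  have hsum : ∑ j, ((P j).card : ℝ) ≤ d / 2 * n := by
    refine (Finset.sum_le_sum fun j _ => hP j).trans_eq ?_
    simp only [Finset.sum_const, Finset.card_univ, Fintype.card_fin, nsmul_eq_mul]
    field_simp
  have hLst' : (R : ℝ) * Lst.card ≤ n + (R * M : ℕ) := by exact_mod_cast hLst
  have hn0 : (0 : ℝ) < n := lt_of_lt_of_le (by push_cast; positivity) hn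
  have h1 : (R : ℝ) * (d * n) ≤ R * (Lst.card + d / 2 * n) :=
    mul_le_mul_of_nonneg_left (by linarith) hR0.le
  have h2 := mul_lt_mul_of_pos_right hR hn0
  linarith

/-- Independence of `A` at positive density yields independence of the tuple of intersections
`A a ∩ T⁻ᴺ A b` for arbitrarily large `N`. -/
theorem PosIndep.exists_shift {T : X → X} {A : κ → Set X} (h : PosIndep T A) (M : ℕ) :
    ∃ N, M ≤ N ∧ PosIndep T fun p : κ × κ => A p.1 ∩ T^[N] ⁻¹' A p.2 := by
  classical
  obtain ⟨d, hd, h⟩ := h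
  obtain ⟨R, e, he, hev⟩ := exists_shift_of_card hd (M + 1) M.succ_pos
  by_contra! hcon
  have hcon' : ∀ j : Fin R, ∀ᶠ n : ℕ in atTop, ¬ ∃ J ⊆ Finset.range n, e * n ≤ (J.card : ℝ) ∧
      IndepOn T (fun p : κ × κ => A p.1 ∩ T^[(j + 1) * (M + 1)] ⁻¹' A p.2) J := fun j => by
    have := hcon ((j + 1) * (M + 1)) (by nlinarith)
    simp only [PosIndep, not_exists, not_and] at this
    simpa using this e he
  obtain ⟨n, ⟨I, hI, hc, hi⟩, hn, hnot⟩ :=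
    (h.and_eventually (hev.and (eventually_all.mpr hcon'))).exists
  obtain ⟨j, J, hJ, hJc, hJI⟩ := hn I hI hc
  refine hnot j ⟨J, hJ.trans hI, hJc, fun σ => ?_⟩
  obtain ⟨x, hx⟩ := hi fun t => if t ∈ J then (σ t).1 else (σ (t - (j + 1) * (M + 1))).2
  refine ⟨x, fun i hiJ => ⟨?_, ?_⟩⟩
  · simpa [hiJ] using hx i (hJ hiJ)
  · have := hx _ (hJI i hiJ).1
    rw [if_neg (hJI i hiJ).2, Nat.add_sub_cancel, add_comm i, Function.iterate_add_apply] at this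
    exact this

end Independence

theorem covNumOpen_le_card {X : Type*} {T : X → X} {l n : ℕ} {V : Fin l → Set X}
    {F : Finset (Fin n → Fin l)} (hF : IsItineraryCover T V n F) : covNumOpen T V n ≤ F.card := by
  refine Nat.sInf_le ⟨F, rfl, eq_univ_of_forall fun x => ?_⟩
  obtain ⟨σ, hσ, h⟩ := hF x
  exact mem_iUnion₂.mpr ⟨σ, hσ, mem_iInter.mpr h⟩

/-- A finite open cover of positive entropy yields a pair of disjoint closed sets of positive
independence density. -/
theorem exists_closed_pair_posIndep {X : Type*} [TopologicalSpace X] [NormalSpace X] (T : X → X)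
    {l : ℕ} {V : Fin l → Set X} (hV : ∀ i, IsOpen (V i)) (hcov : ⋃ i, V i = Set.univ) {h : ℝ}
    (hh : 0 < h)
    (hlim : Tendsto (fun n : ℕ => Real.log (covNumOpen T V n : ℝ) / n) atTop (nhds h)) :
    ∃ A : Bool → Set X, (∀ β, IsClosed (A β)) ∧ Pairwise (Function.onFun Disjoint A) ∧
      PosIndep T A := by
  classical
  have hgrowth : ∀ᶠ n : ℕ in atTop, Real.exp (h / 2 * n) ≤ covNumOpen T V n := by
    filter_upwards [hlim.eventually_const_lt (half_lt_self hh), eventually_gt_atTop 0] with n hn hn0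
    have hn0 : (0 : ℝ) < n := by exact_mod_cast hn0
    rw [lt_div_iff₀ hn0] at hn
    have hpos : (0 : ℝ) < covNumOpen T V n := by
      rcases (Nat.cast_nonneg (α := ℝ) (covNumOpen T V n)).eq_or_lt with h0 | h0
      · rw [← h0, Real.log_zero] at hn
        exact absurd hn (not_lt.mpr (by positivity))
      · exact h0
    exact ((Real.lt_log_iff_exp_lt hpos).mp hn).le
  have hl : Nonempty (Fin l) := by
    by_contra hl
    rw [not_nonempty_iff] at hl
    have hX : IsEmpty X := by rwa [iUnion_of_empty, eq_comm, univ_eq_empty_iff] at hcov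
    obtain ⟨n, hn⟩ := hgrowth.exists
    have h0 : covNumOpen T V n ≤ 0 := covNumOpen_le_card (F := ∅) fun x => hX.elim x
    rw [Nat.le_zero.mp h0, Nat.cast_zero] at hn
    exact absurd hn (not_le.mpr (Real.exp_pos _))
  obtain ⟨W, hWcov, hWc, hWV⟩ := exists_iUnion_eq_closed_subset hV (fun _ => Set.toFinite _) hcov
  let A : Fin l → Bool → Set X := fun i β => if β then (V i)ᶜ else W i
  have hdisj : ∀ i, Disjoint (W i) (V i)ᶜ := fun i => disjoint_compl_right_iff_subset.mpr (hWV i)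
  have hA : ∀ i, Pairwise (Function.onFun Disjoint (A i)) := by
    intro i β β' hne
    cases β <;> cases β' <;> simp_all [A, Function.onFun, disjoint_comm]
  obtain ⟨i, hi⟩ := exists_posIndep_of_refines T hA
    (fun f => if h : ∃ i, f i = true then h.choose else Classical.arbitrary _)
    (fun f x hx => by
      obtain ⟨i, hi⟩ := mem_iUnion.mp (hWcov.symm ▸ mem_univ x : x ∈ ⋃ i, W i)
      have hex : ∃ i, f i = true := by
        refine ⟨i, ?_⟩
        by_contra hf
        exact hx i (by simpa [A, hf] using hi)
      rw [dif_pos hex]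
      have := hx hex.choose
      rw [hex.choose_spec] at this
      simpa [A] using this)
    (half_pos hh)
    (hgrowth.frequently.mono fun n hn F hF =>
      hn.trans (Nat.cast_le.mpr (covNumOpen_le_card hF)))
  refine ⟨A i, fun β => ?_, hA i, hi⟩
  cases β
  · simpa [A] using hWc i
  · simpa [A] using (hV i).isClosed_compl

/-- Given a tuple of disjoint closed sets of positive independence density, each of its members
can be split in two so that, at some late times, all pieces come together at a small scale and the
two halves visit prescribed members of the tuple. -/
theorem PosIndep.exists_split {X κ : Type*} [MetricSpace X] [CompactSpace X] [Fintype κ]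
    [Nontrivial κ] {T : X → X} (hT : Continuous T) {A : κ → Set X} (hAc : ∀ a, IsClosed (A a))
    (hA : Pairwise (Function.onFun Disjoint A)) (h : PosIndep T A) {f : Bool → κ}
    (hf : Function.Injective f) (M : ℕ) {δ : ℝ} (hδ : 0 < δ) :
    ∃ B : κ × Bool → Set X, (∀ p, IsClosed (B p)) ∧ Pairwise (Function.onFun Disjoint B) ∧
      PosIndep T B ∧ (∀ p, B p ⊆ A p.1) ∧
      (∃ n, M ≤ n ∧ ∀ p q, ∀ x ∈ B p, ∀ y ∈ B q, dist (T^[n] x) (T^[n] y) ≤ δ) ∧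
      ∃ n, M ≤ n ∧ ∀ p, ∀ x ∈ B p, T^[n] x ∈ A (f p.2) := by
  obtain ⟨t, -, htfin, ht⟩ :=
    finite_cover_balls_of_compact (isCompact_univ (X := X)) (half_pos hδ)
  have := htfin.fintype
  obtain ⟨c, hc⟩ := h.exists_inter hA (fun j : t => Metric.closedBall (j : X) (δ / 2)) (by
    refine eq_univ_of_forall fun x => ?_
    obtain ⟨j, hj, hx⟩ := mem_iUnion₂.mp (ht (mem_univ x))
    exact mem_iUnion.mpr ⟨⟨j, hj⟩, Metric.ball_subset_closedBall hx⟩)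
  obtain ⟨N, hN, hsh⟩ := hc.exists_shift M
  let D : κ → Set X := fun a => (A a ∩ Metric.closedBall (c a : X) (δ / 2)) ∩
    T^[N] ⁻¹' (A (f true) ∩ Metric.closedBall (c (f true) : X) (δ / 2))
  have hDA : ∀ a, D a ⊆ A a := fun a x hx => hx.1.1
  have hDc : ∀ a, IsClosed (D a) := fun a => ((hAc a).inter Metric.isClosed_closedBall).inter
    (((hAc _).inter Metric.isClosed_closedBall).preimage (hT.iterate N))
  have hD : PosIndep T D := hsh.reindex (fun a => (a, f true)) fun _ => subset_rfl
  obtain ⟨N', hN', hsh'⟩ := hD.exists_shift M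
  refine ⟨fun p => D p.1 ∩ T^[N'] ⁻¹' D (f p.2),
    fun p => (hDc _).inter ((hDc _).preimage (hT.iterate N')), ?_,
    hsh'.reindex (fun p => (p.1, f p.2)) fun _ => subset_rfl, fun p x hx => hDA _ hx.1,
    ⟨N, hN, fun p q x hx y hy => ?_⟩, N', hN', fun p x hx => hDA _ hx.2⟩
  · rintro ⟨a, β⟩ ⟨a', β'⟩ hne
    refine Set.disjoint_left.mpr fun x hx hx' => ?_
    by_cases ha : a = a'
    · have hβ : f β ≠ f β' := fun e => hne (by rw [ha, hf e])
      exact Set.disjoint_left.mp (hA hβ) (hDA _ hx.2) (hDA _ hx'.2)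
    · exact Set.disjoint_left.mp (hA ha) (hDA _ hx.1) (hDA _ hx'.1)
  · have h1 := Metric.mem_closedBall.mp hx.1.2.2
    have h2 := Metric.mem_closedBall.mp hy.1.2.2
    linarith [dist_triangle_right (T^[N] x) (T^[N] y) (c (f true) : X)]

/-- A disjoint closed pair of positive independence density gives points indexed by binary
sequences which at arbitrarily late times are jointly close, and at other late times follow the
digits of their index. -/
theorem PosIndep.exists_coded_points {X : Type*} [MetricSpace X] [CompactSpace X] {T : X → X}
    (hT : Continuous T) {A : Bool → Set X} (hAc : ∀ β, IsClosed (A β))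
    (hA : Pairwise (Function.onFun Disjoint A)) (h : PosIndep T A) :
    ∃ x : (ℕ → Bool) → X,
      (∀ m : ℕ, ∃ n, m ≤ n ∧ ∀ ω ω', dist (T^[n] (x ω)) (T^[n] (x ω')) ≤ 1 / ((m : ℝ) + 1)) ∧
      ∀ m : ℕ, ∃ n, m ≤ n ∧ ∀ ω, T^[n] (x ω) ∈ A (ω (m + 1)) := by
  let Stage : ℕ → Type _ := fun m => {B : (Fin (m + 1) → Bool) → Set X //
    (∀ a, IsClosed (B a)) ∧ Pairwise (Function.onFun Disjoint B) ∧ PosIndep T B ∧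
    ∃ f : Bool → Fin (m + 1) → Bool, Function.Injective f ∧ ∀ β, B (f β) ⊆ A β}
  have hstep : ∀ m (S : Stage m), ∃ S' : Stage (m + 1),
      (∀ a, S'.1 a ⊆ S.1 (Fin.init a)) ∧
      (∃ n, m ≤ n ∧ ∀ a b, ∀ x ∈ S'.1 a, ∀ y ∈ S'.1 b,
        dist (T^[n] x) (T^[n] y) ≤ 1 / ((m : ℝ) + 1)) ∧
      ∃ n, m ≤ n ∧ ∀ a, ∀ x ∈ S'.1 a, T^[n] x ∈ A (a (Fin.last (m + 1))) := by
    rintro m ⟨B, hBc, hB, hBP, f, hf, hfA⟩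
    obtain ⟨B', hBc', hB', hBP', hsub, ⟨n, hn, hclose⟩, n', hn', hvisit⟩ :=
      hBP.exists_split hT hBc hB hf m (δ := 1 / ((m : ℝ) + 1)) (by positivity)
    let r : (Fin (m + 1 + 1) → Bool) → (Fin (m + 1) → Bool) × Bool :=
      fun a => (Fin.init a, a (Fin.last (m + 1)))
    have hr : Function.Injective r := by
      intro a b hab
      have h1 : Fin.init a = Fin.init b := congrArg Prod.fst hab
      have h2 : a (Fin.last (m + 1)) = b (Fin.last (m + 1)) := congrArg Prod.snd hab
      rw [← Fin.snoc_init_self a, ← Fin.snoc_init_self b, h1, h2]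
    refine ⟨⟨fun a => B' (r a), fun a => hBc' _, fun a b hab => hB' (hr.ne hab),
      hBP'.reindex r fun _ => subset_rfl, fun β => Fin.snoc (f β) true, ?_, ?_⟩,
      fun a => hsub _, ⟨n, hn, fun a b => hclose _ _⟩, n', hn', fun a x hx => hfA _ (hvisit _ x hx)⟩
    · intro β β' hββ
      have := congrArg Fin.init hββ
      exact hf (by simpa using this)
    · intro β
      refine (hsub _).trans ?_
      simpa [r] using hfA β
  choose next hnest hclose hvisit using hstep
  have S₀ : Stage 0 :=
    ⟨fun a => A (a 0), fun a => hAc _, fun a b hab => hA fun h0 => hab (by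
        funext i
        obtain rfl : i = 0 := Fin.ext (by omega)
        exact h0), h.reindex (fun a => a 0) fun _ => subset_rfl,
      fun β _ => β, fun β β' hβ => congrFun hβ 0, fun β => subset_rfl⟩
  let S : ∀ m, Stage m := fun m => Nat.rec S₀ next m
  let K : (ℕ → Bool) → ℕ → Set X := fun ω m => (S m).1 fun i => ω i
  have hK : ∀ ω, (⋂ m, K ω m).Nonempty := fun ω =>
    IsCompact.nonempty_iInter_of_sequence_nonempty_isCompact_isClosed (K ω)
      (fun m => hnest m (S m) fun i => ω i) (fun m => (S m).2.2.2.1.nonempty _)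
      ((S 0).2.1 _).isCompact fun m => (S m).2.1 _
  choose x hx using hK
  have hx : ∀ ω m, x ω ∈ K ω m := fun ω => mem_iInter.mp (hx ω)
  refine ⟨x, fun m => ?_, fun m => ?_⟩
  · obtain ⟨n, hn, h⟩ := hclose m (S m)
    exact ⟨n, hn, fun ω ω' => h _ _ _ (hx ω (m + 1)) _ (hx ω' (m + 1))⟩
  · obtain ⟨n, hn, h⟩ := hvisit m (S m)
    exact ⟨n, hn, fun ω => by simpa using h _ _ (hx ω (m + 1))⟩

/-- positive topological entropy implies Li–Yorke chaos
(Corollary `C-LY`).  `h_top(T) > 0` (the supremum over all finite open covers of the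
cover entropies is positive) is expressed by the existence of a finite open cover whose
entropy (a limit, which exists by subadditivity) is positive. -/
theorem stmt12 {X : Type*} [MetricSpace X] [CompactSpace X]
    (T : X → X) (hT : Continuous T) (hTs : Function.Surjective T)
    (hent : ∃ (l : ℕ) (V : Fin l → Set X), (∀ i, IsOpen (V i)) ∧ (⋃ i, V i) = Set.univ ∧
      ∃ h : ℝ, 0 < h ∧
        Tendsto (fun n : ℕ => Real.log (covNumOpen T V n : ℝ) / n) atTop (nhds h)) :
    ∃ Z : Set X, ¬Z.Countable ∧ ∀ x ∈ Z, ∀ y ∈ Z, x ≠ y →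
      0 < Filter.limsup (fun n : ℕ => dist (T^[n] x) (T^[n] y)) atTop ∧
      Filter.liminf (fun n : ℕ => dist (T^[n] x) (T^[n] y)) atTop = 0 := by
  obtain ⟨l, V, hV, hcov, h, hh, hlim⟩ := hent
  obtain ⟨A, hAc, hA, hAP⟩ := exists_closed_pair_posIndep T hV hcov hh hlim
  obtain ⟨x, hclose, hvisit⟩ := hAP.exists_coded_points hT hAc hA
  obtain ⟨r, hr, hsep⟩ := Metric.exists_pos_forall_lt_edist (hAc true).isCompact (hAc false)
    (hA Bool.noConfusion)
  have hsep' : ∀ β β', β ≠ β' → ∀ y ∈ A β, ∀ z ∈ A β', (r : ℝ) ≤ dist y z := by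
    have key : ∀ y ∈ A true, ∀ z ∈ A false, (r : ℝ) ≤ dist y z := by
      intro y hy z hz
      have := hsep y hy z hz
      rw [edist_nndist] at this
      exact_mod_cast this.le
    rintro (_ | _) (_ | _) hne y hy z hz
    · exact absurd rfl hne
    · rw [dist_comm]; exact key z hz y hy
    · exact key y hy z hz
    · exact absurd rfl hne
  -- Each digit is repeated infinitely often, so distinct codes differ infinitely often.
  let code : (ℕ → Bool) → ℕ → Bool := fun ω m => ω (Nat.unpair (m - 1)).1
  have hfar : ∀ ω ω', ω ≠ ω' →
      ∃ᶠ n : ℕ in atTop, (r : ℝ) ≤ dist (T^[n] (x (code ω))) (T^[n] (x (code ω'))) := by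
    intro ω ω' hne
    obtain ⟨j, hj⟩ := Function.ne_iff.mp hne
    refine frequently_atTop.mpr fun N => ?_
    obtain ⟨n, hn, hv⟩ := hvisit (Nat.pair j N)
    refine ⟨n, (Nat.right_le_pair j N).trans hn, hsep' _ _ ?_ _ (hv _) _ (hv _)⟩
    simpa [code] using hj
  have hr' : (0 : ℝ) < r := by exact_mod_cast hr
  have hinj : Function.Injective fun ω => x (code ω) := by
    intro ω ω' he
    by_contra hne
    obtain ⟨n, hn⟩ := (hfar ω ω' hne).exists
    rw [show x (code ω) = x (code ω') from he, dist_self] at hn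
    linarith
  refine ⟨Set.range fun ω => x (code ω), fun hcount => ?_, ?_⟩
  · have : Countable (ℕ → Bool) := by
      have := hcount.to_subtype
      exact (Set.rangeFactorization_injective.mpr hinj).countable
    have hcard := Cardinal.mk_le_aleph0_iff.mpr this
    simp only [← Cardinal.power_def, Cardinal.mk_bool, Cardinal.mk_nat] at hcard
    exact absurd hcard (not_le.mpr (Cardinal.cantor _))
  · rintro _ ⟨ω, rfl⟩ _ ⟨ω', rfl⟩ hne
    have hbdd : ∀ n : ℕ, dist (T^[n] (x (code ω))) (T^[n] (x (code ω'))) ≤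
        Metric.diam (Set.univ : Set X) := fun n =>
      Metric.dist_le_diam_of_mem isCompact_univ.isBounded (mem_univ _) (mem_univ _)
    have habove : IsBoundedUnder (· ≤ ·) atTop
        fun n : ℕ => dist (T^[n] (x (code ω))) (T^[n] (x (code ω'))) :=
      isBoundedUnder_of ⟨_, hbdd⟩
    have hbelow : IsBoundedUnder (· ≥ ·) atTop
        fun n : ℕ => dist (T^[n] (x (code ω))) (T^[n] (x (code ω'))) :=
      isBoundedUnder_of ⟨0, fun _ => dist_nonneg⟩
    refine ⟨hr'.trans_le (le_limsup_of_frequently_le (hfar ω ω' fun e => hne (by rw [e])) habove),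
      le_antisymm (le_of_forall_pos_le_add fun ε hε => ?_)
        (le_liminf_of_le habove.isCoboundedUnder_ge (Eventually.of_forall fun _ => dist_nonneg))⟩
    rw [zero_add]
    refine liminf_le_of_frequently_le (frequently_atTop.mpr fun N => ?_) hbelow
    obtain ⟨k, hk⟩ := exists_nat_one_div_lt hε
    obtain ⟨n, hn, hc⟩ := hclose (max N k)
    refine ⟨n, (le_max_left N k).trans hn, (hc _ _).trans (le_trans ?_ hk.le)⟩
    have : (k : ℝ) ≤ (max N k : ℕ) := by exact_mod_cast le_max_right N k
    exact one_div_le_one_div_of_le (by positivity) (by linarith)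
end
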